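/- Let Ω be a Runge domain in ℂ^{m−1}, let Y be a Nash subset of Ω × ℂ of pure dimension k < m with proper projection onto Ω, let Ω₀ be an open relatively compact subset of Ω, and let r > 0, where B₁(r) denotes the open ball of radius r in ℂ. Then there exists a purely k-dimensional algebraic subset Ỹ of ℂ^{m−1} × ℂ such that Y ∩ (Ω₀ × B₁(r)) is the union of some of the analytic irreducible components of Ỹ ∩ (Ω₀ × B₁(r)); moreover, Ỹ may be chosen so that the projection of Ỹ onto ℂ^{m−1} is a proper mapping (after composing with a suitable ℂ-linear change of coordinates of ℂ^m, replacing Ω₀ × B₁(r) by a suitable product Ω₁ × B₁(s)). -/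

import Mathlib

open Set Filter Topology MvPolynomial

noncomputable section

/-- The complex Euclidean space `ℂ^N`. -/
abbrev CE (N : ℕ) := Fin N → ℂ

/-- The natural projection `ℂ^{a+b} → ℂ^a` (onto the first `a` coordinates). -/
def projFst (a b : ℕ) (z : CE (a + b)) : CE a := fun i => z (Fin.castAdd b i)

/-- The natural projection `ℂ^{a+b} → ℂ^b` (onto the last `b` coordinates). -/
def projSnd (a b : ℕ) (z : CE (a + b)) : CE b := fun i => z (Fin.natAdd a i)

/-- The cylinder `U × ℂ^b ⊆ ℂ^{a+b}` over `U ⊆ ℂ^a`. -/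
def cylOver {a : ℕ} (b : ℕ) (U : Set (CE a)) : Set (CE (a + b)) :=
  {z | projFst a b z ∈ U}

/-- The product `U × B ⊆ ℂ^{a+b}` of `U ⊆ ℂ^a` and `B ⊆ ℂ^b`. -/
def prodSet {a b : ℕ} (U : Set (CE a)) (B : Set (CE b)) : Set (CE (a + b)) :=
  {z | projFst a b z ∈ U ∧ projSnd a b z ∈ B}

/-- The open ball of radius `r` in `ℂ = ℂ^1`. -/
def ball1 (r : ℝ) : Set (CE 1) := {w | ‖w 0‖ < r}

/-- The open Euclidean ball of radius `t` in `ℂ^l`. -/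
def eball (l : ℕ) (t : ℝ) : Set (CE l) := {x | ∑ i, ‖x i‖ ^ 2 < t ^ 2}

/-- An algebraic subset of `ℂ^N`: the common zero set of finitely many polynomials. -/
def IsAlgebraicSet {N : ℕ} (X : Set (CE N)) : Prop :=
  ∃ s : Finset (MvPolynomial (Fin N) ℂ), X = {z | ∀ p ∈ s, eval z p = 0}

/-- An analytic subset `X` of an open set `Ω ⊆ ℂ^N`: locally (at every point of `Ω`)
the common zero set of finitely many holomorphic functions. -/
def IsAnalyticSet {N : ℕ} (Ω X : Set (CE N)) : Prop :=
  X ⊆ Ω ∧ ∀ z ∈ Ω, ∃ U : Set (CE N), IsOpen U ∧ z ∈ U ∧ U ⊆ Ω ∧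
    ∃ s : Finset (CE N → ℂ), (∀ f ∈ s, AnalyticOnNhd ℂ f U) ∧
      X ∩ U = {w ∈ U | ∀ f ∈ s, f w = 0}

/-- `X` is, near `a`, a `d`-dimensional complex submanifold of `ℂ^N`: there is a local
biholomorphism straightening `X` to the linear subspace `{z : z_i = 0 for i ≥ d}`. -/
def IsSubmanifoldPtOfDim {N : ℕ} (X : Set (CE N)) (d : ℕ) (a : CE N) : Prop :=
  ∃ (V W : Set (CE N)) (φ ψ : CE N → CE N),
    IsOpen V ∧ a ∈ V ∧ IsOpen W ∧
    AnalyticOnNhd ℂ φ V ∧ AnalyticOnNhd ℂ ψ W ∧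
    MapsTo φ V W ∧ MapsTo ψ W V ∧
    (∀ x ∈ V, ψ (φ x) = x) ∧ (∀ y ∈ W, φ (ψ y) = y) ∧
    φ '' (X ∩ V) = W ∩ {z | ∀ i : Fin N, d ≤ (i : ℕ) → z i = 0}

/-- `X` is purely `k`-dimensional: every point of `X` near which `X` is a submanifold is a
point of dimension exactly `k`, and such (regular) points are dense in `X`. -/
def PureDimOf {N : ℕ} (X : Set (CE N)) (k : ℕ) : Prop :=
  (∀ a ∈ X, a ∈ closure {b | b ∈ X ∧ IsSubmanifoldPtOfDim X k b}) ∧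
  (∀ b ∈ X, ∀ d, IsSubmanifoldPtOfDim X d b → d = k)

/-- The singular locus of `X`: the points of `X` at which `X` is not locally a submanifold. -/
def singLocus {N : ℕ} (X : Set (CE N)) : Set (CE N) :=
  {a ∈ X | ¬ ∃ d, IsSubmanifoldPtOfDim X d a}

/-- An irreducible analytic subset of the open set `Ω`. -/
def IsIrreducibleAnalyticSet {N : ℕ} (Ω X : Set (CE N)) : Prop :=
  IsAnalyticSet Ω X ∧ X.Nonempty ∧
  ∀ A B : Set (CE N), IsAnalyticSet Ω A → IsAnalyticSet Ω B → X = A ∪ B → X = A ∨ X = B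

/-- `C` is an (analytic) irreducible component of the analytic set `X ⊆ Ω`:
an irreducible analytic subset of `Ω` contained in `X`, maximal among such. -/
def IsIrreducibleComponent {N : ℕ} (Ω X C : Set (CE N)) : Prop :=
  IsIrreducibleAnalyticSet Ω C ∧ C ⊆ X ∧
  ∀ C' : Set (CE N), IsIrreducibleAnalyticSet Ω C' → C ⊆ C' → C' ⊆ X → C' = C

/-- `A` is the union of some of the analytic irreducible components of `X` in `Ω`. -/
def IsUnionOfComponents {N : ℕ} (Ω X A : Set (CE N)) : Prop :=
  ∃ 𝒞 : Set (Set (CE N)), (∀ C ∈ 𝒞, IsIrreducibleComponent Ω X C) ∧ A = ⋃₀ 𝒞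

/-- The germ of the analytic set `Z` at `a` is irreducible. -/
def GermIrreducibleAt {N : ℕ} (Z : Set (CE N)) (a : CE N) : Prop :=
  ∀ U A B : Set (CE N), IsOpen U → a ∈ U → IsAnalyticSet U A → IsAnalyticSet U B →
    Z ∩ U = A ∪ B →
    (∃ V, IsOpen V ∧ a ∈ V ∧ Z ∩ V = A ∩ V) ∨ (∃ V, IsOpen V ∧ a ∈ V ∧ Z ∩ V = B ∩ V)

/-- A Nash function on the open set `U ⊆ ℂ^N`: a holomorphic function annihilated,
locally around every point of `U`, by a nonzero polynomial `P(x, f(x)) = 0`. -/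
def IsNashFn {N : ℕ} (U : Set (CE N)) (f : CE N → ℂ) : Prop :=
  AnalyticOnNhd ℂ f U ∧ ∀ x₀ ∈ U, ∃ V : Set (CE N), IsOpen V ∧ x₀ ∈ V ∧ V ⊆ U ∧
    ∃ P : MvPolynomial (Fin (N + 1)) ℂ, P ≠ 0 ∧
      ∀ x ∈ V, eval (Fin.snoc x (f x)) P = 0

/-- A Nash subset `Y` of the open set `Ω ⊆ ℂ^N`: locally (at every point of `Ω`) the common
zero set of finitely many Nash functions. -/
def IsNashSet {N : ℕ} (Ω Y : Set (CE N)) : Prop :=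
  Y ⊆ Ω ∧ ∀ y ∈ Ω, ∃ U : Set (CE N), IsOpen U ∧ y ∈ U ∧ U ⊆ Ω ∧
    ∃ s : Finset (CE N → ℂ), (∀ f ∈ s, IsNashFn U f) ∧
      Y ∩ U = {x ∈ U | ∀ f ∈ s, f x = 0}

/-- `U` is a domain of holomorphy in `ℂ^N`. -/
def IsDomainOfHolomorphy {N : ℕ} (U : Set (CE N)) : Prop :=
  IsOpen U ∧ ¬ ∃ U₁ U₂ : Set (CE N), IsOpen U₁ ∧ IsOpen U₂ ∧ U₁.Nonempty ∧
    U₁ ⊆ U ∩ U₂ ∧ IsConnected U₂ ∧ ¬ U₂ ⊆ U ∧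
    ∀ f : CE N → ℂ, AnalyticOnNhd ℂ f U →
      ∃ F : CE N → ℂ, AnalyticOnNhd ℂ F U₂ ∧ EqOn f F U₁

/-- A Runge domain in `ℂ^N`: a domain of holomorphy on which every holomorphic function can be
approximated uniformly on compact subsets by polynomials. -/
def IsRungeDomain {N : ℕ} (U : Set (CE N)) : Prop :=
  IsDomainOfHolomorphy U ∧
  ∀ f : CE N → ℂ, AnalyticOnNhd ℂ f U → ∀ K : Set (CE N), IsCompact K → K ⊆ U →
    ∀ ε : ℝ, 0 < ε → ∃ p : MvPolynomial (Fin N) ℂ, ∀ z ∈ K, ‖f z - eval z p‖ < ε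

/-- The projection `ℂ^{a+b} → ℂ^a` restricted to `X` maps `X` into `U` and is proper over `U`. -/
def ProperProjTo {a b : ℕ} (X : Set (CE (a + b))) (U : Set (CE a)) : Prop :=
  (∀ z ∈ X, projFst a b z ∈ U) ∧
  ∀ K : Set (CE a), IsCompact K → K ⊆ U → IsCompact {z ∈ X | projFst a b z ∈ K}

/-- Local uniform convergence of the closed subsets `Y ν` of `W` to `Y'`. -/
def LocUnifConvSets {N : ℕ} (W : Set (CE N)) (Y : ℕ → Set (CE N)) (Y' : Set (CE N)) : Prop :=
  (∀ a ∈ Y', ∃ u : ℕ → CE N, (∀ ν, u ν ∈ Y ν) ∧ Tendsto u atTop (𝓝 a)) ∧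
  ∀ K : Set (CE N), IsCompact K → K ⊆ W → K ∩ Y' = ∅ → ∀ᶠ ν in atTop, K ∩ Y ν = ∅

/-- `X` and `T` meet transversally at `a`: their tangent spaces at `a` span `ℂ^N`. -/
def TransversalAt {N : ℕ} (X T : Set (CE N)) (a : CE N) : Prop :=
  Submodule.span ℂ (tangentConeAt ℂ X a ∪ tangentConeAt ℂ T a) = ⊤

/-- `T` is a `d`-dimensional complex submanifold of the open set `W`. -/
def IsSubmanifoldOfDim {N : ℕ} (W T : Set (CE N)) (d : ℕ) : Prop :=
  T ⊆ W ∧ ∀ a ∈ T, IsSubmanifoldPtOfDim T d a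

/-- Convergence, in the open set `W ⊆ ℂ^N`, of the purely `k`-dimensional analytic sets `Z ν`
to the purely `k`-dimensional analytic set `Z'` in the sense of holomorphic chains (all
multiplicities being `1`): local uniform convergence of supports, together with the degree
condition: for every regular point `a` of `Z'` and every `(N-k)`-dimensional submanifold `T`
transversal to `Z'` at `a`, with compact closure contained in `W` and meeting `Z'` only at `a`
(so that `deg(Z' · T) = 1`), for almost all `ν` the chain `Z ν · T` also has degree one, i.e.
`Z ν` meets `T` in exactly one point, which is a regular point of `Z ν` where the intersection
is transversal. -/
def ChainsConvTo {N : ℕ} (W : Set (CE N)) (k : ℕ) (Z : ℕ → Set (CE N))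
    (Z' : Set (CE N)) : Prop :=
  LocUnifConvSets W Z Z' ∧
  ∀ (a : CE N) (T : Set (CE N)), a ∈ Z' → IsSubmanifoldPtOfDim Z' k a →
    IsSubmanifoldOfDim W T (N - k) → IsCompact (closure T) → closure T ⊆ W →
    Z' ∩ closure T = {a} → TransversalAt Z' T a →
    ∀ᶠ ν in atTop, ∃ b, Z ν ∩ T = {b} ∧ IsSubmanifoldPtOfDim (Z ν) k b ∧
      TransversalAt (Z ν) T b

/-- A polynomial polyhedron in `ℂ^N`: a set of the form `{z : |q₁ z| ≤ c₁, …, |q_s z| ≤ c_s}`. -/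
def IsPolyPolyhedron {N : ℕ} (P : Set (CE N)) : Prop :=
  ∃ (s : Finset (MvPolynomial (Fin N) ℂ)) (c : MvPolynomial (Fin N) ℂ → ℝ),
    P = {z | ∀ q ∈ s, ‖eval z q‖ ≤ c q}

/-- A compact set `K ⊆ ℂ^N` is polynomially convex: it equals its polynomially convex hull. -/
def PolyConvex {N : ℕ} (K : Set (CE N)) : Prop :=
  K = {z | ∀ p : MvPolynomial (Fin N) ℂ,
    ‖eval z p‖ ≤ sSup ((fun w => ‖eval w p‖) '' K)}

/-- Sign condition used in the definition of semialgebraic sets. -/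
def signCond (c : Ordering) (t : ℝ) : Prop :=
  match c with
  | .lt => t < 0
  | .eq => t = 0
  | .gt => 0 < t

/-- Evaluation of a real polynomial in the `2m` real coordinates of `z ∈ ℂ^m`. -/
def realizeRe {m : ℕ} (p : MvPolynomial (Fin m ⊕ Fin m) ℝ) (z : CE m) : ℝ :=
  MvPolynomial.eval (Sum.elim (fun i => (z i).re) (fun i => (z i).im)) p

/-- A subset of `ℂ^m ≅ ℝ^{2m}` is semialgebraic: a finite union of finite intersections of
sets defined by polynomial sign conditions in the real coordinates. -/
def IsSemialgebraic {m : ℕ} (S : Set (CE m)) : Prop :=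
  ∃ (n r : ℕ) (P : Fin n → Fin r → MvPolynomial (Fin m ⊕ Fin m) ℝ)
    (σ : Fin n → Fin r → Ordering),
    S = ⋃ i, ⋂ j, {z | signCond (σ i j) (realizeRe (P i j) z)}

end

open Set Filter Topology MvPolynomial

section SCV
variable {E F : Type*} [NormedAddCommGroup E] [NormedSpace ℂ E]
  [NormedAddCommGroup F] [NormedSpace ℂ F]

/-- Cauchy estimate for the Fréchet derivative. -/
theorem cauchy_fderiv {f : E → F} {x : E} {ρ M : ℝ} (hρ : 0 < ρ)
    (hf : DifferentiableOn ℂ f (Metric.ball x ρ)) (hM : ∀ y ∈ Metric.ball x ρ, ‖f y‖ ≤ M) :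
    ‖fderiv ℂ f x‖ ≤ M / ρ := by
  have hM0 : 0 ≤ M := (norm_nonneg _).trans (hM x (Metric.mem_ball_self hρ))
  refine ContinuousLinearMap.opNorm_le_bound _ (by positivity) fun v => ?_
  by_cases hv : v = 0
  · simp [hv]
  have hv' : 0 < ‖v‖ := norm_pos_iff.2 hv
  -- for each σ < ρ/‖v‖
  have key : ∀ σ : ℝ, 0 < σ → σ < ρ → ‖fderiv ℂ f x v‖ ≤ M / (σ / ‖v‖) := by
    intro σ hσ hσρ
    have hs : 0 < σ / ‖v‖ := by positivity
    have hin : ∀ t : ℂ, ‖t‖ ≤ σ / ‖v‖ → x + t • v ∈ Metric.ball x ρ := by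
      intro t ht
      simp only [Metric.mem_ball, dist_self_add_left, norm_smul]
      calc ‖t‖ * ‖v‖ ≤ σ / ‖v‖ * ‖v‖ := by gcongr
        _ = σ := by field_simp
        _ < ρ := hσρ
    have hline : ∀ t : ℂ, HasFDerivAt (fun t : ℂ => x + t • v)
        ((ContinuousLinearMap.id ℂ ℂ).smulRight v) t := fun t =>
      ((ContinuousLinearMap.id ℂ ℂ).smulRight v).hasFDerivAt.const_add x
    have hd : deriv (fun t : ℂ => f (x + t • v)) 0 = fderiv ℂ f x v := by
      have h1 : DifferentiableAt ℂ f (x + (0:ℂ) • v) :=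
        hf.differentiableAt (Metric.isOpen_ball.mem_nhds (hin 0 (by simpa using hs.le)))
      have h2 := (h1.hasFDerivAt.comp (0:ℂ) (hline 0)).hasDerivAt.deriv
      simpa [Function.comp_def] using h2
    rw [← hd]
    refine Complex.norm_deriv_le_of_forall_mem_sphere_norm_le hs ?_ ?_
    · refine DifferentiableOn.diffContOnCl ?_
      rw [closure_ball _ hs.ne']
      intro t ht
      have ht' : ‖t‖ ≤ σ / ‖v‖ := by simpa using ht
      have h1 : DifferentiableAt ℂ f (x + t • v) :=
        hf.differentiableAt (Metric.isOpen_ball.mem_nhds (hin t ht'))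
      exact (h1.comp t (hline t).differentiableAt).differentiableWithinAt
    · intro t ht
      exact hM _ (hin t (by simpa using (le_of_eq (by simpa using ht))))
  have hlim : Tendsto (fun σ : ℝ => M / (σ / ‖v‖)) (𝓝[<] ρ) (𝓝 (M / (ρ / ‖v‖))) := by
    refine tendsto_nhdsWithin_of_tendsto_nhds ?_
    refine ContinuousAt.tendsto (f := fun σ : ℝ => M / (σ / ‖v‖)) ?_
    have : ρ / ‖v‖ ≠ 0 := by positivity
    fun_prop (disch := assumption)
  have := ge_of_tendsto hlim (by
    filter_upwards [Ioo_mem_nhdsLT hρ] with σ hσ using key σ hσ.1 hσ.2)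
  calc _ ≤ _ := this
    _ = M / ρ * ‖v‖ := by field_simp

/-- Uniform limits of holomorphic functions on a ball are holomorphic. -/
theorem differentiableAt_of_unif_limit [CompleteSpace F]
    {g : ℕ → E → F} {f : E → F}
    {x : E} {ρ : ℝ} (hρ : 0 < ρ) (hg : ∀ n, DifferentiableOn ℂ (g n) (Metric.ball x ρ))
    (hl : TendstoUniformlyOn g f atTop (Metric.ball x ρ)) : DifferentiableAt ℂ f x := by
  classical
  have hsub : ∀ y ∈ Metric.ball x (ρ/2), Metric.ball y (ρ/2) ⊆ Metric.ball x ρ := by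
    intro y hy
    refine Metric.ball_subset_ball' ?_
    rw [Metric.mem_ball] at hy; linarith
  have hdiff : ∀ n, ∀ y ∈ Metric.ball x (ρ/2), DifferentiableAt ℂ (g n) y := fun n y hy =>
    (hg n).differentiableAt (Metric.isOpen_ball.mem_nhds
      (hsub y hy (Metric.mem_ball_self (by linarith))))
  have hC : UniformCauchySeqOn (fun n => fderiv ℂ (g n)) atTop (Metric.ball x (ρ/2)) := by
    have h1 := hl.uniformCauchySeqOn
    rw [Metric.uniformCauchySeqOn_iff] at h1 ⊢
    intro ε hε
    obtain ⟨N, hN⟩ := h1 (ε * (ρ/2) / 2) (by positivity)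
    refine ⟨N, fun m hm n hn y hy => ?_⟩
    have h2 := cauchy_fderiv (f := fun z => g m z - g n z) (x := y) (ρ := ρ/2)
      (M := ε * (ρ/2) / 2) (by linarith) (((hg m).sub (hg n)).mono (hsub y hy))
      (fun z hz => by rw [← dist_eq_norm]; exact (hN m hm n hn z (hsub y hy hz)).le)
    rw [fderiv_fun_sub (hdiff m y hy) (hdiff n y hy)] at h2
    rw [dist_eq_norm]
    refine h2.trans_lt ?_
    rw [div_lt_iff₀ (by linarith)]
    have : 0 < ε * (ρ/2) := by positivity
    linarith
  have hcau : ∀ y ∈ Metric.ball x (ρ/2), ∃ L, Tendsto (fun n => fderiv ℂ (g n) y) atTop (𝓝 L) :=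
    fun y hy => cauchySeq_tendsto_of_complete (hC.cauchySeq hy)
  choose! L hL using hcau
  exact (hasFDerivAt_of_tendstoUniformlyOn Metric.isOpen_ball
    (hC.tendstoUniformlyOn_of_tendsto hL) (fun n y hy => (hdiff n y hy).hasFDerivAt)
    (fun y hy => hl.tendsto_at (Metric.ball_subset_ball (by linarith) hy))
    (Metric.mem_ball_self (by linarith))).differentiableAt

/-- Directional derivatives of holomorphic functions are holomorphic (bounded version). -/
theorem differentiableAt_fderiv_apply [CompleteSpace F] {f : E → F} {x : E} {ρ M : ℝ} (hρ : 0 < ρ)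
    (hf : DifferentiableOn ℂ f (Metric.ball x ρ)) (hM : ∀ y ∈ Metric.ball x ρ, ‖f y‖ ≤ M) (v : E) :
    DifferentiableAt ℂ (fun y => fderiv ℂ f y v) x := by
  have hM0 : 0 ≤ M := (norm_nonneg _).trans (hM x (Metric.mem_ball_self hρ))
  -- choose scaling
  set τ : ℝ := ρ / (4 * (‖v‖ + 1)) with hτ
  have hv : 0 < ‖v‖ + 1 := by positivity
  have hτ0 : 0 < τ := by positivity
  have hτv : τ * ‖v‖ < ρ / 4 := by
    have h1 : τ * (‖v‖ + 1) = ρ / 4 := by rw [hτ]; field_simp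
    nlinarith
  have hball : ∀ y ∈ Metric.ball x (ρ/2), ∀ t : ℂ, ‖t‖ ≤ 2 * τ → y + t • v ∈ Metric.ball x ρ := by
    intro y hy t ht
    rw [mem_ball_iff_norm] at hy ⊢
    calc ‖y + t • v - x‖ = ‖(y - x) + t • v‖ := by congr 1; abel
      _ ≤ ‖y - x‖ + ‖t‖ * ‖v‖ := (norm_add_le _ _).trans (by rw [norm_smul])
      _ ≤ ‖y - x‖ + 2 * τ * ‖v‖ := by gcongr
      _ < ρ := by linarith
  have hφ : ∀ y ∈ Metric.ball x (ρ/2), ∀ t : ℂ, ‖t‖ ≤ 2 * τ →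
      HasDerivAt (fun t : ℂ => f (y + t • v)) (fderiv ℂ f (y + t • v) v) t := by
    intro y hy t ht
    have h1 : DifferentiableAt ℂ f (y + t • v) :=
      hf.differentiableAt (Metric.isOpen_ball.mem_nhds (hball y hy t ht))
    have h2 := (h1.hasFDerivAt.comp t
      (((ContinuousLinearMap.id ℂ ℂ).smulRight v).hasFDerivAt.const_add y)).hasDerivAt
    simpa [Function.comp_def] using h2
  -- quadratic estimate
  have hquad : ∃ C : ℝ, 0 ≤ C ∧ ∀ y ∈ Metric.ball x (ρ/2), ∀ t : ℂ, ‖t‖ ≤ τ / 2 →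
      ‖f (y + t • v) - f y - t • fderiv ℂ f y v‖ ≤ C * ‖t‖ * ‖t‖ := by
    refine ⟨2 * M / (τ/2) ^ 2, by positivity, fun y hy t ht => ?_⟩
    set φ : ℂ → F := fun t : ℂ => f (y + t • v) with hφd
    have hd2 : DifferentiableOn ℂ φ (Metric.ball 0 (2 * τ)) := fun t ht =>
      (hφ y hy t (by simpa using (mem_ball_zero_iff.1 ht).le)).differentiableAt.differentiableWithinAt
    have hder : ∀ t : ℂ, ‖t‖ ≤ 2 * τ → deriv φ t = fderiv ℂ f (y + t • v) v :=
      fun t ht => (hφ y hy t ht).deriv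
    have hd3 : DifferentiableOn ℂ (deriv φ) (Metric.ball 0 (2 * τ)) :=
      hd2.deriv Metric.isOpen_ball
    have hφM : ∀ t : ℂ, ‖t‖ ≤ 2 * τ → ‖φ t‖ ≤ M := fun t ht => hM _ (hball y hy t ht)
    have hsubb : ∀ s : ℂ, ∀ a b : ℝ, ‖s‖ ≤ a → a + b ≤ 2 * τ → ∀ u ∈ Metric.closedBall s b,
        ‖u‖ ≤ 2 * τ := by
      intro s a b hs hab u hu
      rw [mem_closedBall_iff_norm] at hu
      calc ‖u‖ = ‖(u - s) + s‖ := by congr 1; ring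
        _ ≤ ‖u - s‖ + ‖s‖ := norm_add_le _ _
        _ ≤ 2 * τ := by linarith
    have hM1 : ∀ s : ℂ, ‖s‖ ≤ τ → ‖deriv φ s‖ ≤ M / (τ/2) := by
      intro s hs
      refine Complex.norm_deriv_le_of_forall_mem_sphere_norm_le (by positivity) ?_ ?_
      · refine DifferentiableOn.diffContOnCl ?_
        rw [closure_ball _ (by positivity)]
        refine hd2.mono fun u hu => ?_
        have : ‖u‖ ≤ ‖u - s‖ + ‖s‖ := by simpa using norm_add_le (u - s) s
        rw [mem_closedBall_iff_norm] at hu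
        rw [mem_ball_zero_iff]; linarith
      · intro u hu
        exact hφM u (hsubb s τ (τ/2) hs (by linarith) u (Metric.sphere_subset_closedBall hu))
    have hM2 : ∀ s : ℂ, ‖s‖ ≤ τ/2 → ‖deriv (deriv φ) s‖ ≤ M / (τ/2) / (τ/2) := by
      intro s hs
      refine Complex.norm_deriv_le_of_forall_mem_sphere_norm_le (by positivity) ?_ ?_
      · refine DifferentiableOn.diffContOnCl ?_
        rw [closure_ball _ (by positivity)]
        refine hd3.mono fun u hu => ?_
        have : ‖u‖ ≤ ‖u - s‖ + ‖s‖ := by simpa using norm_add_le (u - s) s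
        rw [mem_closedBall_iff_norm] at hu
        rw [mem_ball_zero_iff]; linarith
      · intro u hu
        refine hM1 u ?_
        have : ‖u‖ ≤ ‖u - s‖ + ‖s‖ := by simpa using norm_add_le (u - s) s
        rw [mem_sphere_iff_norm] at hu
        linarith
    have hcv : Convex ℝ (Metric.closedBall (0:ℂ) ‖t‖) := convex_closedBall _ _
    have hin : ∀ s ∈ Metric.closedBall (0:ℂ) ‖t‖, s ∈ Metric.ball (0:ℂ) (2 * τ) := by
      intro s hs
      rw [mem_closedBall_zero_iff] at hs
      rw [mem_ball_zero_iff]; linarith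
    have e1 : ∀ s ∈ Metric.closedBall (0:ℂ) ‖t‖, ‖deriv φ s - deriv φ 0‖ ≤
        M / (τ/2) / (τ/2) * ‖t‖ := by
      intro s hs
      have := hcv.norm_image_sub_le_of_norm_deriv_le (f := deriv φ) (C := M / (τ/2) / (τ/2))
        (fun u hu => hd3.differentiableAt (Metric.isOpen_ball.mem_nhds (hin u hu)))
        (fun u hu => hM2 u (by rw [mem_closedBall_zero_iff] at hu; linarith))
        (Metric.mem_closedBall_self (norm_nonneg _)) hs
      refine this.trans ?_
      rw [sub_zero]
      rw [mem_closedBall_zero_iff] at hs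
      gcongr
    have e2 := hcv.norm_image_sub_le_of_norm_deriv_le
      (f := fun s => φ s - s • deriv φ 0) (C := M / (τ/2) / (τ/2) * ‖t‖)
      (x := 0) (y := t)
      (fun u hu => (hd2.differentiableAt (Metric.isOpen_ball.mem_nhds (hin u hu))).sub
        (differentiableAt_id.smul_const _))
      (fun u hu => by
        have h1 := hd2.differentiableAt (Metric.isOpen_ball.mem_nhds (hin u hu))
        have h3 : deriv (fun s => φ s - s • deriv φ 0) u = deriv φ u - deriv φ 0 := by
          have := h1.hasDerivAt.sub ((hasDerivAt_id u).smul_const (deriv φ 0))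
          have h5 := this.deriv
          rw [one_smul] at h5
          exact h5
        rw [h3]
        exact e1 u hu)
      (Metric.mem_closedBall_self (norm_nonneg _)) (by simp)
    have h0 : deriv φ 0 = fderiv ℂ f y v := by
      have := hder 0 (by simpa using hτ0.le)
      simpa using this
    rw [h0] at e2
    have h4 : φ t - t • fderiv ℂ f y v - (φ 0 - (0:ℂ) • fderiv ℂ f y v) =
      f (y + t • v) - f y - t • fderiv ℂ f y v := by
      simp [hφd]; abel
    rw [h4, sub_zero] at e2
    refine e2.trans ?_
    have : M / (τ/2) / (τ/2) ≤ 2 * M / (τ/2)^2 := by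
      rw [div_div, ← sq]; gcongr; linarith
    gcongr
  obtain ⟨C, hC0, hC⟩ := hquad
  set t : ℕ → ℂ := fun n => ((τ / 2 / (n + 1) : ℝ) : ℂ) with ht
  have htn : ∀ n, ‖t n‖ = τ / 2 / (n + 1) := fun n => by
    rw [ht, Complex.norm_real, Real.norm_of_nonneg (by positivity)]
  have htle : ∀ n, ‖t n‖ ≤ τ / 2 := fun n => by
    rw [htn]; exact div_le_self (by positivity) (by linarith [(n.cast_nonneg : (0:ℝ) ≤ n)])
  have htne : ∀ n, t n ≠ 0 := fun n => by
    rw [← norm_pos_iff, htn]; positivity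
  refine differentiableAt_of_unif_limit (g := fun n y => (t n)⁻¹ • (f (y + t n • v) - f y))
    (ρ := ρ / 2) (by positivity) (fun n => ?_) ?_
  · refine DifferentiableOn.const_smul (DifferentiableOn.sub ?_ ?_) _
    · refine DifferentiableOn.comp (t := Metric.ball x ρ) hf (by fun_prop) fun y hy => ?_
      exact hball y hy _ ((htle n).trans (by linarith))
    · exact hf.mono (Metric.ball_subset_ball (by linarith))
  · rw [Metric.tendstoUniformlyOn_iff]
    intro ε hε
    have hlim : Tendsto (fun n : ℕ => C * ‖t n‖) atTop (𝓝 0) := by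
      have : Tendsto (fun n : ℕ => ‖t n‖) atTop (𝓝 0) := by
        simp only [htn]
        exact tendsto_const_div_atTop_nhds_zero_nat (τ/2) |>.comp (tendsto_add_atTop_nat 1) |>.congr
          fun n => by simp
      simpa using this.const_mul C
    filter_upwards [hlim.eventually (gt_mem_nhds hε)] with n hn y hy
    refine lt_of_le_of_lt ?_ hn
    have h1 := hC y hy (t n) (htle n)
    rw [dist_comm, dist_eq_norm]
    have h2 : (t n)⁻¹ • (f (y + t n • v) - f y) - fderiv ℂ f y v =
        (t n)⁻¹ • (f (y + t n • v) - f y - t n • fderiv ℂ f y v) := by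
      rw [smul_sub (t n)⁻¹ (f (y + t n • v) - f y), smul_smul, inv_mul_cancel₀ (htne n), one_smul]
    rw [h2, norm_smul, norm_inv]
    have h3 : 0 < ‖t n‖ := norm_pos_iff.2 (htne n)
    rw [inv_mul_le_iff₀ h3]
    linarith

/-- Holomorphic functions on finite dimensional spaces are `C^n`. -/
theorem scv_contDiffOn [FiniteDimensional ℂ E] [CompleteSpace F] {U : Set E}
    (hU : IsOpen U) (n : ℕ) : ∀ {f : E → F}, DifferentiableOn ℂ f U → ContDiffOn ℂ n f U := by
  induction n with
  | zero => intro f hf; exact contDiffOn_zero.2 hf.continuousOn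
  | succ n ih =>
    intro f hf
    have : ((n + 1 : ℕ) : WithTop ℕ∞) = (n : WithTop ℕ∞) + 1 := by norm_cast
    rw [this, contDiffOn_succ_iff_fderiv_of_isOpen hU]
    refine ⟨hf, fun h => by simp at h, ?_⟩
    rw [contDiffOn_clm_apply]
    intro v
    refine ih fun x hx => DifferentiableAt.differentiableWithinAt ?_
    have hc : ContinuousAt f x := (hf.differentiableAt (hU.mem_nhds hx)).continuousAt
    have h1 : {y | ‖f y‖ < ‖f x‖ + 1} ∈ 𝓝 x :=
      hc.norm.eventually (gt_mem_nhds (by linarith))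
    obtain ⟨ρ, hρ, hsub⟩ := Metric.mem_nhds_iff.1 (inter_mem (hU.mem_nhds hx) h1)
    exact differentiableAt_fderiv_apply hρ (hf.mono fun y hy => (hsub hy).1)
      (fun y hy => (hsub hy).2.le) v

theorem norm_iteratedFDeriv_le_aux [FiniteDimensional ℂ E] [CompleteSpace F] {f : E → F}
    {x : E} {ρ M : ℝ} (hρ : 0 < ρ)
    (hf : DifferentiableOn ℂ f (Metric.ball x ρ)) (hM : ∀ y ∈ Metric.ball x ρ, ‖f y‖ ≤ M)
    (n : ℕ) (hn : 0 < n) : ∀ j ≤ n, ∀ y ∈ Metric.ball x (ρ * (1 - j / n) ), 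
      ‖iteratedFDeriv ℂ j f y‖ ≤ M * (n / ρ) ^ j := by
  intro j
  have hn' : (0:ℝ) < n := by exact_mod_cast hn
  induction j with
  | zero => 
    intro _ y hy
    simpa using hM y (by simpa using hy)
  | succ j ih =>
    intro hj y hy
    have hrad : ρ * (1 - ((j + 1 : ℕ) : ℝ) / n) + ρ / n = ρ * (1 - j / n) := by
      push_cast; field_simp; ring
    have hsub : Metric.ball y (ρ / n) ⊆ Metric.ball x (ρ * (1 - j / n)) := by
      refine Metric.ball_subset_ball' ?_
      rw [Metric.mem_ball] at hy
      linarith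
    have hsub2 : Metric.ball x (ρ * (1 - j / n)) ⊆ Metric.ball x ρ := by
      refine Metric.ball_subset_ball ?_
      have : 0 ≤ (j:ℝ) / n := by positivity
      nlinarith
    rw [← norm_fderiv_iteratedFDeriv]
    have := cauchy_fderiv (f := iteratedFDeriv ℂ j f) (x := y) (ρ := ρ / n)
      (M := M * (n / ρ) ^ j) (by positivity) ?_ (fun z hz => ih (by omega) z (hsub hz))
    · refine this.trans (le_of_eq ?_)
      rw [pow_succ]; field_simp
    · intro z hz
      refine DifferentiableAt.differentiableWithinAt ?_
      have h2 := (scv_contDiffOn Metric.isOpen_ball (j + 1) hf).contDiffAt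
        (Metric.isOpen_ball.mem_nhds (hsub2 (hsub hz)))
      exact h2.differentiableAt_iteratedFDeriv (by norm_cast; omega)

theorem norm_iteratedFDeriv_le_of_ball [FiniteDimensional ℂ E] [CompleteSpace F] {f : E → F}
    {x : E} {ρ M : ℝ} (hρ : 0 < ρ)
    (hf : DifferentiableOn ℂ f (Metric.ball x ρ)) (hM : ∀ y ∈ Metric.ball x ρ, ‖f y‖ ≤ M)
    (n : ℕ) : ‖iteratedFDeriv ℂ n f x‖ ≤ M * Real.exp 1 * n.factorial * (Real.exp 1 / ρ) ^ n := by
  have hM0 : 0 ≤ M := (norm_nonneg _).trans (hM x (Metric.mem_ball_self hρ))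
  have h1 := norm_iteratedFDeriv_le_aux hρ hf hM (n + 1) (by omega) n (by omega) x
    (Metric.mem_ball_self (mul_pos hρ (by
      rw [sub_pos, div_lt_one (by positivity)]; push_cast; linarith)))
  have h2 := Real.pow_div_factorial_le_exp ((n + 1 : ℕ) : ℝ) (by positivity) (n + 1)
  refine h1.trans ?_
  rw [div_pow, div_pow, mul_assoc M, mul_assoc M]
  refine mul_le_mul_of_nonneg_left ?_ hM0
  rw [← mul_div_assoc]
  refine div_le_div_of_nonneg_right ?_ (by positivity)
  rw [div_le_iff₀ (by positivity)] at h2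
  have h3 : Real.exp ((n + 1 : ℕ) : ℝ) = Real.exp 1 * Real.exp 1 ^ n := by
    rw [← pow_succ', ← Real.exp_nat_mul]; simp
  rw [h3, Nat.factorial_succ, pow_succ] at h2
  push_cast at h2 ⊢
  have h4 : (0:ℝ) < (n:ℝ) + 1 := by positivity
  have h5 : ((n:ℝ) + 1) ^ n * ((n:ℝ) + 1) ≤
      (Real.exp 1 * n.factorial * Real.exp 1 ^ n) * ((n:ℝ) + 1) := by
    calc _ ≤ _ := h2
      _ = _ := by ring
  exact le_of_mul_le_mul_right h5 h4

/-- Taylor expansion along a line. -/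
theorem scv_hasSum_taylor [FiniteDimensional ℂ E] [CompleteSpace F] {f : E → F}
    {x : E} {ρ : ℝ} (hf : DifferentiableOn ℂ f (Metric.ball x ρ)) {w : E} (hw : ‖w‖ < ρ) :
    HasSum (fun n : ℕ => (n.factorial : ℂ)⁻¹ • iteratedFDeriv ℂ n f x (fun _ => w)) (f (x + w)) := by
  have hρ : 0 < ρ := (norm_nonneg _).trans_lt hw
  obtain ⟨R, hR1, hRw⟩ : ∃ R : ℝ, 1 < R ∧ R * ‖w‖ < ρ := by
    by_cases h0 : ‖w‖ = 0
    · exact ⟨2, by norm_num, by rw [h0]; simpa using hρ⟩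
    · have h0' : 0 < ‖w‖ := lt_of_le_of_ne (norm_nonneg _) (Ne.symm h0)
      obtain ⟨R, h1, h2⟩ := exists_between ((one_lt_div h0').2 hw)
      exact ⟨R, h1, (lt_div_iff₀ h0').1 h2⟩
  set s : Set ℂ := Metric.ball (0:ℂ) R with hs
  set g : ℂ →L[ℂ] E := (ContinuousLinearMap.id ℂ ℂ).smulRight w with hg
  set f' : E → F := fun z => f (x + z) with hf'
  have hgm : ∀ t ∈ s, x + g t ∈ Metric.ball x ρ := by
    intro t ht
    rw [hs, mem_ball_zero_iff] at ht
    simp only [Metric.mem_ball, dist_self_add_left, hg, ContinuousLinearMap.smulRight_apply,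
      ContinuousLinearMap.id_apply, norm_smul]
    exact lt_of_le_of_lt (by gcongr) hRw
  have hd : DifferentiableOn ℂ (f' ∘ g) s := by
    refine hf.comp (f := fun t => x + g t) (by fun_prop) hgm
  have h1 := Complex.hasSum_taylorSeries_on_ball (f := f' ∘ g) (c := 0) (r := R)
    (z := 1) hd (by simpa using hR1)
  have hU : IsOpen (g ⁻¹' (Metric.ball (0:E) ρ)) := Metric.isOpen_ball.preimage g.continuous
  have h2 : ∀ n : ℕ, iteratedDeriv n (f' ∘ g) 0 = iteratedFDeriv ℂ n f x (fun _ => w) := by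
    intro n
    rw [iteratedDeriv_eq_iteratedFDeriv]
    have hcd : ContDiffOn ℂ n f' (Metric.ball (0:E) ρ) := by
      refine scv_contDiffOn Metric.isOpen_ball n ?_
      refine hf.comp (by fun_prop) fun z hz => ?_
      simpa using hz
    have h0 : (0:ℂ) ∈ g ⁻¹' (Metric.ball (0:E) ρ) := by simpa using hρ
    have h3 := g.iteratedFDerivWithin_comp_right hcd Metric.isOpen_ball.uniqueDiffOn
      hU.uniqueDiffOn (x := 0) (by simpa using hρ) (i := n) le_rfl
    rw [iteratedFDerivWithin_of_isOpen n hU h0,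
      iteratedFDerivWithin_of_isOpen n Metric.isOpen_ball (by simpa using hρ)] at h3
    rw [h3]
    simp only [ContinuousMultilinearMap.compContinuousLinearMap_apply, map_zero]
    rw [hf', iteratedFDeriv_comp_add_left]
    simp [hg]
  simp only [h2] at h1
  simpa [hf', hg] using h1

/-- Holomorphic functions of several variables are analytic. -/
theorem scv_analytic [FiniteDimensional ℂ E] [CompleteSpace F] {f : E → F} {U : Set E}
    (hU : IsOpen U) (hf : DifferentiableOn ℂ f U) : AnalyticOnNhd ℂ f U := by
  intro x hx
  have hc : ContinuousAt f x := (hf.differentiableAt (hU.mem_nhds hx)).continuousAt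
  have h1 : {y | ‖f y‖ < ‖f x‖ + 1} ∈ 𝓝 x :=
    hc.norm.eventually (gt_mem_nhds (by linarith))
  obtain ⟨ρ, hρ, hsub⟩ := Metric.mem_nhds_iff.1 (inter_mem (hU.mem_nhds hx) h1)
  set M := ‖f x‖ + 1
  have hM0 : 0 ≤ M := by positivity
  have hdf : DifferentiableOn ℂ f (Metric.ball x ρ) := hf.mono fun y hy => (hsub hy).1
  set p : FormalMultilinearSeries ℂ E F := fun n => (n.factorial : ℂ)⁻¹ • iteratedFDeriv ℂ n f x
  obtain ⟨r, hr⟩ : ∃ r : NNReal, (r : ℝ) = ρ / Real.exp 1 := ⟨⟨ρ / Real.exp 1, by positivity⟩, rfl⟩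
  have hr0 : 0 < r := by rw [← NNReal.coe_pos, hr]; positivity
  have hrρ : (r : ℝ) ≤ ρ := by
    rw [hr]
    exact div_le_self hρ.le (Real.one_le_exp (by norm_num))
  refine ⟨p, r, ⟨?_, by simpa using hr0, fun {y} hy => ?_⟩⟩
  · refine p.le_radius_of_bound (M * Real.exp 1) fun n => ?_
    have h2 := norm_iteratedFDeriv_le_of_ball hρ hdf (fun y hy => (hsub hy).2.le) n
    simp only [p, norm_smul, norm_inv, Complex.norm_natCast]
    have h3 : (0:ℝ) < n.factorial := by positivity
    calc _ ≤ (n.factorial : ℝ)⁻¹ * (M * Real.exp 1 * n.factorial * (Real.exp 1 / ρ) ^ n) *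
          (r:ℝ) ^ n := by gcongr
      _ = M * Real.exp 1 * ((Real.exp 1 / ρ) * r) ^ n := by
          rw [mul_pow]; field_simp
      _ = M * Real.exp 1 := by
          have : Real.exp 1 / ρ * r = 1 := by rw [hr]; field_simp
          rw [this]; simp
      _ ≤ _ := le_rfl
  · have hy' : ‖y‖ < ρ := by
      have : ‖y‖ < r := by simpa using hy
      linarith
    simpa [p] using scv_hasSum_taylor hdf hy'
end SCV

open Set Filter Topology MvPolynomial

section SCV
variable {E : Type*} [NormedAddCommGroup E] [NormedSpace ℂ E] [FiniteDimensional ℂ E]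

/-- Holomorphic dependence of integrals on parameters. -/
theorem scv_param_integral {G : ℝ → E → ℂ} {a b : ℝ} (hab : a ≤ b) {O : Set E} (hO : IsOpen O)
    (hc : ContinuousOn (Function.uncurry G) (Icc a b ×ˢ O))
    (hd : ∀ t ∈ Icc a b, DifferentiableOn ℂ (G t) O) :
    DifferentiableOn ℂ (fun x => ∫ t in a..b, G t x) O := by
  intro x₀ hx₀
  refine DifferentiableAt.differentiableWithinAt ?_
  have : ProperSpace E := FiniteDimensional.proper ℂ E
  obtain ⟨ρ', hρ', hsub'⟩ := Metric.mem_nhds_iff.1 (hO.mem_nhds hx₀)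
  set ρ := ρ' / 2 with hρd
  have hρ : 0 < ρ := by positivity
  have hsub : Metric.closedBall x₀ ρ ⊆ O :=
    (Metric.closedBall_subset_ball (by linarith)).trans hsub'
  have hcomp : IsCompact (Icc a b ×ˢ Metric.closedBall x₀ ρ) :=
    isCompact_Icc.prod (isCompact_closedBall x₀ ρ)
  have hc' : ContinuousOn (Function.uncurry G) (Icc a b ×ˢ Metric.closedBall x₀ ρ) :=
    hc.mono (prod_mono le_rfl hsub)
  obtain ⟨M, hM⟩ := hcomp.exists_bound_of_continuousOn hc'
  have huc := hcomp.uniformContinuousOn_of_continuous hc'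
  rw [Metric.uniformContinuousOn_iff] at huc
  have hUI : Set.uIoc a b = Ioc a b := uIoc_of_le hab
  have hsl : ∀ x ∈ O, ContinuousOn (fun t => G t x) (Icc a b) := by
    intro x hx
    exact hc.comp (f := fun t => (t, x)) (by fun_prop) fun t ht => ⟨ht, hx⟩
  have hbb : ∀ y ∈ Metric.ball x₀ (ρ/2), Metric.ball y (ρ/2) ⊆ Metric.closedBall x₀ ρ := by
    intro y hy
    refine (Metric.ball_subset_ball' ?_).trans Metric.ball_subset_closedBall
    rw [Metric.mem_ball] at hy; linarith
  have hda : ∀ t ∈ Icc a b, ∀ y ∈ O, DifferentiableAt ℂ (G t) y := fun t ht y hy =>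
    (hd t ht).differentiableAt (hO.mem_nhds hy)
  refine (intervalIntegral.hasFDerivAt_integral_of_dominated_of_fderiv_le
    (F := fun x t => G t x) (F' := fun x t => fderiv ℂ (G t) x) (bound := fun _ => M / (ρ/2))
    (Metric.ball_mem_nhds x₀ (half_pos hρ)) ?_ ?_ ?_ ?_ ?_ ?_).differentiableAt
  · filter_upwards [hO.mem_nhds hx₀] with x hx
    rw [hUI]
    exact ((hsl x hx).mono Ioc_subset_Icc_self).aestronglyMeasurable measurableSet_Ioc
  · exact ContinuousOn.intervalIntegrable (by rw [uIcc_of_le hab]; exact hsl x₀ hx₀)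
  · rw [hUI]
    refine ContinuousOn.aestronglyMeasurable (ContinuousOn.mono ?_ Ioc_subset_Icc_self)
      measurableSet_Ioc
    rw [Metric.continuousOn_iff]
    intro t ht ε hε
    obtain ⟨η, hη, h1⟩ := huc (ε * ρ / 2) (by positivity)
    refine ⟨η, hη, fun s hs hst => ?_⟩
    have h2 := cauchy_fderiv (f := fun z => G s z - G t z) (x := x₀) (ρ := ρ)
      (M := ε * ρ / 2) hρ (((hd s hs).sub (hd t ht)).mono
        (Metric.ball_subset_closedBall.trans hsub)) (fun z hz => by
          rw [← dist_eq_norm]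
          refine (h1 (s, z) ⟨hs, Metric.ball_subset_closedBall hz⟩ (t, z)
            ⟨ht, Metric.ball_subset_closedBall hz⟩ ?_).le
          simpa [Prod.dist_eq, hη] using hst)
    rw [fderiv_fun_sub (hda s hs x₀ hx₀) (hda t ht x₀ hx₀)] at h2
    rw [dist_eq_norm]
    refine h2.trans_lt ?_
    rw [div_lt_iff₀ hρ]
    have : 0 < ε * ρ := by positivity
    linarith
  · refine Eventually.of_forall fun t ht x hx => ?_
    rw [hUI] at ht
    have ht' := Ioc_subset_Icc_self ht
    exact cauchy_fderiv (half_pos hρ) ((hd t ht').mono ((hbb x hx).trans hsub))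
      fun y hy => hM (t, y) ⟨ht', hbb x hx hy⟩
  · simp
  · refine Eventually.of_forall fun t ht x hx => ?_
    rw [hUI] at ht
    exact (hda t (Ioc_subset_Icc_self ht) x
      (hsub (hbb x hx (Metric.mem_ball_self (half_pos hρ))))).hasFDerivAt

/-- One variable removable singularities along a discrete set. -/
theorem scv_removable_one {O Z : Set ℂ} (hO : IsOpen O) {φ : ℂ → ℂ}
    (hZ : ∀ t ∈ O, ∀ᶠ u in 𝓝[≠] t, u ∉ Z) (hφ : ∀ t ∈ O, t ∉ Z → DifferentiableAt ℂ φ t)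
    (hb : ∀ t ∈ O, ∃ M : ℝ, ∀ᶠ u in 𝓝[≠] t, ‖φ u‖ ≤ M) :
    ∃ ψ : ℂ → ℂ, DifferentiableOn ℂ ψ O ∧ ∀ t ∈ O, t ∉ Z → ψ t = φ t := by
  have hreg : ∀ t ∈ O, t ∉ Z → limUnder (𝓝[≠] t) φ = φ t := fun t ht htZ =>
    ((hφ t ht htZ).continuousAt.tendsto.mono_left nhdsWithin_le_nhds).limUnder_eq
  refine ⟨fun t => limUnder (𝓝[≠] t) φ, fun t ht => ?_, hreg⟩
  refine DifferentiableAt.differentiableWithinAt ?_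
  obtain ⟨M, hM⟩ := hb t ht
  have h1 : ∀ᶠ u in 𝓝[≠] t, u ∉ Z ∧ ‖φ u‖ ≤ M := (hZ t ht).and hM
  rw [eventually_nhdsWithin_iff] at h1
  obtain ⟨ε, hε, hsub⟩ := Metric.mem_nhds_iff.1 (inter_mem h1 (hO.mem_nhds ht))
  have h2 : DifferentiableOn ℂ φ (Metric.ball t ε \ {t}) := fun u hu =>
    (hφ u (hsub hu.1).2 ((hsub hu.1).1 hu.2).1).differentiableWithinAt
  have h3 := Complex.differentiableOn_update_limUnder_of_bddAbove (Metric.ball_mem_nhds t hε) h2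
    ⟨M, by rintro _ ⟨u, hu, rfl⟩; exact ((hsub hu.1).1 hu.2).2⟩
  refine (h3.differentiableAt (Metric.ball_mem_nhds t hε)).congr_of_eventuallyEq ?_
  filter_upwards [Metric.ball_mem_nhds t hε] with u hu
  by_cases hut : u = t
  · subst hut; simp
  · rw [Function.update_of_ne hut]
    exact hreg u (hsub hu).2 ((hsub hu).1 hut).1

set_option linter.unusedSectionVars false in
theorem scv_line_ne {S : Set E} {δ : E → ℂ} (hδ : AnalyticOnNhd ℂ δ S) {x v : E} {r : ℝ}
    (hS : ∀ t ∈ Metric.ball (0:ℂ) r, x + t • v ∈ S) {t₁ : ℂ} (ht₁ : t₁ ∈ Metric.ball (0:ℂ) r)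
    (hne : δ (x + t₁ • v) ≠ 0) : ∀ t ∈ Metric.ball (0:ℂ) r, ∀ᶠ u in 𝓝[≠] t, δ (x + u • v) ≠ 0 := by
  intro t ht
  have han : AnalyticOnNhd ℂ (fun t : ℂ => δ (x + t • v)) (Metric.ball (0:ℂ) r) := by
    intro t ht
    exact AnalyticAt.comp (g := δ) (f := fun t : ℂ => x + t • v) (hδ _ (hS t ht)) (by fun_prop)
  by_contra hcon
  rw [not_eventually] at hcon
  simp only [not_not] at hcon
  exact hne (han.eqOn_zero_of_preconnected_of_frequently_eq_zero
    (convex_ball _ _).isPreconnected ht hcon ht₁)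

/-- Local form of the Riemann extension theorem. -/
theorem scv_riemann_local {S : Set E} (hS : IsOpen S) {δ s : E → ℂ} (hδ : AnalyticOnNhd ℂ δ S)
    (hs : ∀ x ∈ S, δ x ≠ 0 → DifferentiableAt ℂ s x)
    {x₀ : E} (hx₀ : x₀ ∈ S) (hfr : ∃ᶠ y in 𝓝 x₀, δ y ≠ 0)
    (hb : ∃ M : ℝ, ∀ᶠ y in 𝓝 x₀, δ y ≠ 0 → ‖s y‖ ≤ M) :
    ∃ η > 0, ∃ g : E → ℂ, DifferentiableOn ℂ g (Metric.ball x₀ η) ∧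
      ∀ x ∈ Metric.ball x₀ η, δ x ≠ 0 → g x = s x := by
  obtain ⟨M, hM⟩ := hb
  obtain ⟨R, hR, hsub⟩ := Metric.mem_nhds_iff.1 (inter_mem (hS.mem_nhds hx₀) hM)
  obtain ⟨y, hy1, hy2⟩ := (hfr.and_eventually
    (Metric.ball_mem_nhds x₀ (show 0 < R/4 by positivity))).exists
  set v := y - x₀ with hv
  have hvR : ‖v‖ < R / 4 := by rwa [dist_eq_norm] at hy2
  have hin : ∀ x ∈ Metric.ball x₀ (R/4), ∀ t : ℂ, ‖t‖ < 2 → x + t • v ∈ Metric.ball x₀ R := by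
    intro x hx t ht
    rw [mem_ball_iff_norm] at hx ⊢
    calc ‖x + t • v - x₀‖ = ‖(x - x₀) + t • v‖ := by congr 1; abel
      _ ≤ ‖x - x₀‖ + ‖t‖ * ‖v‖ := (norm_add_le _ _).trans (by rw [norm_smul])
      _ ≤ ‖x - x₀‖ + 2 * ‖v‖ := by gcongr
      _ < R := by linarith
  have hx₀b : x₀ ∈ Metric.ball x₀ (R/4) := Metric.mem_ball_self (by positivity)
  have h1 := scv_line_ne hδ (x := x₀) (v := v) (r := 2)
    (fun t ht => (hsub (hin x₀ hx₀b t (by simpa using ht))).1) (t₁ := 1) (by simp)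
    (by simpa [hv] using hy1) 0 (by simp)
  rw [eventually_nhdsWithin_iff, Metric.eventually_nhds_iff_ball] at h1
  obtain ⟨ρ₀, hρ₀, h1⟩ := h1
  set ρ := min (ρ₀/2) 1 with hρd
  have hρ : 0 < ρ := by positivity
  have hρ1 : ρ ≤ 1 := min_le_right _ _
  have hρ2 : ρ < ρ₀ := (min_le_left _ _).trans_lt (by linarith)
  have h2 : ∀ᶠ x in 𝓝 x₀, ∀ t ∈ Metric.sphere (0:ℂ) ρ, δ (x + t • v) ≠ 0 := by
    refine (isCompact_sphere (0:ℂ) ρ).eventually_forall_of_forall_eventually fun t ht => ?_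
    have ht' : ‖t‖ = ρ := by simpa using ht
    have h3 : δ (x₀ + t • v) ≠ 0 := h1 t (by simpa [ht'] using hρ2)
      (by rw [mem_compl_singleton_iff, ← norm_pos_iff, ht']; exact hρ)
    have h4 : ContinuousAt (fun z : E × ℂ => δ (z.1 + z.2 • v)) (x₀, t) := by
      refine ContinuousAt.comp (g := δ) (f := fun z : E × ℂ => z.1 + z.2 • v) ?_ (by fun_prop)
      exact (hδ _ (hsub (hin x₀ hx₀b t (by linarith))).1).continuousAt
    exact h4.eventually_ne h3
  obtain ⟨η₀, hη₀, h2⟩ := Metric.eventually_nhds_iff_ball.1 h2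
  set η := min η₀ (R/4) with hηd
  have hη : 0 < η := by positivity
  have hη1 : Metric.ball x₀ η ⊆ Metric.ball x₀ η₀ := Metric.ball_subset_ball (min_le_left _ _)
  have hη2 : Metric.ball x₀ η ⊆ Metric.ball x₀ (R/4) := Metric.ball_subset_ball (min_le_right _ _)
  have hcm : ∀ θ : ℝ, ‖circleMap 0 ρ θ‖ = ρ := fun θ => by
    simpa using abs_of_pos hρ
  have hsd : ∀ x ∈ Metric.ball x₀ η, ∀ θ : ℝ, DifferentiableAt ℂ s (x + circleMap 0 ρ θ • v) :=
    fun x hx θ => hs _ (hsub (hin x (hη2 hx) _ (by rw [hcm]; linarith))).1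
      (h2 x (hη1 hx) _ (by simpa using hcm θ))
  refine ⟨η, hη, fun x => (2 * Real.pi * Complex.I : ℂ)⁻¹ *
    ∮ t in C(0, ρ), (t - 0)⁻¹ • s (x + t • v), ?_, ?_⟩
  · refine DifferentiableOn.const_mul ?_ _
    simp only [circleIntegral]
    refine scv_param_integral (G := fun θ x => deriv (circleMap 0 ρ) θ •
      ((circleMap 0 ρ θ - 0)⁻¹ • s (x + circleMap 0 ρ θ • v))) Real.two_pi_pos.le Metric.isOpen_ball
      ?_ ?_
    · rintro ⟨θ, x⟩ ⟨_, hx⟩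
      refine ContinuousAt.continuousWithinAt ?_
      have hc0 : circleMap 0 ρ θ - 0 ≠ 0 := by
        rw [sub_zero, ← norm_pos_iff, hcm]; exact hρ
      have hc1 : ContinuousAt (fun z : ℝ × E => s (z.2 + circleMap 0 ρ z.1 • v)) (θ, x) := by
        refine ContinuousAt.comp (g := s) (f := fun z : ℝ × E => z.2 + circleMap 0 ρ z.1 • v)
          (hsd x hx θ).continuousAt ?_
        have := continuous_circleMap 0 ρ
        fun_prop
      have hc2 : ContinuousAt (fun z : ℝ × E => (circleMap 0 ρ z.1 - 0)⁻¹) (θ, x) := by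
        refine ContinuousAt.inv₀ ?_ hc0
        have := continuous_circleMap 0 ρ
        fun_prop
      have hc3 : ContinuousAt (fun z : ℝ × E => deriv (circleMap 0 ρ) z.1) (θ, x) := by
        simp only [deriv_circleMap]
        have := continuous_circleMap 0 ρ
        fun_prop
      exact hc3.smul (hc2.smul hc1)
    · intro θ _ x hx
      refine DifferentiableAt.differentiableWithinAt ?_
      refine DifferentiableAt.fun_const_smul (DifferentiableAt.fun_const_smul ?_ _) _
      exact DifferentiableAt.comp (g := s) x (hsd x hx θ) (by fun_prop)
  · intro x hx hδx
    have hxS : ∀ t ∈ Metric.ball (0:ℂ) 2, x + t • v ∈ Metric.ball x₀ R := fun t ht =>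
      hin x (hη2 hx) t (by simpa using ht)
    have h5 := scv_line_ne hδ (x := x) (v := v) (r := 2)
      (fun t ht => (hsub (hxS t ht)).1) (t₁ := 0) (by simp) (by simpa using hδx)
    obtain ⟨ψ, hψ1, hψ2⟩ := scv_removable_one (O := Metric.ball (0:ℂ) 2)
      (Z := {t | δ (x + t • v) = 0}) (φ := fun t => s (x + t • v)) Metric.isOpen_ball h5
      (fun t ht htZ => DifferentiableAt.comp (g := s) t (hs _ (hsub (hxS t ht)).1 htZ)
        (by fun_prop))
      (fun t ht => ⟨M, by
        have h6 : ∀ᶠ u in 𝓝[≠] t, u ∈ Metric.ball (0:ℂ) 2 :=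
          nhdsWithin_le_nhds (Metric.isOpen_ball.mem_nhds ht)
        filter_upwards [h5 t ht, h6] with u hu1 hu2 using (hsub (hxS u hu2)).2 hu1⟩)
    have h7 : ∮ t in C(0, ρ), (t - 0)⁻¹ • s (x + t • v) = ∮ t in C(0, ρ), (t - 0)⁻¹ • ψ t := by
      refine circleIntegral.integral_congr hρ.le fun t ht => ?_
      have ht' : ‖t‖ = ρ := by simpa using ht
      rw [hψ2 t (by simpa [ht'] using by linarith) (h2 x (hη1 hx) t ht)]
    have h8 : DiffContOnCl ℂ ψ (Metric.ball 0 ρ) := by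
      refine DifferentiableOn.diffContOnCl ?_
      rw [closure_ball _ hρ.ne']
      exact hψ1.mono (Metric.closedBall_subset_ball (by linarith))
    beta_reduce
    rw [h7, h8.circleIntegral_sub_inv_smul (Metric.mem_ball_self hρ)]
    have hψ0 := hψ2 0 (by simp) (by simpa using hδx)
    simp only [zero_smul, add_zero] at hψ0
    rw [hψ0, smul_eq_mul, ← mul_assoc, inv_mul_cancel₀ Complex.two_pi_I_ne_zero, one_mul]

/-- Riemann extension theorem. -/
theorem scv_riemann_ext {S : Set E} (hS : IsOpen S) {δ s : E → ℂ} (hδ : AnalyticOnNhd ℂ δ S)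
    (hs : ∀ x ∈ S, δ x ≠ 0 → DifferentiableAt ℂ s x)
    (hfr : ∀ x ∈ S, ∃ᶠ y in 𝓝 x, δ y ≠ 0)
    (hb : ∀ x ∈ S, ∃ M : ℝ, ∀ᶠ y in 𝓝 x, δ y ≠ 0 → ‖s y‖ ≤ M) :
    ∃ g : E → ℂ, AnalyticOnNhd ℂ g S ∧ ∀ x ∈ S, δ x ≠ 0 → g x = s x := by
  have hloc : ∀ x ∈ S, ∃ η > 0, ∃ g : E → ℂ, DifferentiableOn ℂ g (Metric.ball x η) ∧
      ∀ z ∈ Metric.ball x η, δ z ≠ 0 → g z = s z := fun x hx =>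
    scv_riemann_local hS hδ hs hx (hfr x hx) (hb x hx)
  choose! η hη g hg1 hg2 using hloc
  have hlim : ∀ x ∈ S, ∀ y ∈ S ∩ Metric.ball x (η x), 
      limUnder (𝓝[{z | δ z ≠ 0}] y) s = g x y := by
    intro x hx y hy
    have hne : (𝓝[{z | δ z ≠ 0}] y).NeBot := by
      rw [← mem_closure_iff_nhdsWithin_neBot, mem_closure_iff_frequently]
      exact hfr y hy.1
    have h1 : ContinuousAt (g x) y :=
      ((hg1 x hx).differentiableAt (Metric.isOpen_ball.mem_nhds hy.2)).continuousAt
    refine Tendsto.limUnder_eq ?_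
    refine (h1.tendsto.mono_left nhdsWithin_le_nhds).congr' ?_
    have h2 : ∀ᶠ z in 𝓝[{z | δ z ≠ 0}] y, z ∈ Metric.ball x (η x) :=
      nhdsWithin_le_nhds (Metric.isOpen_ball.mem_nhds hy.2)
    filter_upwards [h2, self_mem_nhdsWithin] with z hz1 hz2 using hg2 x hx z hz1 hz2
  refine ⟨fun y => limUnder (𝓝[{z | δ z ≠ 0}] y) s, scv_analytic hS fun x hx => ?_, ?_⟩
  · refine DifferentiableAt.differentiableWithinAt ?_
    refine ((hg1 x hx).differentiableAt (Metric.ball_mem_nhds x (hη x hx))).congr_of_eventuallyEq ?_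
    filter_upwards [hS.mem_nhds hx, Metric.ball_mem_nhds x (hη x hx)] with y h1 h2
      using hlim x hx y ⟨h1, h2⟩
  · intro x hx hδx
    rw [← hg2 x hx x (Metric.mem_ball_self (hη x hx)) hδx]
    exact hlim x hx x ⟨hx, Metric.mem_ball_self (hη x hx)⟩
end SCV

open Set Filter Topology MvPolynomial

section SCV

theorem poly_analytic {ι : Type*} [Fintype ι] (p : MvPolynomial ι ℂ) (S : Set (ι → ℂ)) :
    AnalyticOnNhd ℂ (fun z => eval z p) S :=
  (AnalyticOnNhd.eval_mvPolynomial p).mono (subset_univ S)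

theorem poly_frequently_ne {ι : Type*} [Fintype ι] {p : MvPolynomial ι ℂ} (hp : p ≠ 0) (x : ι → ℂ) :
    ∃ᶠ y in 𝓝 x, eval y p ≠ 0 := by
  rw [Filter.Frequently]
  intro h
  simp only [not_not] at h
  have h1 := (poly_analytic p univ).eqOn_zero_of_preconnected_of_eventuallyEq_zero
    isPreconnected_univ (mem_univ x) h
  exact hp (MvPolynomial.funext fun z => by simpa using h1 (mem_univ z))

theorem scv_iteratedDeriv_line {E F : Type*} [NormedAddCommGroup E] [NormedSpace ℂ E]
    [FiniteDimensional ℂ E] [NormedAddCommGroup F] [NormedSpace ℂ F] [CompleteSpace F] {f : E → F}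
    {x : E} {ρ : ℝ} (hρ : 0 < ρ) (hf : DifferentiableOn ℂ f (Metric.ball x ρ)) (w : E) (n : ℕ) :
    iteratedDeriv n (fun t : ℂ => f (x + t • w)) 0 = iteratedFDeriv ℂ n f x (fun _ => w) := by
  set g : ℂ →L[ℂ] E := (ContinuousLinearMap.id ℂ ℂ).smulRight w with hg
  set f' : E → F := fun z => f (x + z) with hf'
  have hU : IsOpen (g ⁻¹' (Metric.ball (0:E) ρ)) := Metric.isOpen_ball.preimage g.continuous
  have h4 : (fun t : ℂ => f (x + t • w)) = f' ∘ g := by ext t; simp [hf', hg]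
  rw [h4, iteratedDeriv_eq_iteratedFDeriv]
  have hcd : ContDiffOn ℂ n f' (Metric.ball (0:E) ρ) := by
    refine scv_contDiffOn Metric.isOpen_ball n ?_
    refine hf.comp (by fun_prop) fun z hz => ?_
    simpa using hz
  have h0 : (0:ℂ) ∈ g ⁻¹' (Metric.ball (0:E) ρ) := by simpa using hρ
  have h3 := g.iteratedFDerivWithin_comp_right hcd Metric.isOpen_ball.uniqueDiffOn
    hU.uniqueDiffOn (x := 0) (by simpa using hρ) (i := n) le_rfl
  rw [iteratedFDerivWithin_of_isOpen n hU h0,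
    iteratedFDerivWithin_of_isOpen n Metric.isOpen_ball (by simpa using hρ)] at h3
  rw [h3]
  simp only [ContinuousMultilinearMap.compContinuousLinearMap_apply, map_zero]
  rw [hf', iteratedFDeriv_comp_add_left]
  simp [hg]

/-- Polynomial approximation on polydiscs. -/
theorem scv_taylor_approx {ι : Type*} [Fintype ι] {f : (ι → ℂ) → ℂ} {R r : ℝ} (hr : 0 < r)
    (hrR : r < R)
    (hf : DifferentiableOn ℂ f (Metric.ball 0 R)) {ε : ℝ} (hε : 0 < ε) :
    ∃ p : MvPolynomial ι ℂ, ∀ z ∈ Metric.closedBall (0 : ι → ℂ) r, ‖f z - eval z p‖ < ε := by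
  classical
  have hR : 0 < R := hr.trans hrR
  obtain ⟨R', hR'1, hR'2⟩ := exists_between hrR
  have hR'0 : 0 < R' := hr.trans hR'1
  obtain ⟨M, hM⟩ := (isCompact_closedBall (0 : ι → ℂ) R').exists_bound_of_continuousOn
    (hf.continuousOn.mono (Metric.closedBall_subset_ball hR'2))
  have hM0 : 0 ≤ M := (norm_nonneg _).trans (hM 0 (by simp [hR'0.le]))
  set T : ℕ → (ι → ℂ) → ℂ := fun n w => (n.factorial : ℂ)⁻¹ • iteratedFDeriv ℂ n f 0 (fun _ => w)
    with hT
  have hpoly : ∀ n, ∃ p : MvPolynomial ι ℂ, ∀ w, eval w p = T n w := by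
    intro n
    refine ⟨C (n.factorial : ℂ)⁻¹ * ∑ r : Fin n → ι,
      (∏ j, X (r j)) * C (iteratedFDeriv ℂ n f 0 (fun j => Pi.single (r j) 1)), fun w => ?_⟩
    have hw : (fun _ : Fin n => w) = fun _ => ∑ i, w i • (Pi.single i 1 : ι → ℂ) := by
      funext _; exact pi_eq_sum_univ' w
    rw [hT]
    simp only
    rw [hw, ContinuousMultilinearMap.map_sum]
    simp only [ContinuousMultilinearMap.map_smul_univ]
    simp [map_sum, map_prod, smul_eq_mul]
  have hbound : ∀ n, ∀ w ∈ Metric.closedBall (0 : ι → ℂ) r, ‖T n w‖ ≤ M * (r / R') ^ n := by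
    intro n w hw
    rw [mem_closedBall_zero_iff] at hw
    have hin : ∀ t : ℂ, ‖t‖ ≤ R' / r → (0 : ι → ℂ) + t • w ∈ Metric.closedBall (0 : ι → ℂ) R' := by
      intro t ht
      rw [zero_add, mem_closedBall_zero_iff, norm_smul]
      calc ‖t‖ * ‖w‖ ≤ R' / r * r := by gcongr
        _ = R' := by field_simp
    have h1 := Complex.norm_iteratedDeriv_le_of_forall_mem_sphere_norm_le
      (f := fun t : ℂ => f (0 + t • w)) (c := 0) (R := R' / r) (C := M) n (by positivity) ?_ ?_
    · rw [scv_iteratedDeriv_line hR hf] at h1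
      simp only [hT, norm_smul, norm_inv, Complex.norm_natCast]
      have h3 : (0:ℝ) < n.factorial := by positivity
      rw [inv_mul_le_iff₀ h3]
      refine h1.trans (le_of_eq ?_)
      rw [div_pow, div_pow]; field_simp
    · refine DifferentiableOn.diffContOnCl ?_
      rw [closure_ball _ (by positivity)]
      refine hf.comp (by fun_prop) fun t ht => ?_
      exact Metric.closedBall_subset_ball hR'2 (hin t (by simpa using ht))
    · intro t ht
      exact hM _ (hin t (by simpa using (le_of_eq (by simpa using ht))))
  have hsum : Summable fun n : ℕ => M * (r / R') ^ n :=
    (summable_geometric_of_lt_one (by positivity) ((div_lt_one hR'0).2 hR'1)).mul_left M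
  have hunif := tendstoUniformlyOn_tsum_nat hsum hbound
  rw [Metric.tendstoUniformlyOn_iff] at hunif
  obtain ⟨N, hN⟩ := (hunif ε hε).exists
  choose P hP using hpoly
  refine ⟨∑ n ∈ Finset.range N, P n, fun z hz => ?_⟩
  have h5 := hN z hz
  have h6 : f z = ∑' n, T n z := by
    have hzR : ‖z‖ < R := by rw [mem_closedBall_zero_iff] at hz; linarith
    have := (scv_hasSum_taylor hf hzR).tsum_eq
    rw [zero_add] at this
    exact this.symm
  rw [h6, map_sum]
  simp only [hP]
  rwa [dist_eq_norm] at h5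

/-- The polynomially convex hull. -/
def polyHull {ι : Type*} (K : Set (ι → ℂ)) : Set (ι → ℂ) :=
  {z | ∀ (p : MvPolynomial ι ℂ) (M : ℝ), (∀ w ∈ K, ‖eval w p‖ ≤ M) → ‖eval z p‖ ≤ M}

theorem subset_polyHull {ι : Type*} (K : Set (ι → ℂ)) : K ⊆ polyHull K :=
  fun z hz _ _ h => h z hz

theorem isClosed_polyHull {ι : Type*} [Fintype ι] (K : Set (ι → ℂ)) : IsClosed (polyHull K) := by
  simp only [polyHull, Set.ofPred_forall]
  refine isClosed_iInter fun p => isClosed_iInter fun M => isClosed_iInter fun _ => ?_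
  exact isClosed_le (continuous_norm.comp (MvPolynomial.continuous_eval p)) continuous_const

theorem isCompact_polyHull {ι : Type*} [Fintype ι] {K : Set (ι → ℂ)} (hK : IsCompact K) :
    IsCompact (polyHull K) := by
  obtain ⟨M, hM⟩ := hK.isBounded.exists_norm_le
  refine Metric.isCompact_of_isClosed_isBounded (isClosed_polyHull K) ?_
  refine (Metric.isBounded_closedBall (x := (0 : ι → ℂ)) (r := max M 0)).subset fun z hz => ?_
  rw [mem_closedBall_zero_iff, pi_norm_le_iff_of_nonneg (le_max_right _ _)]
  intro i
  have := hz (X i) (max M 0) fun w hw => by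
    rw [eval_X]; exact (norm_le_pi_norm w i).trans ((hM w hw).trans (le_max_left _ _))
  simpa using this

theorem runge_hull_bound {N : ℕ} {Ω : Set (CE N)} (hΩ : IsRungeDomain Ω) {K : Set (CE N)}
    (hK : IsCompact K) (hKΩ : K ⊆ Ω) {z : CE N} (hz : z ∈ polyHull K ∩ Ω) {f : CE N → ℂ}
    (hf : AnalyticOnNhd ℂ f Ω) {M : ℝ} (hM : ∀ w ∈ K, ‖f w‖ ≤ M) : ‖f z‖ ≤ M := by
  refine le_of_forall_pos_le_add fun ε hε => ?_
  obtain ⟨p, hp⟩ := hΩ.2 f hf (insert z K) (hK.insert z) (insert_subset hz.2 hKΩ) (ε/2)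
    (by positivity)
  have h1 := hz.1 p (M + ε/2) fun w hw => by
    have h2 := hp w (mem_insert_of_mem _ hw)
    have h3 := hM w hw
    have h4 := norm_sub_norm_le (eval w p) (f w)
    rw [norm_sub_rev] at h2
    linarith
  have h2 := hp z (mem_insert _ _)
  have h4 := norm_sub_norm_le (f z) (eval z p)
  linarith

/-- Cartan–Thullen for Runge domains: the hull of a compact set in `Ω` is compact. -/
theorem cartan_thullen {N : ℕ} {Ω : Set (CE N)} (hΩ : IsRungeDomain Ω) {K : Set (CE N)}
    (hK : IsCompact K) (hKΩ : K ⊆ Ω) : IsCompact (polyHull K ∩ Ω) := by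
  have hΩo : IsOpen Ω := hΩ.1.1
  obtain ⟨ρ, hρ, hρΩ⟩ := hK.exists_cthickening_subset_open hΩo hKΩ
  have hKρ : IsCompact (Metric.cthickening ρ K) := hK.cthickening
  have hball : ∀ w ∈ K, Metric.ball w ρ ⊆ Metric.cthickening ρ K := fun w hw =>
    Metric.ball_subset_closedBall.trans (Metric.closedBall_subset_cthickening hw ρ)
  obtain ⟨r, hr⟩ : ∃ r : NNReal, (r : ℝ) = ρ / Real.exp 1 := ⟨⟨ρ / Real.exp 1, by positivity⟩, rfl⟩
  have hr0 : (0:ℝ) < r := by rw [hr]; positivity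
  have key : ∀ z ∈ polyHull K ∩ Ω, Metric.ball z r ⊆ Ω := by
    intro z hz
    by_contra hcon
    obtain ⟨σ, hσ, hσΩ⟩ := Metric.mem_nhds_iff.1 (hΩo.mem_nhds hz.2)
    refine hΩ.1.2 ⟨Metric.ball z (min σ r), Metric.ball z r, Metric.isOpen_ball,
      Metric.isOpen_ball, ⟨z, Metric.mem_ball_self (by positivity)⟩, ?_,
      ⟨⟨z, Metric.mem_ball_self hr0⟩, (convex_ball z r).isPreconnected⟩, hcon, fun f hf => ?_⟩
    · exact subset_inter ((Metric.ball_subset_ball (min_le_left _ _)).trans hσΩ)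
        (Metric.ball_subset_ball (min_le_right _ _))
    have hfd : DifferentiableOn ℂ f Ω := hf.differentiableOn
    obtain ⟨M, hM⟩ := hKρ.exists_bound_of_continuousOn (hfd.continuousOn.mono hρΩ)
    set p : FormalMultilinearSeries ℂ (CE N) ℂ :=
      fun n => (n.factorial : ℂ)⁻¹ • iteratedFDeriv ℂ n f z with hp
    have hMK : ∀ n, ∀ w ∈ K, ‖iteratedFDeriv ℂ n f w‖ ≤
        M * Real.exp 1 * n.factorial * (Real.exp 1 / ρ) ^ n := fun n w hw =>
      norm_iteratedFDeriv_le_of_ball hρ (hfd.mono ((hball w hw).trans hρΩ))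
        (fun y hy => hM y (hball w hw hy)) n
    have hMz : ∀ n, ‖iteratedFDeriv ℂ n f z‖ ≤
        max M 0 * Real.exp 1 * n.factorial * (Real.exp 1 / ρ) ^ n := by
      intro n
      refine ContinuousMultilinearMap.opNorm_le_bound (by positivity) fun v => ?_
      have han : AnalyticOnNhd ℂ (fun x => iteratedFDeriv ℂ n f x v) Ω := by
        intro x hx
        exact ((ContinuousMultilinearMap.apply ℂ (fun _ : Fin n => CE N) ℂ v).analyticAt _).comp
          (hf.iteratedFDeriv n x hx)
      refine runge_hull_bound hΩ hK hKΩ hz han fun w hw => ?_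
      refine (ContinuousMultilinearMap.le_opNorm _ v).trans ?_
      refine mul_le_mul_of_nonneg_right ((hMK n w hw).trans ?_) (by positivity)
      gcongr
      exact le_max_left _ _
    have hrad : (r : ENNReal) ≤ p.radius := by
      refine p.le_radius_of_bound (max M 0 * Real.exp 1) fun n => ?_
      have h2 := hMz n
      simp only [p, norm_smul, norm_inv, Complex.norm_natCast]
      have h3 : (0:ℝ) < n.factorial := by positivity
      calc _ ≤ (n.factorial : ℝ)⁻¹ * (max M 0 * Real.exp 1 * n.factorial * (Real.exp 1 / ρ) ^ n) *
            (r:ℝ) ^ n := by gcongr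
        _ = max M 0 * Real.exp 1 * ((Real.exp 1 / ρ) * r) ^ n := by
            rw [mul_pow]; field_simp
        _ = max M 0 * Real.exp 1 := by
            have : Real.exp 1 / ρ * r = 1 := by rw [hr]; field_simp
            rw [this]; simp
        _ ≤ _ := le_rfl
    have hr0' : (0 : ENNReal) < r := by
      have : 0 < r := by exact_mod_cast hr0
      exact_mod_cast this
    have hps := (p.hasFPowerSeriesOnBall (hr0'.trans_le hrad)).mono hr0' hrad
    refine ⟨fun y => p.sum (y - z), ?_, ?_⟩
    · have h2 := hps.analyticOnNhd
      intro y hy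
      refine AnalyticAt.comp (g := p.sum) (f := fun y => y - z) (h2 _ ?_) (by fun_prop)
      rw [Metric.mem_ball] at hy
      simpa [edist_dist, dist_eq_norm] using! (by
        rw [dist_eq_norm] at hy; exact hy)
    · intro y hy
      have hy' : ‖y - z‖ < σ := by
        rw [mem_ball_iff_norm] at hy; exact hy.trans_le (min_le_left _ _)
      have := (scv_hasSum_taylor (hfd.mono hσΩ) hy').tsum_eq
      rw [add_sub_cancel] at this
      rw [← this]
      rfl
  refine (isCompact_polyHull hK).of_isClosed_subset ?_ inter_subset_left
  refine isClosed_of_closure_subset fun z hz => ?_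
  refine ⟨(isClosed_polyHull K).closure_subset_iff.2 inter_subset_left hz, ?_⟩
  obtain ⟨w, hw, hzw⟩ := Metric.mem_closure_iff.1 hz r hr0
  exact key w hw hzw
end SCV

open Set Filter Topology MvPolynomial

section Oka
open Complex in
theorem oka_log_edge {γ : ℝ → ℂ} {v : ℂ} {a b : ℝ} (hγ : ∀ t, HasDerivAt γ v t)
    (hs : ∀ t ∈ uIcc a b, γ t ∈ slitPlane) :
    ∫ t in a..b, v / γ t = log (γ b) - log (γ a) := by
  refine intervalIntegral.integral_eq_sub_of_hasDerivAt (f := fun t => log (γ t))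
    (fun t ht => (hγ t).clog_real (hs t ht)) ?_
  apply ContinuousOn.intervalIntegrable
  have hc : Continuous γ := continuous_iff_continuousAt.2 fun t => (hγ t).continuousAt
  exact continuousOn_const.div hc.continuousOn fun t ht => slitPlane_ne_zero (hs t ht)

open Complex in
theorem oka_log_neg_pos {z : ℂ} (hz : 0 < z.im) : log (-z) = log z - Real.pi * I := by
  rw [log, log, norm_neg, arg_neg_eq_arg_sub_pi_of_im_pos hz]; push_cast; ring

open Complex in
theorem oka_log_neg_neg {z : ℂ} (hz : z.im < 0) : log (-z) = log z + Real.pi * I := by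
  rw [log, log, norm_neg, arg_neg_eq_arg_add_pi_of_im_neg hz]; push_cast; ring

open Complex in
theorem oka_winding {x0 x1 y0 y1 : ℝ} {w : ℂ} (h1 : x0 < w.re) (h2 : w.re < x1) (h3 : y0 < w.im)
    (h4 : w.im < y1) :
    (∫ x : ℝ in x0..x1, 1 / ((x:ℂ) + y0 * I - w)) - (∫ x : ℝ in x0..x1, 1 / ((x:ℂ) + y1 * I - w)) +
      I * (∫ y : ℝ in y0..y1, 1 / ((x1:ℂ) + y * I - w)) -
      I * (∫ y : ℝ in y0..y1, 1 / ((x0:ℂ) + y * I - w)) = 2 * Real.pi * I := by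
  have hx : ∀ (c : ℂ) (t : ℝ), HasDerivAt (fun t : ℝ => (t:ℂ) + c) 1 t := fun c t =>
    (ofRealCLM.hasDerivAt (x := t)).add_const c
  have hy : ∀ (c : ℂ) (t : ℝ), HasDerivAt (fun t : ℝ => (t:ℂ) * I + c) I t := fun c t => by
    simpa using ((ofRealCLM.hasDerivAt (x := t)).mul_const I).add_const c
  have e1 := oka_log_edge (a := x0) (b := x1) (hx (y0 * I - w)) (fun t ht => by
    right; simp; linarith)
  have e2 := oka_log_edge (a := x0) (b := x1) (hx (y1 * I - w)) (fun t ht => by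
    right; simp; linarith)
  have e3 := oka_log_edge (a := y0) (b := y1) (hy (x1 - w)) (fun t ht => by
    left; simp; linarith)
  have e4 := oka_log_edge (a := y0) (b := y1) (γ := fun t => -((t:ℂ) * I + (x0 - w))) (v := -I)
    (fun t => (hy (x0 - w) t).neg) (fun t ht => by
    left; simp; linarith)
  simp only [neg_div_neg_eq] at e4
  rw [oka_log_neg_pos (z := (y1:ℂ) * I + (x0 - w)) (by simp; linarith),
    oka_log_neg_neg (z := (y0:ℂ) * I + (x0 - w)) (by simp; linarith)] at e4
  rw [← intervalIntegral.integral_const_mul, ← intervalIntegral.integral_const_mul]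
  have f1 : ∀ (y : ℝ) , (∫ x : ℝ in x0..x1, 1 / ((x:ℂ) + y * I - w)) =
      ∫ x : ℝ in x0..x1, 1 / ((x:ℂ) + (y * I - w)) := fun y => by simp only [add_sub_assoc]
  have f2 : ∀ (x : ℝ) , (∫ y : ℝ in y0..y1, I * (1 / ((x:ℂ) + y * I - w))) =
      ∫ y : ℝ in y0..y1, I / ((y:ℂ) * I + (x - w)) := fun x => by
    congr 1; ext y; rw [mul_one_div]; congr 1; ring
  rw [f1, f1, f2, f2, e1, e2, e3, e4]
  have g1 : (x0:ℂ) + (y1 * I - w) = y1 * I + (x0 - w) := by ring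
  have g2 : (x0:ℂ) + (y0 * I - w) = y0 * I + (x0 - w) := by ring
  have g3 : (x1:ℂ) + (y1 * I - w) = y1 * I + (x1 - w) := by ring
  have g4 : (x1:ℂ) + (y0 * I - w) = y0 * I + (x1 - w) := by ring
  rw [g1, g2, g3, g4]; ring

open Complex in
theorem oka_rect_cauchy {x0 x1 y0 y1 : ℝ} {w : ℂ} (h1 : x0 < w.re) (h2 : w.re < x1) (h3 : y0 < w.im)
    (h4 : w.im < y1) {f : ℂ → ℂ}
    (hf : ∀ z, x0 ≤ z.re → z.re ≤ x1 → y0 ≤ z.im → z.im ≤ y1 → DifferentiableAt ℂ f z) :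
    (∫ x : ℝ in x0..x1, f (x + y0 * I) / ((x:ℂ) + y0 * I - w)) -
      (∫ x : ℝ in x0..x1, f (x + y1 * I) / ((x:ℂ) + y1 * I - w)) +
      I * (∫ y : ℝ in y0..y1, f (x1 + y * I) / ((x1:ℂ) + y * I - w)) -
      I * (∫ y : ℝ in y0..y1, f (x0 + y * I) / ((x0:ℂ) + y * I - w)) = 2 * Real.pi * I * f w := by
  have hx01 : x0 ≤ x1 := by linarith
  have hy01 : y0 ≤ y1 := by linarith
  have hfw : DifferentiableAt ℂ f w := hf w h1.le h2.le h3.le h4.le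
  have key := integral_boundary_rect_eq_zero_of_differentiable_on_off_countable (dslope f w)
    ⟨x0, y0⟩ ⟨x1, y1⟩ {w} (countable_singleton w) (by
      intro z hz
      simp only [uIcc_of_le hx01, uIcc_of_le hy01, mem_reProdIm, mem_Icc] at hz
      refine ContinuousAt.continuousWithinAt ?_
      by_cases hzw : z = w
      · subst hzw; exact continuousAt_dslope_same.2 hfw
      · exact (continuousAt_dslope_of_ne hzw).2
          (hf z hz.1.1 hz.1.2 hz.2.1 hz.2.2).continuousAt) (by
      intro z hz
      simp only [min_eq_left hx01, min_eq_left hy01, max_eq_right hx01, max_eq_right hy01,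
        Set.mem_sdiff, mem_reProdIm, mem_Ioo, mem_singleton_iff] at hz
      exact (differentiableAt_dslope_of_ne hz.2).2
        (hf z hz.1.1.1.le hz.1.1.2.le hz.1.2.1.le hz.1.2.2.le))
  simp only [smul_eq_mul] at key
  have hd : ∀ z, z ≠ w → dslope f w z = f z / (z - w) - f w * (1 / (z - w)) := fun z hz => by
    rw [dslope_of_ne _ hz, slope_def_field]; ring
  have edge : ∀ (γ : ℝ → ℂ) (a b : ℝ), a ≤ b → Continuous γ → (∀ t ∈ Icc a b, γ t ≠ w) →
      (∀ t ∈ Icc a b, DifferentiableAt ℂ f (γ t)) →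
      ∫ t in a..b, dslope f w (γ t) = (∫ t in a..b, f (γ t) / (γ t - w)) -
        f w * ∫ t in a..b, 1 / (γ t - w) := by
    intro γ a b hab hγ hne hd'
    have c1 : ContinuousOn (fun t => f (γ t) / (γ t - w)) (uIcc a b) := by
      rw [uIcc_of_le hab]
      refine ContinuousOn.div (fun t ht => ?_) (by fun_prop) fun t ht => sub_ne_zero.2 (hne t ht)
      exact ((hd' t ht).continuousAt.comp hγ.continuousAt).continuousWithinAt
    have c2 : ContinuousOn (fun t => f w * (1 / (γ t - w))) (uIcc a b) := by
      rw [uIcc_of_le hab]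
      refine continuousOn_const.mul (continuousOn_const.div (by fun_prop)
        fun t ht => sub_ne_zero.2 (hne t ht))
    rw [← intervalIntegral.integral_const_mul, ← intervalIntegral.integral_sub
      c1.intervalIntegrable c2.intervalIntegrable]
    refine intervalIntegral.integral_congr fun t ht => ?_
    rw [uIcc_of_le hab] at ht
    exact hd _ (hne t ht)
  have ne1 : ∀ (y : ℝ) (t : ℝ), y ≠ w.im → (t:ℂ) + y * I ≠ w := fun y t hy h => hy (by
    have := congrArg Complex.im h; simpa using this)
  have ne2 : ∀ (x : ℝ) (t : ℝ), x ≠ w.re → (x:ℂ) + t * I ≠ w := fun y t hy h => hy (by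
    have := congrArg Complex.re h; simpa using this)
  rw [edge (fun x : ℝ => (x:ℂ) + y0 * I) x0 x1 hx01 (by fun_prop) (fun t _ => ne1 _ t h3.ne)
      (fun t ht => hf _ (by simpa using ht.1) (by simpa using ht.2) (by simp) (by simpa using hy01)),
    edge (fun x : ℝ => (x:ℂ) + y1 * I) x0 x1 hx01 (by fun_prop) (fun t _ => ne1 _ t h4.ne')
      (fun t ht => hf _ (by simpa using ht.1) (by simpa using ht.2) (by simpa using hy01) (by simp)),
    edge (fun y : ℝ => (x1:ℂ) + y * I) y0 y1 hy01 (by fun_prop) (fun t _ => ne2 _ t h2.ne')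
      (fun t ht => hf _ (by simpa using hx01) (by simp) (by simpa using ht.1) (by simpa using ht.2)),
    edge (fun y : ℝ => (x0:ℂ) + y * I) y0 y1 hy01 (by fun_prop) (fun t _ => ne2 _ t h1.ne)
      (fun t ht => hf _ (by simp) (by simpa using hx01) (by simpa using ht.1) (by simpa using ht.2))]
    at key
  have W := oka_winding h1 h2 h3 h4
  linear_combination key + f w * W

/-- `f` is holomorphic near every point of `A`. -/
def HolNear {E : Type*} [NormedAddCommGroup E] [NormedSpace ℂ E] (f : E → ℂ) (A : Set E) : Prop :=
  ∀ x ∈ A, ∀ᶠ y in 𝓝 x, DifferentiableAt ℂ f y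

theorem glue_near {X Z : Type*} [TopologicalSpace X] [NormalSpace X] {P₁ P₂ : Set X}
    (h₁ : IsClosed P₁) (h₂ : IsClosed P₂) {f g : X → Z} (h : ∀ x ∈ P₁ ∩ P₂, f =ᶠ[𝓝 x] g) :
    ∃ G : X → Z, (∀ x ∈ P₁, G =ᶠ[𝓝 x] f) ∧ ∀ x ∈ P₂, G =ᶠ[𝓝 x] g := by
  classical
  set A : Set X := {x | f =ᶠ[𝓝 x] g} with hA
  have hAo : IsOpen A := isOpen_setOfPred_eventually_nhds
  obtain ⟨U, V, hU, hV, hPU, hPV, hUV⟩ := NormalSpace.normal (P₁ \ A) (P₂ \ A)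
    (h₁.sdiff hAo) (h₂.sdiff hAo) (by
      rw [Set.disjoint_left]; rintro x ⟨hx1, hx2⟩ ⟨hx3, -⟩; exact hx2 (h x ⟨hx1, hx3⟩))
  refine ⟨fun x => if x ∈ U then f x else g x, fun x hx => ?_, fun x hx => ?_⟩
  · by_cases hxA : x ∈ A
    · have : f =ᶠ[𝓝 x] g := hxA
      filter_upwards [this] with y hy
      split_ifs <;> simp [hy]
    · filter_upwards [hU.mem_nhds (hPU ⟨hx, hxA⟩)] with y hy
      simp [hy]
  · by_cases hxA : x ∈ A
    · have : f =ᶠ[𝓝 x] g := hxA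
      filter_upwards [this] with y hy
      split_ifs <;> simp [hy]
    · filter_upwards [hV.mem_nhds (hPV ⟨hx, hxA⟩)] with y hy
      simp only [if_neg (Set.disjoint_right.1 hUV hy)]

theorem HolNear.congr {E : Type*} [NormedAddCommGroup E] [NormedSpace ℂ E] {f g : E → ℂ} {A : Set E}
    (hf : HolNear f A) (h : ∀ x ∈ A, g =ᶠ[𝓝 x] f) : HolNear g A := fun x hx => by
  filter_upwards [hf x hx, (h x hx).eventually_nhds] with y h1 h2
  exact h1.congr_of_eventuallyEq h2

/-- box induction -/
theorem box_induction {κ : Type*} [Fintype κ] [DecidableEq κ] {Sol : (κ → ℝ) → (κ → ℝ) → Prop}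
    (hm : ∀ l u i c, l i ≤ c → c ≤ u i → Sol l (Function.update u i c) →
      Sol (Function.update l i c) u → Sol l u)
    {ε : ℝ} (hε : 0 < ε) (hs : ∀ l u, (∀ i, u i - l i < ε) → Sol l u) (l u : κ → ℝ) : Sol l u := by
  have key : ∀ S : Finset κ, ∀ l u : κ → ℝ, (∀ i, i ∉ S → u i - l i < ε) → Sol l u := by
    intro S
    induction S using Finset.induction_on with
    | empty => intro l u h; exact hs l u fun i => h i (by simp)
    | insert i S hi ih =>
      have h2 : ∀ n : ℕ, ∀ l u : κ → ℝ, (∀ j, j ∉ insert i S → u j - l j < ε) →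
          u i - l i < 2 ^ n * ε → Sol l u := by
        intro n
        induction n with
        | zero =>
          intro l u h h'
          refine ih l u fun j hj => ?_
          by_cases hji : j = i
          · subst hji; linarith
          · exact h j (by simp [hji, hj])
        | succ n ihn =>
          intro l u h h'
          by_cases hc : u i - l i < 2 ^ n * ε
          · exact ihn l u h hc
          have hp : 0 < 2 ^ n * ε := by positivity
          rw [pow_succ] at h'
          refine hm l u i ((l i + u i) / 2) (by linarith) (by linarith) (ihn _ _ ?_ ?_)
            (ihn _ _ ?_ ?_)
          · intro j hj
            have : j ≠ i := by rintro rfl; simp at hj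
            simpa [this] using h j hj
          · simp; linarith
          · intro j hj
            have : j ≠ i := by rintro rfl; simp at hj
            simpa [this] using h j hj
          · simp; linarith
      intro l u h
      obtain ⟨n, hn⟩ := pow_unbounded_of_one_lt ((u i - l i) / ε) (one_lt_two)
      exact h2 n l u h (by rwa [div_lt_iff₀ hε] at hn)
  exact key Finset.univ l u (by simp)

/-- Integrals of Cauchy type along a path in the coordinate `i` are holomorphic. -/
theorem oka_path {ι : Type*} [Fintype ι] [DecidableEq ι] {h : (ι → ℂ) → ℂ} (i : ι) {γ : ℝ → ℂ}
    (hγ : Continuous γ) {e : ℂ} {a b : ℝ} (hab : a ≤ b) {x : ι → ℂ}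
    (hx : ∀ t ∈ Icc a b, (∀ᶠ y in 𝓝 (Function.update x i (e⁻¹ * γ t)), DifferentiableAt ℂ h y) ∧
      γ t ≠ e * x i) :
    ∀ᶠ y in 𝓝 x, DifferentiableAt ℂ
      (fun z => ∫ t in a..b, h (Function.update z i (e⁻¹ * γ t)) / (γ t - e * z i)) y := by
  have hc : Continuous fun q : (ι → ℂ) × ℝ => Function.update q.1 i (e⁻¹ * γ q.2) := by fun_prop
  set O : Set (ι → ℂ) := {x | ∀ t ∈ Icc a b,
    (∀ᶠ y in 𝓝 (Function.update x i (e⁻¹ * γ t)), DifferentiableAt ℂ h y) ∧ γ t ≠ e * x i} with hO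
  have hOo : IsOpen O := by
    rw [isOpen_iff_mem_nhds]
    intro x hx
    refine isCompact_Icc.eventually_forall_of_forall_eventually fun t ht => ?_
    have h1 := (hx t ht).1.eventually_nhds
    have h2 := hc.continuousAt (x := (x, t)).eventually h1
    have h3 : ∀ᶠ q : (ι → ℂ) × ℝ in 𝓝 (x, t), γ q.2 ≠ e * q.1 i :=
      ContinuousAt.eventually_ne (g := fun q : (ι → ℂ) × ℝ => γ q.2 - e * q.1 i) (by fun_prop)
        (sub_ne_zero.2 (hx t ht).2) |>.mono fun q hq => sub_ne_zero.1 hq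
    filter_upwards [h2, h3] with q hq hq'
    exact ⟨hq, hq'⟩
  have := scv_param_integral (G := fun t z => h (Function.update z i (e⁻¹ * γ t)) / (γ t - e * z i))
    hab hOo (by
      rintro ⟨t, z⟩ ⟨ht, hz⟩
      refine ContinuousAt.continuousWithinAt ?_
      refine ContinuousAt.div (f := fun q : ℝ × (ι → ℂ) => h (Function.update q.2 i (e⁻¹ * γ q.1)))
        (g := fun q : ℝ × (ι → ℂ) => γ q.1 - e * q.2 i) ?_ ?_ ?_
      · exact ContinuousAt.comp (f := fun q : ℝ × (ι → ℂ) => Function.update q.2 i (e⁻¹ * γ q.1))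
          (hz t ht).1.self_of_nhds.continuousAt (by fun_prop)
      · fun_prop
      · exact sub_ne_zero.2 (hz t ht).2) (by
      intro t ht z hz
      refine DifferentiableAt.differentiableWithinAt ?_
      have hd2 : DifferentiableAt ℂ (fun z : ι → ℂ => γ t - e * z i) z := by fun_prop
      simp only [div_eq_mul_inv]
      refine DifferentiableAt.fun_mul (DifferentiableAt.fun_comp' (f := fun z : ι → ℂ => Function.update z i (e⁻¹ * γ t)) z
        (hz t ht).1.self_of_nhds ?_) (hd2.fun_inv (sub_ne_zero.2 (hz t ht).2))
      rw [differentiableAt_pi]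
      intro j
      by_cases hj : j = i
      · subst hj; simp
      · simp [hj]; fun_prop)
  filter_upwards [hOo.mem_nhds hx] with y hy
  exact (this y hy).differentiableAt (hOo.mem_nhds hy)

end Oka

open Set Filter Topology MvPolynomial

section Oka

/-- Splitting property along the cut `Re (e z_i) = c`. -/
def SplAt {ι : Type*} [Fintype ι] (P : Set (ι → ℂ)) (i : ι) (e : ℂ) (c : ℝ) : Prop :=
  ∀ h : (ι → ℂ) → ℂ, HolNear h (P ∩ {z | (e * z i).re = c}) →
    ∃ h' h'' : (ι → ℂ) → ℂ, HolNear h' (P ∩ {z | (e * z i).re ≤ c}) ∧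
      HolNear h'' (P ∩ {z | c ≤ (e * z i).re}) ∧
      ∀ x ∈ P ∩ {z | (e * z i).re = c}, ∀ᶠ y in 𝓝 x, h y = h' y - h'' y

open Complex in
theorem oka_spl_base {ι : Type*} [Fintype ι] [DecidableEq ι] {K : ι → Set ℂ}
    (hK : ∀ i, IsCompact (K i)) (hKc : ∀ i, Convex ℝ (K i)) (i : ι) {e : ℂ} (he : ‖e‖ = 1) (c : ℝ) :
    SplAt {z : ι → ℂ | ∀ j, z j ∈ K j} i e c := by
  intro h hh
  have he0 : e ≠ 0 := by rintro rfl; simp at he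
  set P : Set (ι → ℂ) := {z : ι → ℂ | ∀ j, z j ∈ K j} with hP
  have hPc : IsCompact P := by
    have := isCompact_univ_pi hK
    convert this using 1
    ext z; simp [hP]
  set S : Set ℝ := {y | e⁻¹ * ((c:ℂ) + y * I) ∈ K i} with hS
  have hxS : ∀ z ∈ P, (e * z i).re = c → (e * z i).im ∈ S := by
    intro z hz hc
    simp only [hS, mem_ofPred_eq]
    have : (c:ℂ) + ((e * z i).im : ℝ) * I = e * z i := by
      rw [← hc]; exact Complex.re_add_im _
    rw [this, inv_mul_cancel_left₀ he0]; exact hz i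
  rcases S.eq_empty_or_nonempty with hSe | hSne
  · refine ⟨0, 0, fun x _ => Eventually.of_forall fun y => differentiableAt_const _,
      fun x _ => Eventually.of_forall fun y => differentiableAt_const _, fun x hx => ?_⟩
    have := hxS x hx.1 hx.2
    rw [hSe] at this; exact this.elim
  have hScont : Continuous fun y : ℝ => e⁻¹ * ((c:ℂ) + y * I) := by fun_prop
  have hScl : IsClosed S := (hK i).isClosed.preimage hScont
  have hSbd : Bornology.IsBounded S := by
    obtain ⟨M, hM⟩ := (hK i).isBounded.exists_norm_le
    refine (Metric.isBounded_closedBall (x := (0:ℝ)) (r := M)).subset fun y hy => ?_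
    have h1 := hM _ hy
    rw [norm_mul, norm_inv, he, inv_one, one_mul] at h1
    have h2 := Complex.abs_im_le_norm ((c:ℂ) + y * I)
    simp at h2
    simpa using h2.trans h1
  have hSco : IsCompact S := Metric.isCompact_of_isClosed_isBounded hScl hSbd
  obtain ⟨a, ha⟩ := hSco.exists_isLeast hSne
  obtain ⟨b, hb⟩ := hSco.exists_isGreatest hSne
  have hSconv : Convex ℝ S := by
    intro x hx y hy s t hs ht hst
    have := hKc i hx hy hs ht hst
    simp only [hS, mem_ofPred_eq]
    convert this using 1
    simp only [real_smul, smul_eq_mul, ofReal_add, ofReal_mul]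
    have : (s:ℂ) + t = 1 := by exact_mod_cast hst
    linear_combination (-e⁻¹ * c) * this
  have hSab : ∀ y, a ≤ y → y ≤ b → y ∈ S := fun y h1 h2 =>
    hSconv.ordConnected.out ha.1 hb.1 ⟨h1, h2⟩
  have hab : a ≤ b := ha.2 hb.1
  set A := P ∩ {z | (e * z i).re = c} with hA
  have hAc : IsCompact A := hPc.inter_right (isClosed_eq (by fun_prop) continuous_const)
  set U : Set (ι → ℂ) := {x | ∀ᶠ y in 𝓝 x, DifferentiableAt ℂ h y} with hU
  obtain ⟨δ0, hδ0, hsub⟩ := hAc.exists_cthickening_subset_open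
    (isOpen_setOfPred_eventually_nhds : IsOpen U) hh
  set δ := δ0 / 3 with hδ
  have hδp : 0 < δ := by positivity
  -- the key claim
  have claim : ∀ p ∈ P, ∀ x : ι → ℂ, (∀ j, ‖x j - p j‖ ≤ δ) → ∀ u : ℂ, c - δ ≤ u.re → u.re ≤ c + δ →
      a - δ ≤ u.im → u.im ≤ b + δ → Function.update x i (e⁻¹ * u) ∈ U := by
    intro p hp x hx u h1 h2 h3 h4
    set y := max a (min u.im b) with hy
    have hy1 : a ≤ y := le_max_left _ _
    have hy2 : y ≤ b := max_le hab (min_le_right _ _)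
    have hy3 : |u.im - y| ≤ δ := by
      rw [abs_le]
      constructor
      · have : y ≤ u.im + δ := max_le (by linarith) ((min_le_left _ _).trans (by linarith))
        linarith
      · have : u.im - δ ≤ y := le_max_of_le_right (le_min (by linarith) (by linarith))
        linarith
    refine hsub (Metric.mem_cthickening_of_dist_le _ (Function.update p i (e⁻¹ * ((c:ℂ) + y * I))) _ _
      ⟨fun j => ?_, ?_⟩ ?_)
    · by_cases hj : j = i
      · subst hj; rw [Function.update_self]; exact hSab y hy1 hy2
      · simpa [hj] using hp j
    · simp only [mem_ofPred_eq, Function.update_self, mul_inv_cancel_left₀ he0]; simp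
    · rw [dist_pi_le_iff hδ0.le]
      intro j
      by_cases hj : j = i
      · subst hj
        simp only [Function.update_self]
        rw [dist_eq_norm, ← mul_sub, norm_mul, norm_inv, he, inv_one, one_mul]
        refine (Complex.norm_le_abs_re_add_abs_im _).trans ?_
        have : |u.re - c| ≤ δ := abs_le.2 ⟨by linarith, by linarith⟩
        simp
        linarith
      · simp only [Function.update_of_ne hj, dist_eq_norm]
        refine (hx j).trans (by linarith)
  have claim' : ∀ p ∈ P, ∀ u : ℂ, c - δ ≤ u.re → u.re ≤ c + δ →
      a - δ ≤ u.im → u.im ≤ b + δ → Function.update p i (e⁻¹ * u) ∈ U := fun p hp =>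
    claim p hp p fun j => by simpa using hδp.le
  set F : (ι → ℂ) → ℂ → ℂ := fun z u => h (Function.update z i (e⁻¹ * u)) / (u - e * z i) with hF
  set JR : (ι → ℂ) → ℂ := fun z => (∫ x in c..(c+δ), F z (x + ((a-δ:ℝ):ℂ) * I)) -
    (∫ x in c..(c+δ), F z (x + ((b+δ:ℝ):ℂ) * I)) +
    I * (∫ y in (a-δ)..(b+δ), F z (((c+δ:ℝ):ℂ) + y * I)) with hJR
  set JL : (ι → ℂ) → ℂ := fun z => (∫ x in (c-δ)..c, F z (x + ((a-δ:ℝ):ℂ) * I)) -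
    (∫ x in (c-δ)..c, F z (x + ((b+δ:ℝ):ℂ) * I)) -
    I * (∫ y in (a-δ)..(b+δ), F z (((c-δ:ℝ):ℂ) + y * I)) with hJL
  refine ⟨fun z => (2 * Real.pi * I)⁻¹ * JR z, fun z => -((2 * Real.pi * I)⁻¹ * JL z), ?_, ?_, ?_⟩
  · rintro x ⟨hx, hxc⟩
    simp only [mem_ofPred_eq] at hxc
    have e1 := oka_path (h := h) i (γ := fun t : ℝ => (t:ℂ) + ((a-δ:ℝ):ℂ) * I) (by fun_prop) (e := e)
      (a := c) (b := c+δ) (x := x) (by linarith) (fun t ht => ⟨claim' x hx _ (by simp; linarith [ht.1])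
        (by simpa using ht.2) (by simp) (by simp; linarith), fun heq => by
          have h1 := congrArg Complex.re heq
          have h2 := congrArg Complex.im heq
          simp only [add_re, ofReal_re, mul_re, I_re, mul_zero, ofReal_im, I_im, mul_one, sub_self,
            add_zero, add_im, mul_im, zero_add] at h1 h2
          have h3 : (e * x i).re = c := le_antisymm hxc (by rw [mul_re, ← h1]; exact ht.1)
          have h4 := ha.2 (hxS x hx h3)
          rw [mul_im, ← h2] at h4; linarith⟩)
    have e2 := oka_path (h := h) i (γ := fun t : ℝ => (t:ℂ) + ((b+δ:ℝ):ℂ) * I) (by fun_prop) (e := e)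
      (a := c) (b := c+δ) (x := x) (by linarith) (fun t ht => ⟨claim' x hx _ (by simp; linarith [ht.1])
        (by simpa using ht.2) (by simp; linarith) (by simp), fun heq => by
          have h1 := congrArg Complex.re heq
          have h2 := congrArg Complex.im heq
          simp only [add_re, ofReal_re, mul_re, I_re, mul_zero, ofReal_im, I_im, mul_one, sub_self,
            add_zero, add_im, mul_im, zero_add] at h1 h2
          have h3 : (e * x i).re = c := le_antisymm hxc (by rw [mul_re, ← h1]; exact ht.1)
          have h4 := hb.2 (hxS x hx h3)
          rw [mul_im, ← h2] at h4; linarith⟩)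
    have e3 := oka_path (h := h) i (γ := fun t : ℝ => ((c+δ:ℝ):ℂ) + t * I) (by fun_prop) (e := e)
      (a := a-δ) (b := b+δ) (x := x) (by linarith) (fun t ht => ⟨claim' x hx _ (by simp; linarith)
        (by simp) (by simpa using ht.1) (by simpa using ht.2), fun heq => by
          have h1 := congrArg Complex.re heq
          simp only [add_re, ofReal_re, mul_re, I_re, mul_zero, ofReal_im, I_im, mul_one, sub_self,
            add_zero] at h1
          rw [mul_re, ← h1] at hxc; linarith⟩)
    filter_upwards [e1, e2, e3] with y h1 h2 h3
    exact ((h1.fun_sub h2).fun_add (h3.const_mul I)).const_mul _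
  · rintro x ⟨hx, hxc⟩
    simp only [mem_ofPred_eq] at hxc
    have e1 := oka_path (h := h) i (γ := fun t : ℝ => (t:ℂ) + ((a-δ:ℝ):ℂ) * I) (by fun_prop) (e := e)
      (a := c-δ) (b := c) (x := x) (by linarith) (fun t ht => ⟨claim' x hx _ (by simpa using ht.1)
        (by simp; linarith [ht.2]) (by simp) (by simp; linarith), fun heq => by
          have h1 := congrArg Complex.re heq
          have h2 := congrArg Complex.im heq
          simp only [add_re, ofReal_re, mul_re, I_re, mul_zero, ofReal_im, I_im, mul_one, sub_self,
            add_zero, add_im, mul_im, zero_add] at h1 h2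
          have h3 : (e * x i).re = c := le_antisymm (by rw [mul_re, ← h1]; exact ht.2) hxc
          have h4 := ha.2 (hxS x hx h3)
          rw [mul_im, ← h2] at h4; linarith⟩)
    have e2 := oka_path (h := h) i (γ := fun t : ℝ => (t:ℂ) + ((b+δ:ℝ):ℂ) * I) (by fun_prop) (e := e)
      (a := c-δ) (b := c) (x := x) (by linarith) (fun t ht => ⟨claim' x hx _ (by simpa using ht.1)
        (by simp; linarith [ht.2]) (by simp; linarith) (by simp), fun heq => by
          have h1 := congrArg Complex.re heq
          have h2 := congrArg Complex.im heq
          simp only [add_re, ofReal_re, mul_re, I_re, mul_zero, ofReal_im, I_im, mul_one, sub_self,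
            add_zero, add_im, mul_im, zero_add] at h1 h2
          have h3 : (e * x i).re = c := le_antisymm (by rw [mul_re, ← h1]; exact ht.2) hxc
          have h4 := hb.2 (hxS x hx h3)
          rw [mul_im, ← h2] at h4; linarith⟩)
    have e3 := oka_path (h := h) i (γ := fun t : ℝ => ((c-δ:ℝ):ℂ) + t * I) (by fun_prop) (e := e)
      (a := a-δ) (b := b+δ) (x := x) (by linarith) (fun t ht => ⟨claim' x hx _ (by simp)
        (by simp; linarith) (by simpa using ht.1) (by simpa using ht.2), fun heq => by
          have h1 := congrArg Complex.re heq
          simp only [add_re, ofReal_re, mul_re, I_re, mul_zero, ofReal_im, I_im, mul_one, sub_self,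
            add_zero] at h1
          rw [mul_re, ← h1] at hxc; linarith⟩)
    filter_upwards [e1, e2, e3] with y h1 h2 h3
    exact (((h1.fun_sub h2).fun_sub (h3.const_mul I)).const_mul _).fun_neg
  · rintro x ⟨hx, hxc⟩
    simp only [mem_ofPred_eq] at hxc
    have hxS' := hxS x hx hxc
    have hxa := ha.2 hxS'
    have hxb := hb.2 hxS'
    have hcr : ContinuousAt (fun y : ι → ℂ => (e * y i).re) x := by fun_prop
    have hci : ContinuousAt (fun y : ι → ℂ => (e * y i).im) x := by fun_prop
    filter_upwards [Metric.closedBall_mem_nhds x hδp,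
      hcr.eventually_const_lt (u := c - δ) (by linarith), hcr.eventually_lt_const (u := c + δ) (by linarith),
      hci.eventually_const_lt (u := a - δ) (by linarith), hci.eventually_lt_const (u := b + δ) (by linarith)]
      with y hy k1 k2 k3 k4
    have hyx : ∀ j, ‖y j - x j‖ ≤ δ := fun j => by
      rw [← dist_eq_norm]; exact (dist_le_pi_dist y x j).trans hy
    have hfd : ∀ u : ℂ, c - δ ≤ u.re → u.re ≤ c + δ → a - δ ≤ u.im → u.im ≤ b + δ →
        DifferentiableAt ℂ (fun u => h (Function.update y i (e⁻¹ * u))) u := by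
      intro u u1 u2 u3 u4
      have := (claim x hx y hyx u u1 u2 u3 u4).self_of_nhds
      refine DifferentiableAt.fun_comp' (f := fun u => Function.update y i (e⁻¹ * u)) u this ?_
      rw [differentiableAt_pi]
      intro j
      by_cases hj : j = i
      · subst hj; simp; fun_prop
      · simp [hj]
    have hrc := oka_rect_cauchy (f := fun u => h (Function.update y i (e⁻¹ * u))) k1 k2 k3 k4 hfd
    have hinv : e⁻¹ * (e * y i) = y i := inv_mul_cancel_left₀ he0 _
    have hFy : ∀ u, h (Function.update y i (e⁻¹ * u)) / (u - e * y i) = F y u := fun u => rfl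
    simp only [hFy, hinv, Function.update_eq_self] at hrc
    have hintg : ∀ v : ℝ, a - δ ≤ v → v ≤ b + δ → v ≠ (e * y i).im → ∀ s t : ℝ, s ∈ Icc (c-δ) (c+δ) →
        t ∈ Icc (c-δ) (c+δ) →
        IntervalIntegrable (fun x : ℝ => F y (x + (v:ℂ) * I)) MeasureTheory.volume s t := by
      intro v v1 v2 v3 s t hs ht
      apply ContinuousOn.intervalIntegrable
      intro x hx
      have hx' := uIcc_subset_Icc hs ht hx
      refine ContinuousAt.continuousWithinAt ?_
      refine ContinuousAt.div ?_ (by fun_prop) ?_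
      · exact ContinuousAt.comp (g := fun u => h (Function.update y i (e⁻¹ * u)))
          (f := fun x : ℝ => (x:ℂ) + (v:ℂ) * I)
          (hfd _ (by simpa using hx'.1) (by simpa using hx'.2) (by simpa using v1) (by simpa using v2)).continuousAt
          (by fun_prop)
      · intro h0
        have := congrArg Complex.im (sub_eq_zero.1 h0)
        simp at this
        apply v3; simpa using this
    have i1 := intervalIntegral.integral_add_adjacent_intervals
      (hintg (a-δ) le_rfl (by linarith) k3.ne (c-δ) c ⟨le_rfl, by linarith⟩ ⟨by linarith, by linarith⟩)
      (hintg (a-δ) le_rfl (by linarith) k3.ne c (c+δ) ⟨by linarith, by linarith⟩ ⟨by linarith, le_rfl⟩)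
    have i2 := intervalIntegral.integral_add_adjacent_intervals
      (hintg (b+δ) (by linarith) le_rfl k4.ne' (c-δ) c ⟨le_rfl, by linarith⟩ ⟨by linarith, by linarith⟩)
      (hintg (b+δ) (by linarith) le_rfl k4.ne' c (c+δ) ⟨by linarith, by linarith⟩ ⟨by linarith, le_rfl⟩)
    rw [← i1, ← i2] at hrc
    have hpi : (2 * Real.pi * I : ℂ) ≠ 0 := by simp [Real.pi_ne_zero]
    have : JR y + JL y = 2 * Real.pi * I * h y := by
      rw [← hrc, hJR, hJL]; ring
    calc h y = (2 * Real.pi * I)⁻¹ * (2 * Real.pi * I * h y) := by rw [inv_mul_cancel_left₀ hpi]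
      _ = _ := by rw [← this]; ring

end Oka

open Set Filter Topology MvPolynomial

section Oka

/-- Adding a coordinate. -/
def ocons {ι : Type*} (w : ℂ) (z : ι → ℂ) : Option ι → ℂ := fun o => o.elim w z

@[simp] theorem ocons_none {ι : Type*} (w : ℂ) (z : ι → ℂ) : ocons w z none = w := rfl
@[simp] theorem ocons_some {ι : Type*} (w : ℂ) (z : ι → ℂ) (i : ι) : ocons w z (some i) = z i := rfl

theorem ocons_eta {ι : Type*} (x : Option ι → ℂ) : ocons (x none) (fun i => x (some i)) = x := by
  ext o; cases o <;> rfl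

/-- Polynomial polyhedron with constraints. -/
def PH {ι : Type*} (K : ι → Set ℂ) (ps : List (MvPolynomial ι ℂ × Set ℂ)) : Set (ι → ℂ) :=
  {z | (∀ i, z i ∈ K i) ∧ ∀ q ∈ ps, eval z q.1 ∈ q.2}

def GoodSet (A : Set ℂ) : Prop := IsCompact A ∧ Convex ℝ A

def oK {ι : Type*} (K : ι → Set ℂ) (L : Set ℂ) : Option ι → Set ℂ := fun o => o.elim L K

noncomputable def oL {ι : Type*} (ps : List (MvPolynomial ι ℂ × Set ℂ)) : List (MvPolynomial (Option ι) ℂ × Set ℂ) :=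
  ps.map fun q => (rename some q.1, q.2)

theorem mem_PH_oK {ι : Type*} {K : ι → Set ℂ} {L : Set ℂ} {ps : List (MvPolynomial ι ℂ × Set ℂ)}
    {x : Option ι → ℂ} : x ∈ PH (oK K L) (oL ps) ↔ (fun i => x (some i)) ∈ PH K ps ∧ x none ∈ L := by
  simp only [PH, oL, mem_ofPred_eq, List.mem_map, Option.forall, oK, Option.elim]
  constructor
  · rintro ⟨⟨h1, h2⟩, h3⟩
    refine ⟨⟨h2, fun q hq => ?_⟩, h1⟩
    have := h3 _ ⟨q, hq, rfl⟩
    simpa [eval_rename, Function.comp_def] using this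
  · rintro ⟨⟨h1, h2⟩, h3⟩
    refine ⟨⟨h3, h1⟩, ?_⟩
    rintro _ ⟨q, hq, rfl⟩
    simpa [eval_rename, Function.comp_def] using h2 q hq

theorem PH_compact {ι : Type*} [Fintype ι] {K : ι → Set ℂ} (hK : ∀ i, GoodSet (K i))
    {ps : List (MvPolynomial ι ℂ × Set ℂ)} (hps : ∀ q ∈ ps, GoodSet q.2) : IsCompact (PH K ps) := by
  have h1 : IsCompact {z : ι → ℂ | ∀ j, z j ∈ K j} := by
    have := isCompact_univ_pi fun i => (hK i).1
    convert this using 1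
    ext z; simp
  have h2 : IsClosed {z : ι → ℂ | ∀ q ∈ ps, eval z q.1 ∈ q.2} := by
    simp only [Set.ofPred_forall]
    refine isClosed_iInter fun q => isClosed_iInter fun hq => ?_
    exact (hps q hq).1.isClosed.preimage (MvPolynomial.continuous_eval q.1)
  exact h1.inter_right h2

theorem oL_good {ι : Type*} {ps : List (MvPolynomial ι ℂ × Set ℂ)} (hps : ∀ q ∈ ps, GoodSet q.2) :
    ∀ q ∈ oL ps, GoodSet q.2 := by
  intro q hq
  simp only [oL, List.mem_map] at hq
  obtain ⟨q', hq', rfl⟩ := hq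
  exact hps q' hq'

theorem oK_good {ι : Type*} {K : ι → Set ℂ} (hK : ∀ i, GoodSet (K i)) {L : Set ℂ} (hL : GoodSet L) :
    ∀ o, GoodSet (oK K L o) := by
  rintro (_ | i)
  · exact hL
  · exact hK i

theorem good_strip {A : Set ℂ} (hA : GoodSet A) (e : ℂ) (a b : ℝ) :
    GoodSet (A ∩ {ζ | a ≤ (e * ζ).re ∧ (e * ζ).re ≤ b}) := by
  refine ⟨hA.1.inter_right ?_, hA.2.inter ?_⟩
  · have hc : Continuous fun ζ : ℂ => (e * ζ).re := by fun_prop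
    exact (isClosed_le continuous_const hc).inter (isClosed_le hc continuous_const)
  · have hl : IsLinearMap ℝ (fun ζ : ℂ => (e * ζ).re) := by
      constructor
      · intro x y; rw [mul_add, Complex.add_re]
      · intro c x; simp; ring
    exact (convex_halfSpace_ge hl a).inter (convex_halfSpace_le hl b)

/-- Division by `w - p(z)`. -/
theorem oka_divide {ι : Type*} [Fintype ι] (p : MvPolynomial ι ℂ) {D : (Option ι → ℂ) → ℂ}
    {S : Set (Option ι → ℂ)} (hS : IsOpen S) (hD : DifferentiableOn ℂ D S)
    (h0 : ∀ x ∈ S, x none = eval (fun i => x (some i)) p → D x = 0) :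
    ∃ g : (Option ι → ℂ) → ℂ, DifferentiableOn ℂ g S ∧
      ∀ x ∈ S, D x = (x none - eval (fun i => x (some i)) p) * g x := by
  classical
  set P : MvPolynomial (Option ι) ℂ := X none - rename some p with hP
  have hPe : ∀ x, eval x P = x none - eval (fun i => x (some i)) p := fun x => by
    simp [hP, eval_rename, Function.comp_def]
  have hP0 : P ≠ 0 := by
    intro h
    have h1 := hPe (ocons (eval (fun _ => 0) p + 1) fun _ => 0)
    rw [h] at h1; simp at h1
  have hcp : Continuous fun x : Option ι → ℂ => eval x P := MvPolynomial.continuous_eval P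
  have hcp' : Continuous fun z : ι → ℂ => eval z p := MvPolynomial.continuous_eval p
  have hDat : ∀ x ∈ S, ContDiffAt ℂ 1 D x := fun x hx =>
    ((scv_contDiffOn hS 1 hD) x hx).contDiffAt (hS.mem_nhds hx)
  obtain ⟨g, hg1, hg2⟩ := scv_riemann_ext hS (δ := fun x => eval x P)
    (s := fun x => D x / eval x P) (poly_analytic P S) (by
      intro x hx hne
      have h1 := (hD x hx).differentiableAt (hS.mem_nhds hx)
      have h2 : DifferentiableAt ℂ (fun x => eval x P) x := (poly_analytic P S x hx).differentiableAt
      simp only [div_eq_mul_inv]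
      exact h1.fun_mul (h2.fun_inv hne)) (fun x hx => poly_frequently_ne hP0 x) (by
      intro x hx
      by_cases hne : eval x P = 0
      · obtain ⟨C, t, ht, hLip⟩ := (hDat x hx).exists_lipschitzOnWith
        set π : (Option ι → ℂ) → (Option ι → ℂ) := fun y =>
          ocons (eval (fun i => y (some i)) p) fun i => y (some i) with hπ
        have hπx : π x = x := by
          have : x none = eval (fun i => x (some i)) p := by rw [hPe] at hne; exact sub_eq_zero.1 hne
          rw [hπ]; simp only; rw [← this, ocons_eta]
        have hπc : Continuous π := by
          rw [continuous_pi_iff]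
          rintro (_ | i)
          · simp only [hπ, ocons_none]; exact hcp'.comp (by fun_prop)
          · simp only [hπ, ocons_some]; fun_prop
        have ht' : t ∩ S ∈ 𝓝 x := inter_mem ht (hS.mem_nhds hx)
        refine ⟨C, ?_⟩
        filter_upwards [ht', hπc.continuousAt.preimage_mem_nhds (by rw [hπx]; exact ht')] with y hy hy' hyne
        have e1 : D (π y) = 0 := h0 _ hy'.2 (by simp [hπ])
        have e2 := hLip.dist_le_mul y hy.1 (π y) hy'.1
        rw [e1, dist_zero_right] at e2
        have e3 : dist y (π y) ≤ ‖eval y P‖ := by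
          rw [dist_pi_le_iff (norm_nonneg _)]
          rintro (_ | i)
          · rw [hPe, dist_eq_norm]; simp [hπ]
          · simp [hπ]
        rw [norm_div, div_le_iff₀ (norm_pos_iff.2 hyne)]
        exact e2.trans (by gcongr)
      · have hc : ContinuousAt (fun x => D x / eval x P) x :=
          ((hD x hx).differentiableAt (hS.mem_nhds hx)).continuousAt.div hcp.continuousAt hne
        refine ⟨‖D x / eval x P‖ + 1, ?_⟩
        filter_upwards [hc.norm.eventually_lt_const (u := ‖D x / eval x P‖ + 1) (by linarith)] with y hy _
        exact hy.le)
  refine ⟨g, hg1.differentiableOn, fun x hx => ?_⟩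
  rw [← hPe]
  by_cases hne : eval x P = 0
  · rw [hne, zero_mul]; exact h0 x hx (by rw [hPe] at hne; exact sub_eq_zero.1 hne)
  · rw [hg2 x hx hne]; field_simp

noncomputable def oE (b : Bool) : ℂ := if b then 1 else -Complex.I

theorem oE_norm (b : Bool) : ‖oE b‖ = 1 := by cases b <;> simp [oE]

def obox {κ : Type*} (l u : κ × Bool → ℝ) : Set (κ → ℂ) :=
  {x | ∀ k, l k ≤ (oE k.2 * x k.1).re ∧ (oE k.2 * x k.1).re ≤ u k}

theorem obox_close {κ : Type*} [Fintype κ] {l u : κ × Bool → ℝ} {ε : ℝ} (hε : 0 < ε)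
    (h : ∀ k, u k - l k < ε) {x y : κ → ℂ}
    (hx : x ∈ obox l u) (hy : y ∈ obox l u) : dist y x < 2 * ε := by
  rw [dist_pi_lt_iff (by positivity)]
  intro k
  rw [dist_eq_norm]
  refine (Complex.norm_le_abs_re_add_abs_im _).trans_lt ?_
  have x1 := hx (k, true)
  have x2 := hx (k, false)
  have y1 := hy (k, true)
  have y2 := hy (k, false)
  have h1 := h (k, true)
  have h2 := h (k, false)
  simp [oE] at x1 x2 y1 y2
  have a1 : |(y k - x k).re| < ε := by simp [abs_lt]; constructor <;> linarith
  have a2 : |(y k - x k).im| < ε := by simp [abs_lt]; constructor <;> linarith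
  linarith

theorem PH_obox {κ : Type*} {K : κ → Set ℂ} (hK : ∀ i, GoodSet (K i))
    (ps : List (MvPolynomial κ ℂ × Set ℂ)) (l u : κ × Bool → ℝ) :
    ∃ K', (∀ i, GoodSet (K' i)) ∧ PH K ps ∩ obox l u = PH K' ps := by
  refine ⟨fun i => (K i ∩ {ζ | l (i, true) ≤ (oE true * ζ).re ∧ (oE true * ζ).re ≤ u (i, true)}) ∩
    {ζ | l (i, false) ≤ (oE false * ζ).re ∧ (oE false * ζ).re ≤ u (i, false)}, fun i =>
    good_strip (good_strip (hK i) _ _ _) _ _ _, ?_⟩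
  ext z
  simp only [PH, obox, mem_inter_iff, mem_ofPred_eq, Prod.forall, Bool.forall_bool]
  constructor
  · rintro ⟨⟨h1, h2⟩, h3⟩
    exact ⟨fun i => ⟨⟨h1 i, (h3 i).2⟩, (h3 i).1⟩, h2⟩
  · rintro ⟨h1, h2⟩
    exact ⟨⟨fun i => (h1 i).1.1, h2⟩, fun i => ⟨(h1 i).2, (h1 i).1.2⟩⟩

theorem ocons_graph_continuous {ι : Type*} [Fintype ι] (p : MvPolynomial ι ℂ) :
    Continuous fun z : ι → ℂ => ocons (eval z p) z := by
  rw [continuous_pi_iff]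
  rintro (_ | i)
  · exact MvPolynomial.continuous_eval p
  · simp only [ocons_some]; fun_prop

theorem ocons_graph_differentiable {ι : Type*} [Fintype ι] (p : MvPolynomial ι ℂ) :
    Differentiable ℂ fun z : ι → ℂ => ocons (eval z p) z := by
  intro z
  rw [differentiableAt_pi]
  rintro (_ | i)
  · exact (poly_analytic p univ z (mem_univ z)).differentiableAt
  · simp only [ocons_some]; fun_prop

/-- Oka extension to a graph. -/
theorem oka_ext {ι : Type} [Fintype ι] [DecidableEq ι] {K : ι → Set ℂ} (hK : ∀ i, GoodSet (K i))
    {ps : List (MvPolynomial ι ℂ × Set ℂ)} (hps : ∀ q ∈ ps, GoodSet q.2)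
    (hspl : ∀ K' : Option ι → Set ℂ, (∀ i, GoodSet (K' i)) → ∀ o e c, ‖e‖ = 1 →
      SplAt (PH K' (oL ps)) o e c) (p : MvPolynomial ι ℂ) {L : Set ℂ} (hL : GoodSet L)
    {f : (ι → ℂ) → ℂ} (hf : HolNear f (PH K ps ∩ {z | eval z p ∈ L})) :
    ∃ G : (Option ι → ℂ) → ℂ, HolNear G (PH (oK K L) (oL ps)) ∧
      ∀ z ∈ PH K ps, eval z p ∈ L → ∀ᶠ z' in 𝓝 z, G (ocons (eval z' p) z') = f z' := by
  set Q := PH (oK K L) (oL ps) with hQ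
  have hoK := oK_good hK hL
  have hoL := oL_good hps
  have hQc : IsCompact Q := PH_compact hoK hoL
  set Γ : (ι → ℂ) → (Option ι → ℂ) := fun z => ocons (eval z p) z with hΓ
  have hΓc : Continuous Γ := ocons_graph_continuous p
  set δ : (Option ι → ℂ) → ℂ := fun x => x none - eval (fun i => x (some i)) p with hδ
  have hδΓ : ∀ z, δ (Γ z) = 0 := fun z => by simp [hδ, hΓ]
  have hΓδ : ∀ x, δ x = 0 → x = Γ (fun i => x (some i)) := fun x hx => by
    have : x none = eval (fun i => x (some i)) p := sub_eq_zero.1 hx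
    simp only [hΓ]; rw [← this, ocons_eta]
  have hcs : Continuous fun (x : Option ι → ℂ) (i : ι) => x (some i) := by fun_prop
  have hδc : Continuous δ := by
    have := (MvPolynomial.continuous_eval p).comp hcs
    exact (continuous_apply none).sub this
  have hδd : Differentiable ℂ δ := by
    intro x
    refine DifferentiableAt.fun_sub (by fun_prop) ?_
    refine DifferentiableAt.fun_comp' (g := fun z => eval z p) (f := fun (x : Option ι → ℂ) (i : ι) => x (some i)) x
      (poly_analytic p univ _ (mem_univ _)).differentiableAt ?_
    rw [differentiableAt_pi]; intro i; fun_prop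
  set Sol : (Option ι × Bool → ℝ) → (Option ι × Bool → ℝ) → Prop := fun l u =>
    ∃ G : (Option ι → ℂ) → ℂ, HolNear G (Q ∩ obox l u) ∧
      ∀ z, Γ z ∈ Q ∩ obox l u → ∀ᶠ z' in 𝓝 z, G (Γ z') = f z' with hSol
  have hclosed : ∀ l u, IsClosed (Q ∩ obox l u) := by
    intro l u
    obtain ⟨K', hK', hK'e⟩ := PH_obox hoK (oL ps) l u
    rw [hQ, hK'e]; exact (PH_compact hK' hoL).isClosed
  -- merging
  have hmerge : ∀ l u i c, l i ≤ c → c ≤ u i → Sol l (Function.update u i c) →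
      Sol (Function.update l i c) u → Sol l u := by
    rintro l u i c hlc hcu ⟨G₁, hG₁, hG₁f⟩ ⟨G₂, hG₂, hG₂f⟩
    have hb1 : obox l (Function.update u i c) = obox l u ∩ {x | (oE i.2 * x i.1).re ≤ c} := by
      ext x
      simp only [obox, mem_inter_iff, mem_ofPred_eq]
      constructor
      · intro h
        have hi := (h i).2
        rw [Function.update_self] at hi
        refine ⟨fun k => ⟨(h k).1, ?_⟩, hi⟩
        by_cases hk : k = i
        · subst hk; exact hi.trans hcu
        · simpa [hk] using (h k).2
      · rintro ⟨h, hi⟩ k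
        refine ⟨(h k).1, ?_⟩
        by_cases hk : k = i
        · subst hk; simpa using hi
        · simpa [hk] using (h k).2
    have hb2 : obox (Function.update l i c) u = obox l u ∩ {x | c ≤ (oE i.2 * x i.1).re} := by
      ext x
      simp only [obox, mem_inter_iff, mem_ofPred_eq]
      constructor
      · intro h
        have hi := (h i).1
        rw [Function.update_self] at hi
        refine ⟨fun k => ⟨?_, (h k).2⟩, hi⟩
        by_cases hk : k = i
        · subst hk; exact hlc.trans hi
        · simpa [hk] using (h k).1
      · rintro ⟨h, hi⟩ k
        refine ⟨?_, (h k).2⟩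
        by_cases hk : k = i
        · subst hk; simpa using hi
        · simpa [hk] using (h k).1
    have hc1 := hclosed l (Function.update u i c)
    have hc2 := hclosed (Function.update l i c) u
    set A₁ := Q ∩ obox l (Function.update u i c) with hA₁
    set A₂ := Q ∩ obox (Function.update l i c) u with hA₂
    obtain ⟨K', hK', hK'e⟩ := PH_obox hoK (oL ps) l u
    rw [← hQ] at hK'e
    have hA₁e : A₁ = PH K' (oL ps) ∩ {x | (oE i.2 * x i.1).re ≤ c} := by
      rw [← hK'e, hA₁, hb1, inter_assoc]
    have hA₂e : A₂ = PH K' (oL ps) ∩ {x | c ≤ (oE i.2 * x i.1).re} := by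
      rw [← hK'e, hA₂, hb2, inter_assoc]
    have hA₁₂ : A₁ ∩ A₂ = PH K' (oL ps) ∩ {x | (oE i.2 * x i.1).re = c} := by
      rw [hA₁e, hA₂e]; ext x; simp only [mem_inter_iff, mem_ofPred_eq]
      constructor
      · rintro ⟨⟨h1, h2⟩, -, h3⟩; exact ⟨h1, le_antisymm h2 h3⟩
      · rintro ⟨h1, h2⟩; exact ⟨⟨h1, h2.le⟩, h1, h2.ge⟩
    have hAun : Q ∩ obox l u = A₁ ∪ A₂ := by
      rw [hA₁e, hA₂e, hK'e]; ext x; simp only [mem_union, mem_inter_iff, mem_ofPred_eq]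
      have := le_total (oE i.2 * x i.1).re c
      tauto
    set S : Set (Option ι → ℂ) := {x | ∀ᶠ y in 𝓝 x, DifferentiableAt ℂ (fun x => G₁ x - G₂ x) y ∧
      (δ y = 0 → G₁ y - G₂ y = 0)} with hS
    have hSo : IsOpen S := isOpen_setOfPred_eventually_nhds
    obtain ⟨g, hgd, hg⟩ := oka_divide p (D := fun x => G₁ x - G₂ x) hSo
      (fun x hx => (Eventually.self_of_nhds hx).1.differentiableWithinAt)
      (fun x hx h0 => (Eventually.self_of_nhds hx).2 (sub_eq_zero.2 h0))
    have hIS : A₁ ∩ A₂ ⊆ S := by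
      rintro x ⟨hx1, hx2⟩
      simp only [hS, mem_ofPred_eq]
      by_cases hx0 : δ x = 0
      · have hxe := hΓδ x hx0
        have k1 := hG₁f (fun i => x (some i)) (by rw [← hxe]; exact hx1)
        have k2 := hG₂f (fun i => x (some i)) (by rw [← hxe]; exact hx2)
        have k3 := (hcs.continuousAt (x := x)).eventually (k1.and k2)
        filter_upwards [hG₁ x hx1, hG₂ x hx2, k3] with y y1 y2 y3
        refine ⟨y1.fun_sub y2, fun hy0 => ?_⟩
        rw [hΓδ y hy0, y3.1, y3.2, sub_self]
      · filter_upwards [hG₁ x hx1, hG₂ x hx2, hδc.continuousAt.eventually_ne hx0] with y y1 y2 y3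
        exact ⟨y1.fun_sub y2, fun h => absurd h y3⟩
    obtain ⟨g', g'', hg', hg'', hgg⟩ := hspl K' hK' i.1 (oE i.2) c (oE_norm _) g (by
      intro x hx
      rw [← hA₁₂] at hx
      filter_upwards [hSo.mem_nhds (hIS hx)] with y hy
      exact (hgd y hy).differentiableAt (hSo.mem_nhds hy))
    rw [← hA₁e] at hg'
    rw [← hA₂e] at hg''
    obtain ⟨G, hGa, hGb⟩ := glue_near hc1 hc2 (f := fun x => G₁ x - δ x * g' x)
      (g := fun x => G₂ x - δ x * g'' x) (by
        intro x hx
        have hx' := hx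
        rw [hA₁₂] at hx'
        filter_upwards [hgg x hx', hSo.mem_nhds (hIS hx)] with y y1 y2
        have := hg y y2
        rw [y1] at this
        simp only [hδ]
        linear_combination this)
    refine ⟨G, ?_, ?_⟩
    · rw [hAun]
      rintro x (hx | hx)
      · have : HolNear (fun x => G₁ x - δ x * g' x) A₁ := fun x hx => by
          filter_upwards [hG₁ x hx, hg' x hx] with y y1 y2
          exact y1.fun_sub ((hδd y).fun_mul y2)
        exact this.congr hGa x hx
      · have : HolNear (fun x => G₂ x - δ x * g'' x) A₂ := fun x hx => by
          filter_upwards [hG₂ x hx, hg'' x hx] with y y1 y2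
          exact y1.fun_sub ((hδd y).fun_mul y2)
        exact this.congr hGb x hx
    · intro z hz
      rw [hAun] at hz
      rcases hz with hz | hz
      · filter_upwards [hG₁f z hz, (hΓc.continuousAt (x := z)).eventually (hGa _ hz)] with y y1 y2
        rw [y2]; simp only [hδΓ]; rw [y1]; ring
      · filter_upwards [hG₂f z hz, (hΓc.continuousAt (x := z)).eventually (hGb _ hz)] with y y1 y2
        rw [y2]; simp only [hδΓ]; rw [y1]; ring
  -- small boxes
  have hloc : ∀ x ∈ Q, ∃ N : Set (Option ι → ℂ), IsOpen N ∧ x ∈ N ∧ ((∀ y ∈ N, δ y ≠ 0) ∨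
      ∀ y ∈ N, DifferentiableAt ℂ (fun x : Option ι → ℂ => f (fun i => x (some i))) y) := by
    intro x hx
    by_cases hx0 : δ x = 0
    · have hxQ := mem_PH_oK.1 hx
      have hfx := hf (fun i => x (some i)) ⟨hxQ.1, by
        rw [mem_ofPred_eq, ← sub_eq_zero.1 hx0]; exact hxQ.2⟩
      obtain ⟨N, hN, hNo, hxN⟩ := eventually_nhds_iff.1 ((hcs.continuousAt (x := x)).eventually hfx)
      refine ⟨N, hNo, hxN, Or.inr fun y hy => ?_⟩
      refine DifferentiableAt.fun_comp' (f := fun (x : Option ι → ℂ) (i : ι) => x (some i)) y (hN y hy) ?_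
      rw [differentiableAt_pi]; intro i; fun_prop
    · obtain ⟨N, hN, hNo, hxN⟩ := eventually_nhds_iff.1 (hδc.continuousAt.eventually_ne hx0)
      exact ⟨N, hNo, hxN, Or.inl hN⟩
  choose! N hNo hxN hN using hloc
  obtain ⟨ε, hε, hLeb⟩ := lebesgue_number_lemma_of_metric hQc (c := fun x : Q => N x)
    (fun x => hNo _ x.2) (fun x hx => mem_iUnion.2 ⟨⟨x, hx⟩, hxN x hx⟩)
  have hsmall : ∀ l u, (∀ i, u i - l i < ε / 2) → Sol l u := by
    intro l u hlu
    rcases (Q ∩ obox l u).eq_empty_or_nonempty with he | ⟨x, hx⟩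
    · refine ⟨0, ?_, ?_⟩
      · rw [he]; intro x hx; exact hx.elim
      · rw [he]; intro x hx; exact hx.elim
    · obtain ⟨x', hx'⟩ := hLeb x hx.1
      have hsub : Q ∩ obox l u ⊆ N x' := fun y hy => hx' (by
        have := obox_close (by positivity) hlu hx.2 hy.2
        rw [Metric.mem_ball]; linarith)
      rcases hN x' x'.2 with h1 | h1
      · refine ⟨0, fun x hx => Eventually.of_forall fun y => differentiableAt_const _, fun z hz => ?_⟩
        exact absurd (hδΓ z) (h1 _ (hsub hz))
      · refine ⟨fun x => f (fun i => x (some i)), fun x hx => ?_, fun z hz =>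
          Eventually.of_forall fun y => by simp [hΓ]⟩
        filter_upwards [(hNo _ x'.2).mem_nhds (hsub hx)] with y hy
        exact h1 y hy
  obtain ⟨M, hM⟩ := hQc.isBounded.exists_norm_le
  have hbox : Q ⊆ obox (fun _ => -M) (fun _ => M) := by
    intro x hx k
    have h1 := hM x hx
    have h2 := norm_le_pi_norm x k.1
    have h3 := Complex.abs_re_le_norm (oE k.2 * x k.1)
    rw [norm_mul, oE_norm, one_mul] at h3
    exact abs_le.1 (h3.trans (h2.trans h1))
  obtain ⟨G, hG1, hG2⟩ := box_induction hmerge (half_pos hε) hsmall (fun _ => -M) (fun _ => M)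
  rw [inter_eq_left.2 hbox] at hG1 hG2
  exact ⟨G, hG1, fun z hz hzL => hG2 z (mem_PH_oK.2 ⟨hz, hzL⟩)⟩

end Oka

open Set Filter Topology MvPolynomial

section Oka

theorem oka_spl : ∀ (n : ℕ) {ι : Type} [Fintype ι] [DecidableEq ι] {K : ι → Set ℂ}
    (_ : ∀ i, GoodSet (K i)) {ps : List (MvPolynomial ι ℂ × Set ℂ)} (_ : ∀ q ∈ ps, GoodSet q.2)
    (_ : ps.length = n) (i : ι) {e : ℂ} (_ : ‖e‖ = 1) (c : ℝ), SplAt (PH K ps) i e c := by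
  intro n
  induction n with
  | zero =>
    intro ι _ _ K hK ps hps hlen i e he c
    have : PH K ps = {z | ∀ j, z j ∈ K j} := by
      rw [List.length_eq_zero_iff.1 hlen]; ext z; simp [PH]
    rw [this]
    exact oka_spl_base (fun i => (hK i).1) (fun i => (hK i).2) i he c
  | succ n ih =>
    intro ι _ _ K hK ps hps hlen i e he c h hh
    obtain ⟨⟨p, L⟩, ps', rfl⟩ := List.exists_cons_of_length_eq_add_one hlen
    have hlen' : ps'.length = n := by simpa using hlen
    have hps' : ∀ q ∈ ps', GoodSet q.2 := fun q hq => hps q (List.mem_cons_of_mem _ hq)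
    have hL : GoodSet L := hps (p, L) (by simp)
    have hPH : ∀ K : ι → Set ℂ, PH K ((p, L) :: ps') = PH K ps' ∩ {z | eval z p ∈ L} := by
      intro K; ext z
      simp only [PH, mem_inter_iff, mem_ofPred_eq, List.forall_mem_cons]; tauto
    have hspl : ∀ K' : Option ι → Set ℂ, (∀ i, GoodSet (K' i)) → ∀ o e c, ‖e‖ = 1 →
      SplAt (PH K' (oL ps')) o e c := fun K' hK' o e c he =>
      ih hK' (oL_good hps') (by simp [oL, hlen']) o he c
    -- restrict to cut
    set Kc : ι → Set ℂ := Function.update K i (K i ∩ {ζ | c ≤ (e * ζ).re ∧ (e * ζ).re ≤ c}) with hKc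
    have hKcg : ∀ j, GoodSet (Kc j) := by
      intro j
      by_cases hj : j = i
      · subst hj; simpa [hKc] using good_strip (hK j) e c c
      · simpa [hKc, hj] using hK j
    have hPHc : PH Kc ps' = PH K ps' ∩ {z | (e * z i).re = c} := by
      ext z
      simp only [PH, mem_inter_iff, mem_ofPred_eq]
      constructor
      · rintro ⟨h1, h2⟩
        have hi := h1 i
        simp only [hKc, Function.update_self, mem_inter_iff, mem_ofPred_eq] at hi
        refine ⟨⟨fun j => ?_, h2⟩, le_antisymm hi.2.2 hi.2.1⟩
        by_cases hj : j = i
        · subst hj; exact hi.1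
        · simpa [hKc, hj] using h1 j
      · rintro ⟨⟨h1, h2⟩, h3⟩
        refine ⟨fun j => ?_, h2⟩
        by_cases hj : j = i
        · subst hj; simp only [hKc, Function.update_self, mem_inter_iff, mem_ofPred_eq]
          exact ⟨h1 j, h3.ge, h3.le⟩
        · simpa [hKc, hj] using h1 j
    obtain ⟨H, hH, hHh⟩ := oka_ext hKcg hps' hspl p hL (f := h) (by
      rw [hPHc]; rw [hPH] at hh
      intro x hx; exact hh x ⟨⟨hx.1.1, hx.2⟩, hx.1.2⟩)
    obtain ⟨H', H'', hH', hH'', hHH⟩ := hspl (oK K L) (oK_good hK hL) (some i) e c he H (by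
      rintro x ⟨hx, hxc⟩
      refine hH x ?_
      rw [mem_PH_oK] at hx ⊢
      exact ⟨by rw [hPHc]; exact ⟨hx.1, hxc⟩, hx.2⟩)
    have hΓc : Continuous fun z : ι → ℂ => ocons (eval z p) z := ocons_graph_continuous p
    have hΓd := ocons_graph_differentiable p
    refine ⟨fun z => H' (ocons (eval z p) z), fun z => H'' (ocons (eval z p) z), ?_, ?_, ?_⟩
    · rintro x ⟨hx, hxc⟩
      rw [hPH] at hx
      have := hH' (ocons (eval x p) x) ⟨mem_PH_oK.2 hx, hxc⟩
      filter_upwards [(hΓc.continuousAt (x := x)).eventually this] with y hy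
      exact DifferentiableAt.fun_comp' (f := fun z : ι → ℂ => ocons (eval z p) z) y hy (hΓd y)
    · rintro x ⟨hx, hxc⟩
      rw [hPH] at hx
      have := hH'' (ocons (eval x p) x) ⟨mem_PH_oK.2 hx, hxc⟩
      filter_upwards [(hΓc.continuousAt (x := x)).eventually this] with y hy
      exact DifferentiableAt.fun_comp' (f := fun z : ι → ℂ => ocons (eval z p) z) y hy (hΓd y)
    · rintro x ⟨hx, hxc⟩
      rw [hPH] at hx
      have h1 := hHH (ocons (eval x p) x) ⟨mem_PH_oK.2 hx, hxc⟩
      have h2 := hHh x (by rw [hPHc]; exact ⟨hx.1, hxc⟩) hx.2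
      filter_upwards [(hΓc.continuousAt (x := x)).eventually h1, h2] with y y1 y2
      rw [← y2, y1]

theorem oka_app {R : ℝ} (hR : 0 < R) : ∀ (n : ℕ) {ι : Type} [Fintype ι] [DecidableEq ι]
    (ps : List (MvPolynomial ι ℂ)) (_ : ps.length = n) {f : (ι → ℂ) → ℂ}
    (_ : HolNear f {z | ‖z‖ ≤ R ∧ ∀ q ∈ ps, ‖eval z q‖ ≤ R}) {ε : ℝ} (_ : 0 < ε),
    ∃ P : MvPolynomial ι ℂ, ∀ z, ‖z‖ ≤ R → (∀ q ∈ ps, ‖eval z q‖ ≤ R) → ‖f z - eval z P‖ < ε := by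
  intro n
  induction n with
  | zero =>
    intro ι _ _ ps hlen f hf ε hε
    rw [List.length_eq_zero_iff.1 hlen] at hf ⊢
    simp only [List.not_mem_nil, false_implies, implies_true, and_true, forall_const] at hf ⊢
    have hset : {z : ι → ℂ | ‖z‖ ≤ R} = Metric.closedBall 0 R := by ext; simp
    rw [hset] at hf
    obtain ⟨d, hd, hsub⟩ := (isCompact_closedBall (0 : ι → ℂ) R).exists_thickening_subset_open
      (isOpen_setOfPred_eventually_nhds : IsOpen {x | ∀ᶠ y in 𝓝 x, DifferentiableAt ℂ f y}) hf
    obtain ⟨P, hP⟩ := scv_taylor_approx (f := f) hR (R := R + d) (by linarith) (by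
      intro x hx
      refine DifferentiableAt.differentiableWithinAt (Eventually.self_of_nhds (hsub ?_))
      rw [thickening_closedBall hd hR.le, add_comm]; exact hx) hε
    exact ⟨P, fun z hz => hP z (by simpa using hz)⟩
  | succ n ih =>
    intro ι _ _ ps hlen f hf ε hε
    obtain ⟨p, ps', rfl⟩ := List.exists_cons_of_length_eq_add_one hlen
    have hlen' : ps'.length = n := by simpa using hlen
    set L : Set ℂ := Metric.closedBall 0 R with hLd
    have hL : GoodSet L := ⟨isCompact_closedBall _ _, convex_closedBall _ _⟩
    set ps'' : List (MvPolynomial ι ℂ × Set ℂ) := ps'.map fun q => (q, L) with hps''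
    have hg : ∀ q ∈ ps'', GoodSet q.2 := by
      intro q hq
      simp only [hps'', List.mem_map] at hq
      obtain ⟨q', _, rfl⟩ := hq; exact hL
    have hmem : ∀ z, z ∈ PH (fun _ : ι => L) ps'' ↔ ‖z‖ ≤ R ∧ ∀ q ∈ ps', ‖eval z q‖ ≤ R := by
      intro z
      rw [pi_norm_le_iff_of_nonneg hR.le]
      simp [PH, hps'', hLd]
    obtain ⟨G, hG, hGf⟩ := oka_ext (K := fun _ : ι => L) (fun _ => hL) hg (fun K' hK' o e c he =>
      oka_spl n hK' (oL_good hg) (by simp [oL, hps'', hlen']) o he c) p hL (f := f) (by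
        rintro x ⟨hx, hx'⟩
        rw [hmem] at hx
        refine hf x ⟨hx.1, ?_⟩
        simp only [List.forall_mem_cons]
        exact ⟨by simpa [hLd] using hx', hx.2⟩)
    obtain ⟨P, hP⟩ := ih (ι := Option ι) (ps'.map (rename some)) (by simpa using hlen') (f := G) (by
      rintro x ⟨hx, hx'⟩
      refine hG x (mem_PH_oK.2 ⟨(hmem _).2 ⟨?_, fun q hq => ?_⟩, ?_⟩)
      · rw [pi_norm_le_iff_of_nonneg hR.le]; exact fun i => (norm_le_pi_norm x _).trans hx
      · have := hx' _ (List.mem_map_of_mem hq)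
        simpa [eval_rename, Function.comp_def] using this
      · simpa [hLd] using (norm_le_pi_norm x none).trans hx) hε
    refine ⟨bind₁ (fun o => Option.elim o p X) P, fun z hz hq => ?_⟩
    simp only [List.forall_mem_cons] at hq
    have h1 := (hGf z ((hmem z).2 ⟨hz, hq.2⟩) (by simpa [hLd] using hq.1)).self_of_nhds
    have h2 := hP (ocons (eval z p) z) (by
      rw [pi_norm_le_iff_of_nonneg hR.le]
      rintro (_ | i)
      · exact hq.1
      · exact (norm_le_pi_norm z i).trans hz) (by
      intro q hq'
      obtain ⟨q', hq2, rfl⟩ := List.mem_map.1 hq'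
      simpa [eval_rename, Function.comp_def] using hq.2 q' hq2)
    rw [h1] at h2
    convert h2 using 3
    rw [← MvPolynomial.coe_aeval_eq_eval, ← MvPolynomial.coe_aeval_eq_eval, RingHom.coe_coe, RingHom.coe_coe,
      aeval_bind₁]
    congr 2
    ext o; cases o <;> simp

/-- The Oka–Weil theorem. -/
theorem oka_weil {ι : Type} [Fintype ι] {K : Set (ι → ℂ)} (hK : IsCompact K) (hhull : polyHull K ⊆ K)
    {f : (ι → ℂ) → ℂ} (hf : HolNear f K) {ε : ℝ} (hε : 0 < ε) :
    ∃ P : MvPolynomial ι ℂ, ∀ z ∈ K, ‖f z - eval z P‖ < ε := by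
  classical
  rcases K.eq_empty_or_nonempty with rfl | ⟨k0, hk0⟩
  · exact ⟨0, by simp⟩
  obtain ⟨R0, hR0⟩ := hK.isBounded.exists_norm_le
  set R := max R0 1 with hRd
  have hR : 0 < R := lt_of_lt_of_le one_pos (le_max_right _ _)
  set U : Set (ι → ℂ) := {x | ∀ᶠ y in 𝓝 x, DifferentiableAt ℂ f y} with hU
  have hUo : IsOpen U := isOpen_setOfPred_eventually_nhds
  have hC : IsCompact (Metric.closedBall (0 : ι → ℂ) R \ U) := (isCompact_closedBall _ _).diff hUo
  have hsep : ∀ z ∈ Metric.closedBall (0 : ι → ℂ) R \ U, ∃ q : MvPolynomial ι ℂ,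
      (∀ w ∈ K, ‖eval w q‖ ≤ R) ∧ R < ‖eval z q‖ := by
    rintro z ⟨-, hzU⟩
    have hz : z ∉ polyHull K := fun h => hzU (hf z (hhull h))
    simp only [polyHull, mem_ofPred_eq, not_forall, not_le] at hz
    obtain ⟨p, M, hM, hpz⟩ := hz
    have hM0 : 0 ≤ M := (norm_nonneg _).trans (hM k0 hk0)
    set M' := (M + ‖eval z p‖) / 2 with hM'
    have h1 : M < M' := by rw [hM']; linarith
    have h2 : M' < ‖eval z p‖ := by rw [hM']; linarith
    have h3 : 0 < M' := by linarith
    refine ⟨C ((R / M' : ℝ) : ℂ) * p, fun w hw => ?_, ?_⟩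
    · simp only [map_mul, eval_C, norm_mul, Complex.norm_real, Real.norm_eq_abs,
        abs_of_pos (div_pos hR h3)]
      rw [div_mul_eq_mul_div, div_le_iff₀ h3]
      exact mul_le_mul_of_nonneg_left ((hM w hw).trans h1.le) hR.le
    · simp only [map_mul, eval_C, norm_mul, Complex.norm_real, Real.norm_eq_abs,
        abs_of_pos (div_pos hR h3)]
      rw [div_mul_eq_mul_div, lt_div_iff₀ h3]
      exact mul_lt_mul_of_pos_left h2 hR
  choose! q hq1 hq2 using hsep
  obtain ⟨t, ht, htc⟩ := hC.elim_nhds_subcover (fun z => {y | R < ‖eval y (q z)‖}) (fun z hz =>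
    (isOpen_lt continuous_const (MvPolynomial.continuous_eval (q z)).norm).mem_nhds (hq2 z hz))
  obtain ⟨P, hP⟩ := oka_app hR _ ((t.toList).map q) rfl (f := f) (by
    rintro z ⟨hz, hzq⟩
    by_contra hzU
    have := htc ⟨by simpa using hz, hzU⟩
    simp only [mem_iUnion] at this
    obtain ⟨y, hy, hyz⟩ := this
    exact absurd (hzq (q y) (List.mem_map_of_mem (Finset.mem_toList.2 hy))) (not_le.2 hyz)) hε
  refine ⟨P, fun z hz => hP z ((hR0 z hz).trans (le_max_left _ _)) fun q' hq' => ?_⟩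
  obtain ⟨y, hy, rfl⟩ := List.mem_map.1 hq'
  exact hq1 y (ht y (Finset.mem_toList.1 hy)) z hz

theorem polyHull_idem {ι : Type*} (K : Set (ι → ℂ)) : polyHull (polyHull K) ⊆ polyHull K :=
  fun _ hz p M hM => hz p M fun w hw => hw p M hM

theorem polyHull_mono {ι : Type*} {K L : Set (ι → ℂ)} (h : K ⊆ L) : polyHull K ⊆ polyHull L :=
  fun _ hz p M hM => hz p M fun w hw => hM w (h hw)

/-- hull of a compact subset of a Runge domain stays inside -/
theorem runge_hull_subset {N : ℕ} {Ω : Set (CE N)} (hΩ : IsRungeDomain Ω) {K : Set (CE N)}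
    (hK : IsCompact K) (hKΩ : K ⊆ Ω) : polyHull K ⊆ Ω := by
  have h1 := cartan_thullen hΩ hK hKΩ
  have hΩo : IsOpen Ω := hΩ.1.1
  have hH := isCompact_polyHull hK
  have h2 : IsCompact (polyHull K \ Ω) := hH.diff hΩo
  intro z hz
  by_contra hzΩ
  obtain ⟨f, hf1, hf2⟩ := glue_near (f := fun _ : CE N => (0:ℂ)) (g := fun _ => (1:ℂ)) h1.isClosed h2.isClosed
    (by rintro x ⟨hx, hx'⟩; exact absurd hx.2 hx'.2)
  obtain ⟨P, hP⟩ := oka_weil hH (polyHull_idem K) (f := f) (by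
    intro x hx
    by_cases hxΩ : x ∈ Ω
    · have : HolNear (fun _ : CE N => (0:ℂ)) (polyHull K ∩ Ω) := fun x hx =>
        Eventually.of_forall fun y => differentiableAt_const _
      exact this.congr hf1 x ⟨hx, hxΩ⟩
    · have : HolNear (fun _ : CE N => (1:ℂ)) (polyHull K \ Ω) := fun x hx =>
        Eventually.of_forall fun y => differentiableAt_const _
      exact this.congr hf2 x ⟨hx, hxΩ⟩) (ε := 1/3) (by norm_num)
  have h3 := hz P (1/3) fun w hw => by
    have := hP w (subset_polyHull K hw)
    rw [(hf1 w ⟨subset_polyHull K hw, hKΩ hw⟩).self_of_nhds] at this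
    simpa using this.le
  have h4 := hP z hz
  rw [(hf2 z ⟨hz, hzΩ⟩).self_of_nhds] at h4
  have h5 := norm_sub_norm_le (1:ℂ) (eval z P)
  rw [norm_one] at h5
  norm_num at h3 h4
  linarith

/-- Interior of a compact polynomially convex set is a Runge domain. -/
theorem runge_interior {N : ℕ} {L : Set (CE N)} (hL : IsCompact L) (hh : polyHull L ⊆ L) :
    IsRungeDomain (interior L) := by
  refine ⟨⟨isOpen_interior, ?_⟩, ?_⟩
  · rintro ⟨U₁, U₂, hU₁, hU₂, ⟨x1, hx1⟩, hsub, hconn, hnot, hall⟩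
    have hb : ∃ b ∈ U₂, b ∉ L := by
      by_contra hcon
      push Not at hcon
      exact hnot (interior_maximal hcon hU₂)
    obtain ⟨b, hbU, hbL⟩ := hb
    have hb' : b ∉ polyHull L := fun h => hbL (hh h)
    simp only [polyHull, mem_ofPred_eq, not_forall, not_le] at hb'
    obtain ⟨p, M, hM, hpb⟩ := hb'
    have hne : ∀ x ∈ interior L, eval x (p - C (eval b p)) ≠ 0 := by
      intro x hx h0
      have : eval x p = eval b p := by simpa [sub_eq_zero] using h0
      have h1 := hM x (interior_subset hx)
      rw [this] at h1; linarith
    obtain ⟨F, hF, hFe⟩ := hall (fun x => (eval x (p - C (eval b p)))⁻¹)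
      ((poly_analytic _ _).inv hne)
    have h1 : EqOn (fun x => F x * eval x (p - C (eval b p))) 1 U₂ := by
      refine (hF.mul (poly_analytic _ _)).eqOn_of_preconnected_of_eventuallyEq analyticOnNhd_const
        hconn.isPreconnected (hsub hx1).2 ?_
      filter_upwards [hU₁.mem_nhds hx1] with y hy
      simp only [Pi.mul_apply, Pi.one_apply]
      rw [← hFe hy]; exact inv_mul_cancel₀ (hne y (hsub hy).1)
    have h2 := h1 hbU
    simp at h2
  · intro f hf K hK hKL ε hε
    have hKh := isCompact_polyHull hK
    have hin : polyHull K ⊆ interior L := by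
      obtain ⟨d, hd, hdsub⟩ := hK.exists_thickening_subset_open isOpen_interior hKL
      intro z hz
      rw [mem_interior_iff_mem_nhds]
      filter_upwards [Metric.ball_mem_nhds z hd] with y hy
      refine hh fun p M hM => ?_
      set v := y - z with hv
      have key := hz (bind₁ (fun i => X i + C (v i)) p) M
      have hev : ∀ w : CE N, eval w (bind₁ (fun i => X i + C (v i)) p) = eval (w + v) p := by
        intro w
        rw [← MvPolynomial.coe_aeval_eq_eval, ← MvPolynomial.coe_aeval_eq_eval, RingHom.coe_coe,
          RingHom.coe_coe, aeval_bind₁]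
        congr 2
        ext i; simp
      simp only [hev] at key
      have hzv : z + v = y := by rw [hv]; abel
      rw [hzv] at key
      refine key fun w hw => hM _ (interior_subset (hdsub ?_))
      rw [Metric.mem_thickening_iff]
      refine ⟨w, hw, ?_⟩
      rw [dist_eq_norm, add_sub_cancel_left, hv, ← dist_eq_norm]; exact hy
    obtain ⟨P, hP⟩ := oka_weil hKh (polyHull_idem K) (f := f) (fun x hx => by
      filter_upwards [isOpen_interior.mem_nhds (hin hx)] with y hy
      exact (hf y hy).differentiableAt) hε
    exact ⟨P, fun z hz => hP z (subset_polyHull K hz)⟩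

/-- Exhaustion step. -/
theorem runge_between {N : ℕ} {Ω : Set (CE N)} (hΩ : IsRungeDomain Ω) {K : Set (CE N)}
    (hK : IsCompact K) (hKΩ : K ⊆ Ω) : ∃ Ω₁ : Set (CE N), IsRungeDomain Ω₁ ∧ K ⊆ Ω₁ ∧
      ∃ L, IsCompact L ∧ Ω₁ ⊆ L ∧ L ⊆ Ω := by
  obtain ⟨K', hK', h1, h2⟩ := exists_compact_between hK hΩ.1.1 hKΩ
  refine ⟨interior (polyHull K'), runge_interior (isCompact_polyHull hK') (polyHull_idem K'),
    h1.trans (interior_mono (subset_polyHull K')), polyHull K', isCompact_polyHull hK',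
    interior_subset, runge_hull_subset hΩ hK' h2⟩

end Oka

open Set Filter Topology MvPolynomial

/-- value of `Q ∈ ℂ[x][T]` at `(x,t)` -/
noncomputable def qev {ι : Type*} (Q : Polynomial (MvPolynomial ι ℂ)) (x : ι → ℂ) (t : ℂ) : ℂ :=
  (Q.map (eval x)).eval t

/-- `u` is integral over `ℂ[x]` as a function on `S` -/
def IntOn {T : Type*} {ι : Type*} (S : Set T) (x : T → ι → ℂ) (u : T → ℂ) : Prop :=
  ∃ Q : Polynomial (MvPolynomial ι ℂ), Q.Monic ∧ ∀ z ∈ S, qev Q (x z) (u z) = 0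

/-- substitution hom into functions on `S` -/
noncomputable def fhom {T : Type*} {ι : Type*} (S : Set T) (x : T → ι → ℂ) :
    MvPolynomial ι ℂ →ₐ[ℂ] (S → ℂ) := aeval fun i (z : S) => x z i

theorem coe_aeval_eq_eval' {ι : Type*} (x : ι → ℂ) (p : MvPolynomial ι ℂ) : aeval x p = eval x p := by
  rw [← coe_aeval_eq_eval, RingHom.coe_coe]

theorem fhom_apply {T : Type*} {ι : Type*} (S : Set T) (x : T → ι → ℂ) (p : MvPolynomial ι ℂ) (z : S) :
    fhom S x p z = eval (x z) p := by
  have h : (Pi.evalAlgHom ℂ (fun _ : S => ℂ) z).comp (fhom S x) = aeval (x z) := by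
    ext i; simp [fhom]
  have := DFunLike.congr_fun h p
  rw [coe_aeval_eq_eval' (x z) p] at this
  exact this

theorem intOn_iff {T : Type*} {ι : Type*} (S : Set T) (x : T → ι → ℂ) (u : T → ℂ) :
    IntOn S x u ↔ (fhom S x).toRingHom.IsIntegralElem (fun z : S => u z) := by
  have key : ∀ Q : Polynomial (MvPolynomial ι ℂ), ∀ z : S,
      Polynomial.eval₂ (fhom S x).toRingHom (fun z : S => u z) Q z = qev Q (x z) (u z) := by
    intro Q z
    have h1 := Polynomial.hom_eval₂ Q (fhom S x).toRingHom (Pi.evalRingHom (fun _ : S => ℂ) z)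
      (fun z : S => u z)
    rw [Pi.evalRingHom_apply] at h1
    rw [h1, qev, Polynomial.eval_map]
    congr 1
    refine RingHom.ext fun p => ?_
    exact fhom_apply S x p z
  constructor
  · rintro ⟨Q, hQ, h⟩
    exact ⟨Q, hQ, funext fun z => by rw [key]; exact h z z.2⟩
  · rintro ⟨Q, hQ, h⟩
    exact ⟨Q, hQ, fun z hz => by rw [← key Q ⟨z, hz⟩, h]; rfl⟩

theorem IntOn.mono {T : Type*} {ι : Type*} {S S' : Set T} {x : T → ι → ℂ} {u : T → ℂ}
    (h : IntOn S x u) (hS : S' ⊆ S) : IntOn S' x u := by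
  obtain ⟨Q, hQ, h⟩ := h
  exact ⟨Q, hQ, fun z hz => h z (hS hz)⟩

theorem IntOn.poly {T : Type*} {ι κ : Type*} {S : Set T} {x : T → ι → ℂ} {y : T → κ → ℂ}
    (h : ∀ i, IntOn S x (fun z => y z i)) (p : MvPolynomial κ ℂ) : IntOn S x (fun z => eval (y z) p) := by
  simp only [intOn_iff] at h ⊢
  have : ∀ p : MvPolynomial κ ℂ, (fhom S x).toRingHom.IsIntegralElem (fhom S y p) := by
    intro p
    induction p using MvPolynomial.induction_on with
    | C a =>
      rw [← algebraMap_eq, AlgHom.commutes, ← (fhom S x).commutes]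
      exact (fhom S x).toRingHom.isIntegralElem_map
    | add p q hp hq => rw [map_add]; exact hp.add _ hq
    | mul_X p i hp =>
      rw [map_mul]
      refine hp.mul _ ?_
      have h2 : fhom S y (X i) = fun z : S => y z i := by
        funext z
        simp [fhom_apply]
      rw [h2]; exact h i
  have h2 : fhom S y p = fun z : S => eval (y z) p := by
    funext z
    rw [fhom_apply]
  rw [← h2]; exact this p

theorem IntOn.trans {T : Type*} {ι κ : Type*} {S : Set T} {x : T → ι → ℂ} {y : T → κ → ℂ} {u : T → ℂ}
    (h : ∀ i, IntOn S x (fun z => y z i)) (hu : IntOn S y u) : IntOn S x u := by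
  rw [intOn_iff] at hu ⊢
  let _ := (fhom S x).toRingHom.toAlgebra
  have hp : ∀ p : MvPolynomial κ ℂ, fhom S y p ∈ integralClosure (MvPolynomial ι ℂ) (S → ℂ) := by
    intro p
    have := (intOn_iff _ _ _).1 (IntOn.poly h p)
    have h2 : fhom S y p = fun z : S => eval (y z) p := by
      funext z
      rw [fhom_apply]
    rw [h2]; exact this
  obtain ⟨Q, hQ, h0⟩ := hu
  have h1 : IsIntegral (integralClosure (MvPolynomial ι ℂ) (S → ℂ)) (fun z : S => u z) := by
    refine ⟨Q.map ((fhom S y).toRingHom.codRestrict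
      (integralClosure (MvPolynomial ι ℂ) (S → ℂ)).toSubring hp), hQ.map _, ?_⟩
    rw [Polynomial.eval₂_map]
    exact h0
  exact isIntegral_trans (R := MvPolynomial ι ℂ) _ h1

theorem IntOn.self {T : Type*} {ι : Type*} {S : Set T} {x : T → ι → ℂ} (i : ι) : IntOn S x (fun z => x z i) :=
  ⟨Polynomial.X - Polynomial.C (X i), Polynomial.monic_X_sub_C _, fun z _ => by simp [qev]⟩

theorem IntOn.self_poly {T : Type*} {ι : Type*} {S : Set T} {x : T → ι → ℂ} (p : MvPolynomial ι ℂ) :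
    IntOn S x (fun z => eval (x z) p) := IntOn.poly IntOn.self p

theorem alg_dep_domain {D : Type*} [CommRing D] [IsDomain D] [Algebra ℂ D] {n m : ℕ} (x : Fin n → D)
    (u : Fin m → D) [Algebra.IsAlgebraic (Algebra.adjoin ℂ (range x)) D]
    (h : n < m ∨ (n ≤ m ∧ ¬ AlgebraicIndependent ℂ x)) : ¬ AlgebraicIndependent ℂ u := by
  intro hu
  have h1 := hu.lift_cardinalMk_le_trdeg
  obtain ⟨t, hts, ht⟩ := exists_isTranscendenceBasis_subset (R := ℂ) (range x)
  have h2 := ht.cardinalMk_eq_trdeg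
  have hfin : t.Finite := (finite_range x).subset hts
  have hf' : (range x).Finite := finite_range x
  have := hfin.fintype
  have h4 : (range x).ncard ≤ n := by
    have := Set.ncard_image_le (s := (univ : Set (Fin n))) (f := x) finite_univ
    simpa [Set.ncard_univ] using this
  have h3 : m ≤ t.ncard := by
    rw [← h2] at h1
    rw [← Nat.card_coe_set_eq, Nat.card_eq_fintype_card]
    simp only [Cardinal.mk_fintype, Cardinal.lift_natCast, Fintype.card_fin, Nat.cast_le] at h1
    exact h1
  have h5 := Set.ncard_le_ncard hts hf'
  rcases h with h | ⟨h, hx⟩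
  · omega
  · have h6 : t = range x := Set.eq_of_subset_of_ncard_le hts (by omega) hf'
    subst h6
    have hinj : Function.Injective x := by
      have h7 : (x '' univ).ncard = (univ : Set (Fin n)).ncard := by
        rw [image_univ, Set.ncard_univ, Nat.card_fin]; omega
      have := Set.injOn_of_ncard_image_eq h7 finite_univ
      exact fun a b hab => this (mem_univ _) (mem_univ _) hab
    apply hx
    have h8 := ht.1
    have h9 := h8.comp (fun i => (⟨x i, mem_range_self i⟩ : range x)) (fun a b hab => hinj (by simpa using hab))
    exact h9

theorem alg_dep_domain' {D : Type*} [CommRing D] [IsDomain D] [Algebra ℂ D] {n m : ℕ} (x : Fin n → D)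
    (u : Fin m → D) (hD : ∀ a : D, (aeval x : MvPolynomial (Fin n) ℂ →ₐ[ℂ] D).toRingHom.IsIntegralElem a)
    (h : n < m ∨ (n ≤ m ∧ ¬ AlgebraicIndependent ℂ x)) : ¬ AlgebraicIndependent ℂ u := by
  have : Algebra.IsAlgebraic (Algebra.adjoin ℂ (range x)) D := by
    constructor
    intro a
    apply IsIntegral.isAlgebraic
    obtain ⟨Q, hQ, hQ0⟩ := hD a
    have hmem : ∀ p : MvPolynomial (Fin n) ℂ, aeval x p ∈ Algebra.adjoin ℂ (range x) := by
      intro p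
      rw [Algebra.adjoin_range_eq_range_aeval]
      exact ⟨p, rfl⟩
    refine ⟨Q.map ((aeval x : MvPolynomial (Fin n) ℂ →ₐ[ℂ] D).toRingHom.codRestrict
      (Algebra.adjoin ℂ (range x)).toSubring hmem), hQ.map _, ?_⟩
    rw [Polynomial.eval₂_map]
    exact hQ0
  exact alg_dep_domain x u h

theorem alg_dep_all {A : Type*} [CommRing A] [Algebra ℂ A] {n m : ℕ} (x : Fin n → A) (u : Fin m → A)
    (hA : ∀ a : A, (aeval x : MvPolynomial (Fin n) ℂ →ₐ[ℂ] A).toRingHom.IsIntegralElem a)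
    (h : n < m ∨ (n ≤ m ∧ ¬ AlgebraicIndependent ℂ x)) : ¬ AlgebraicIndependent ℂ u := by
  intro hu0
  have hu0' : Function.Injective (aeval u : MvPolynomial (Fin m) ℂ →ₐ[ℂ] A) := hu0
  let S : Submonoid A := (nonZeroDivisors (MvPolynomial (Fin m) ℂ)).map (aeval u : MvPolynomial (Fin m) ℂ →ₐ[ℂ] A)
  have hdis : Disjoint ((⊥ : Ideal A) : Set A) S := by
    rw [Set.disjoint_left]
    rintro a ha ⟨p, hp, rfl⟩
    have ha' : aeval u p = 0 := by simpa using ha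
    have := (map_eq_zero_iff _ hu0').1 ha'
    exact nonZeroDivisors.ne_zero hp this
  obtain ⟨P, hP, -, hPS⟩ := Ideal.exists_le_prime_disjoint ⊥ S hdis
  let q : A →ₐ[ℂ] A ⧸ P := Ideal.Quotient.mkₐ ℂ P
  have hqs : Function.Surjective q := Ideal.Quotient.mkₐ_surjective ℂ P
  have hq0 : ∀ a, q a = 0 ↔ a ∈ P := fun a => Ideal.Quotient.eq_zero_iff_mem
  have hu1 : AlgebraicIndependent ℂ (fun i => q (u i)) := by
    rw [algebraicIndependent_iff]
    intro p hp
    by_contra hne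
    have h1 : q (aeval u p) = 0 := by rw [← hp, comp_aeval_apply]
    exact Set.disjoint_left.1 hPS ((hq0 _).1 h1) ⟨p, mem_nonZeroDivisors_of_ne_zero hne, rfl⟩
  refine alg_dep_domain' (fun i => q (x i)) _ ?_ (h.imp id fun ⟨h1, h2⟩ => ⟨h1, fun h3 => h2 ?_⟩) hu1
  · intro a
    obtain ⟨b, rfl⟩ := hqs a
    obtain ⟨Q, hQ, hQ0⟩ := hA b
    refine ⟨Q, hQ, ?_⟩
    have h4 : (aeval (fun i => q (x i)) : MvPolynomial (Fin n) ℂ →ₐ[ℂ] _).toRingHom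
      = q.toRingHom.comp (aeval x : MvPolynomial (Fin n) ℂ →ₐ[ℂ] A).toRingHom :=
      RingHom.ext fun p => (comp_aeval_apply x q p).symm
    rw [h4]
    have := congrArg q hQ0
    rw [map_zero] at this
    rw [← this]
    exact (Polynomial.hom_eval₂ Q _ q.toRingHom b).symm
  · exact AlgebraicIndependent.of_comp q h3

theorem alg_dep {A : Type*} [CommRing A] [Algebra ℂ A] {n m : ℕ} (x : Fin n → A) (u : Fin m → A)
    (hu : ∀ i, (aeval x : MvPolynomial (Fin n) ℂ →ₐ[ℂ] A).toRingHom.IsIntegralElem (u i))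
    (h : n < m ∨ (n ≤ m ∧ ¬ AlgebraicIndependent ℂ x)) : ¬ AlgebraicIndependent ℂ u := by
  intro hui
  let algR : Algebra (MvPolynomial (Fin n) ℂ) A := (aeval x : MvPolynomial (Fin n) ℂ →ₐ[ℂ] A).toRingHom.toAlgebra
  have : IsScalarTower ℂ (MvPolynomial (Fin n) ℂ) A := IsScalarTower.of_algebraMap_eq fun c => by
    change _ = (aeval x) _
    simp
  let A0 : Subalgebra ℂ A := (integralClosure (MvPolynomial (Fin n) ℂ) A).restrictScalars ℂ
  let u0 : Fin m → A0 := fun i => ⟨u i, hu i⟩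
  have hxm : ∀ i, x i ∈ A0 := fun i => by
    have : x i = algebraMap (MvPolynomial (Fin n) ℂ) A (X i) := by
      change _ = aeval x (X i); simp
    rw [this]
    change IsIntegral _ _
    exact isIntegral_algebraMap
  let x0 : Fin n → A0 := fun i => ⟨x i, hxm i⟩
  have hu0 : AlgebraicIndependent ℂ u0 := AlgebraicIndependent.of_comp A0.val hui
  refine alg_dep_all x0 u0 ?_ (h.imp id fun ⟨h1, h2⟩ => ⟨h1, fun h3 => h2 ?_⟩) hu0
  · rintro ⟨a, ha⟩
    obtain ⟨Q, hQ, hQ0⟩ := ha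
    refine ⟨Q, hQ, Subtype.ext ?_⟩
    have h4 : (aeval x : MvPolynomial (Fin n) ℂ →ₐ[ℂ] A).toRingHom
      = A0.val.toRingHom.comp (aeval x0 : MvPolynomial (Fin n) ℂ →ₐ[ℂ] A0).toRingHom :=
      RingHom.ext fun p => (comp_aeval_apply x0 A0.val p).symm
    have h5 := Polynomial.hom_eval₂ Q (aeval x0 : MvPolynomial (Fin n) ℂ →ₐ[ℂ] A0).toRingHom
      A0.val.toRingHom ⟨a, ⟨Q, hQ, hQ0⟩⟩
    rw [← h4] at h5
    exact h5.trans hQ0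
  · exact h3.map' (f := A0.val) Subtype.val_injective

/-- algebraic dependence on a set -/
theorem dep_on {T : Type*} {S : Set T} {n m : ℕ} {x : T → Fin n → ℂ} {u : T → Fin m → ℂ}
    (hu : ∀ i, IntOn S x (fun z => u z i))
    (h : n < m ∨ (n ≤ m ∧ ∃ p : MvPolynomial (Fin n) ℂ, p ≠ 0 ∧ ∀ z ∈ S, eval (x z) p = 0)) :
    ∃ p : MvPolynomial (Fin m) ℂ, p ≠ 0 ∧ ∀ z ∈ S, eval (u z) p = 0 := by
  have h1 := alg_dep (fun i (z : S) => x z i) (fun i (z : S) => u z i)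
    (fun i => (intOn_iff _ _ _).1 (hu i)) (h.imp id fun ⟨h1, p, hp, hp0⟩ => ⟨h1, fun h2 => hp ?_⟩)
  · rw [algebraicIndependent_iff] at h2
    refine h2 p (funext fun z => ?_)
    have := fhom_apply S x p z
    rw [hp0 z z.2] at this
    exact this
  · rw [algebraicIndependent_iff] at h1
    push Not at h1
    obtain ⟨p, hp, hp0⟩ := h1
    refine ⟨p, hp0, fun z hz => ?_⟩
    have := congrFun hp ⟨z, hz⟩
    rw [← fhom_apply S u p ⟨z, hz⟩]
    exact this

open Set Filter Topology MvPolynomial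

/-- homogeneous scaling -/
theorem homog_scale {n d : ℕ} {p : MvPolynomial (Fin n) ℂ} (hp : p.IsHomogeneous d) (c : ℂ) (w : Fin n → ℂ) :
    eval (c • w) p = c ^ d * eval w p := by
  rw [eval_eq', eval_eq', Finset.mul_sum]
  refine Finset.sum_congr rfl fun α hα => ?_
  have h1 := hp.degree_eq_sum_deg_support hα
  have h2 : ∏ i, (c • w) i ^ α i = c ^ d * ∏ i, w i ^ α i := by
    simp only [Pi.smul_apply, smul_eq_mul, mul_pow, Finset.prod_mul_distrib, Finset.prod_pow_eq_pow_sum]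
    rw [← Finsupp.degree_eq_sum α, h1]; rfl
  rw [h2]; ring

/-- the shear substitution -/
noncomputable def shearHom {n : ℕ} (v : Fin n → ℂ) :
    MvPolynomial (Fin (n + 1)) ℂ →ₐ[ℂ] Polynomial (MvPolynomial (Fin n) ℂ) :=
  aeval (Fin.cons Polynomial.X fun i => Polynomial.C (X i) + Polynomial.C (C (v i)) * Polynomial.X)

theorem shearHom_qev {n : ℕ} (v : Fin n → ℂ) (p : MvPolynomial (Fin (n + 1)) ℂ) (y : Fin n → ℂ) (t : ℂ) :
    qev (shearHom v p) y t = eval (Fin.cons t (y + t • v) : Fin (n + 1) → ℂ) p := by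
  have : ((Polynomial.evalRingHom t).comp (Polynomial.mapRingHom (eval y))).comp (shearHom v).toRingHom
      = eval (Fin.cons t (y + t • v) : Fin (n + 1) → ℂ) := by
    refine MvPolynomial.ringHom_ext ?_ ?_
    · intro r
      simp [← algebraMap_eq, Polynomial.algebraMap_apply]
    · intro i
      refine Fin.cases ?_ (fun i => ?_) i
      · simp [shearHom]
      · have h1 : shearHom v (X i.succ) = Polynomial.C (X i) + Polynomial.C (C (v i)) * Polynomial.X := by
          rw [shearHom, aeval_X, Fin.cons_succ]
        change Polynomial.eval t (Polynomial.map (eval y) (shearHom v (X i.succ))) = _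
        rw [h1]
        simp only [Polynomial.map_add, Polynomial.map_mul, Polynomial.map_C, Polynomial.map_X,
          Polynomial.eval_add, Polynomial.eval_mul, Polynomial.eval_C, Polynomial.eval_X, eval_X,
          eval_C, Fin.cons_succ, Pi.add_apply, Pi.smul_apply, smul_eq_mul]
        rw [mul_comm]
  exact RingHom.congr_fun this p

/-- degree bookkeeping for the shear -/
def ShH {n : ℕ} (v : Fin n → ℂ) (f : MvPolynomial (Fin (n + 1)) ℂ) (d : ℕ) : Prop :=
  (shearHom v f).natDegree ≤ d ∧ (shearHom v f).coeff d = C (eval (Fin.cons 1 v : Fin (n + 1) → ℂ) f)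

theorem ShH.mul {n : ℕ} {v : Fin n → ℂ} {f g : MvPolynomial (Fin (n + 1)) ℂ} {d e : ℕ}
    (hf : ShH v f d) (hg : ShH v g e) : ShH v (f * g) (d + e) := by
  refine ⟨?_, ?_⟩
  · rw [map_mul]; exact Polynomial.natDegree_mul_le_of_le hf.1 hg.1
  · rw [map_mul, Polynomial.coeff_mul_add_eq_of_natDegree_le hf.1 hg.1, hf.2, hg.2, map_mul, map_mul]

theorem ShH.C {n : ℕ} {v : Fin n → ℂ} (a : ℂ) : ShH v (C a) 0 := by
  have : shearHom v (MvPolynomial.C a) = Polynomial.C (MvPolynomial.C a) := by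
    rw [← algebraMap_eq, AlgHom.commutes, Polynomial.algebraMap_apply, algebraMap_eq]
  constructor
  · rw [this]; simp
  · rw [this]; simp

theorem ShH.X {n : ℕ} {v : Fin n → ℂ} (i : Fin (n + 1)) : ShH v (X i) 1 := by
  refine Fin.cases ?_ (fun i => ?_) i
  · constructor <;> simp [shearHom]
  · constructor
    · simp only [shearHom, aeval_X, Fin.cons_succ]
      compute_degree
    · simp [shearHom]

theorem ShH.pow {n : ℕ} {v : Fin n → ℂ} {f : MvPolynomial (Fin (n + 1)) ℂ} {d : ℕ}
    (hf : ShH v f d) (e : ℕ) : ShH v (f ^ e) (e * d) := by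
  induction e with
  | zero => simpa using ShH.C (v := v) 1
  | succ e ih => rw [pow_succ, add_mul, one_mul]; exact ih.mul hf

theorem ShH.homog {n : ℕ} {v : Fin n → ℂ} {f : MvPolynomial (Fin (n + 1)) ℂ} {d : ℕ}
    (hf : f.IsHomogeneous d) : ShH v f d := by
  have hm : ∀ α ∈ f.support, ShH v (monomial α (coeff α f)) d := by
    intro α hα
    have h1 := hf.degree_eq_sum_deg_support hα
    have h2 : ∀ s : Finset (Fin (n + 1)), ShH v (∏ i ∈ s, MvPolynomial.X i ^ α i) (∑ i ∈ s, α i) := by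
      intro s
      induction s using Finset.induction_on with
      | empty => simpa using ShH.C (v := v) 1
      | insert a s ha ih =>
        rw [Finset.prod_insert ha, Finset.sum_insert ha]
        have := (ShH.X (v := v) a).pow (α a)
        rw [mul_one] at this
        exact this.mul ih
    have h3 := (ShH.C (v := v) (coeff α f)).mul (h2 Finset.univ)
    rw [zero_add, ← Finsupp.degree_eq_sum α] at h3
    have h4 : (monomial α (coeff α f)) = MvPolynomial.C (coeff α f) * ∏ i, (MvPolynomial.X i : MvPolynomial (Fin (n+1)) ℂ) ^ α i := by
      rw [monomial_eq, Finsupp.prod_fintype]; simp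
    rw [h4]
    rw [h1]; exact h3
  rw [f.as_sum]
  constructor
  · rw [map_sum]
    exact Polynomial.natDegree_sum_le_of_forall_le _ _ fun α hα => (hm α hα).1
  · rw [map_sum, Polynomial.finsetSum_coeff, map_sum, map_sum]
    exact Finset.sum_congr rfl fun α hα => (hm α hα).2

theorem lin_shear {n : ℕ} {p : MvPolynomial (Fin (n + 1)) ℂ} (hp : p ≠ 0) :
    ∃ τ : MvPolynomial (Fin n) ℂ, τ ≠ 0 ∧ ∀ v, eval v τ ≠ 0 →
      ∃ a : ℂ, a ≠ 0 ∧ (Polynomial.C (C a) * shearHom v p).Monic := by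
  set d := p.totalDegree with hd
  set pd := homogeneousComponent d p with hpd
  have hpd0 : pd ≠ 0 := by
    obtain ⟨α, hα, hα'⟩ := Finset.exists_mem_eq_sup p.support (support_nonempty.2 hp) (fun s => s.sum fun _ e => e)
    intro h
    have h1 : coeff α pd = 0 := by rw [h]; simp
    rw [hpd, coeff_homogeneousComponent, if_pos] at h1
    · exact (mem_support_iff.1 hα) h1
    · rw [hd, MvPolynomial.totalDegree]; exact hα'.symm
  have hh : pd.IsHomogeneous d := homogeneousComponent_isHomogeneous d p
  have hev : ∀ v : Fin n → ℂ, eval v (aeval (Fin.cons 1 X : Fin (n + 1) → MvPolynomial (Fin n) ℂ) pd)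
      = eval (Fin.cons 1 v : Fin (n + 1) → ℂ) pd := by
    intro v
    have : (eval v).comp (aeval (Fin.cons 1 X : Fin (n + 1) → MvPolynomial (Fin n) ℂ)).toRingHom
      = eval (Fin.cons 1 v : Fin (n + 1) → ℂ) := by
      refine MvPolynomial.ringHom_ext ?_ ?_
      · intro r; simp
      · intro i
        refine Fin.cases ?_ (fun i => ?_) i <;> simp
    exact RingHom.congr_fun this pd
  refine ⟨aeval (Fin.cons 1 X : Fin (n + 1) → MvPolynomial (Fin n) ℂ) pd, ?_, ?_⟩
  · intro h0
    apply hpd0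
    have h1 : pd * X 0 = 0 := by
      apply MvPolynomial.funext
      intro w
      rw [map_mul, eval_X, map_zero]
      by_cases hw : w 0 = 0
      · rw [hw, mul_zero]
      have h2 : w = w 0 • (Fin.cons 1 (fun i => w i.succ / w 0) : Fin (n + 1) → ℂ) := by
        funext i
        refine Fin.cases ?_ (fun i => ?_) i
        · simp
        · simp; field_simp
      rw [h2, homog_scale hh, ← hev, h0]; simp
    exact (mul_eq_zero.1 h1).resolve_right (X_ne_zero 0)
  · intro v hv
    rw [hev] at hv
    refine ⟨(eval (Fin.cons 1 v : Fin (n + 1) → ℂ) pd)⁻¹, inv_ne_zero hv, ?_⟩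
    have hsum : shearHom v p = ∑ i ∈ Finset.range (d + 1), shearHom v (homogeneousComponent i p) := by
      rw [← map_sum, sum_homogeneousComponent]
    have hdeg : (shearHom v p).natDegree ≤ d := by
      rw [hsum]
      refine Polynomial.natDegree_sum_le_of_forall_le _ _ fun i hi => ?_
      exact ((ShH.homog (homogeneousComponent_isHomogeneous i p)).1).trans (by simpa [Nat.lt_succ_iff] using hi)
    have hco : (shearHom v p).coeff d = C (eval (Fin.cons 1 v : Fin (n + 1) → ℂ) pd) := by
      rw [hsum, Polynomial.finsetSum_coeff, Finset.sum_eq_single d]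
      · exact (ShH.homog hh).2
      · intro i hi hid
        apply Polynomial.coeff_eq_zero_of_natDegree_lt
        have h5 := (ShH.homog (v := v) (homogeneousComponent_isHomogeneous i p)).1
        have h6 : i < d + 1 := by simpa using hi
        omega
      · simp
    refine Polynomial.monic_of_natDegree_le_of_coeff_eq_one d ?_ ?_
    · exact (Polynomial.natDegree_C_mul_le _ _).trans hdeg
    · rw [Polynomial.coeff_C_mul, hco, ← map_mul, inv_mul_cancel₀ hv, map_one]

/-- root continuity -/
theorem root_near {ι : Type*} [Fintype ι] {Q : Polynomial (MvPolynomial ι ℂ)} (hQ : Q.Monic) {x₀ : ι → ℂ} {t₀ : ℂ}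
    (h0 : qev Q x₀ t₀ = 0) {ε : ℝ} (hε : 0 < ε) :
    ∀ᶠ x in 𝓝 x₀, ∃ t, ‖t - t₀‖ < ε ∧ qev Q x t = 0 := by
  have hc : Continuous fun x => qev Q x t₀ := by
    simp only [qev, Polynomial.eval_map]
    simp only [Polynomial.eval₂_eq_sum_range]
    exact continuous_finsetSum _ fun i _ => (MvPolynomial.continuous_eval _).mul continuous_const
  have h1 : ∀ᶠ x in 𝓝 x₀, ‖qev Q x t₀‖ < ε ^ Q.natDegree := by
    refine hc.norm.continuousAt.eventually_lt_const ?_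
    simp only [h0, norm_zero]; positivity
  filter_upwards [h1] with x hx
  by_contra hne
  push Not at hne
  have hm : (Q.map (eval x)).Monic := hQ.map _
  have hs : (Q.map (eval x)).Splits := IsAlgClosed.splits _
  have hprod := hs.eval_eq_prod_roots_of_monic hm t₀
  have hcard : (Q.map (eval x)).roots.card = Q.natDegree := by
    rw [← hs.natDegree_eq_card_roots, hQ.natDegree_map]
  have h2 : ∀ s : Multiset ℂ, (∀ a ∈ s, ε ≤ ‖t₀ - a‖) → ε ^ s.card ≤ ‖(s.map fun a => t₀ - a).prod‖ := by
    intro s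
    induction s using Multiset.induction_on with
    | empty => simp
    | cons a s ih =>
      intro hs
      simp only [Multiset.map_cons, Multiset.prod_cons, norm_mul, Multiset.card_cons, pow_succ]
      rw [mul_comm]
      exact mul_le_mul (hs a (by simp)) (ih fun b hb => hs b (by simp [hb])) (by positivity) (norm_nonneg _)
  have h3 := h2 (Q.map (eval x)).roots (fun a ha => by
    have := hne a
    by_contra hlt
    push Not at hlt
    rw [norm_sub_rev] at hlt
    exact this hlt (Polynomial.isRoot_of_mem_roots ha))
  rw [hcard, ← hprod] at h3
  exact absurd hx (not_lt.2 h3)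

/-- squarefree replacement -/
theorem sqfree_repl {n : ℕ} {R : Polynomial (MvPolynomial (Fin n) ℂ)} (hR : R.Monic) :
    ∃ Q : Polynomial (MvPolynomial (Fin n) ℂ), Q.Monic ∧ (∀ x t, qev R x t = 0 → qev Q x t = 0) ∧
      ∃ (a b : Polynomial (MvPolynomial (Fin n) ℂ)) (δ : MvPolynomial (Fin n) ℂ), δ ≠ 0 ∧
        a * Q + b * Q.derivative = Polynomial.C δ := by
  classical
  let A := MvPolynomial (Fin n) ℂ
  let K := FractionRing A
  let Rk := R.map (algebraMap A K)
  have hRk : Rk.Monic := hR.map _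
  have hRk0 : Rk ≠ 0 := hRk.ne_zero
  set g := UniqueFactorizationMonoid.radical Rk with hg
  have hgd : g ∣ Rk := UniqueFactorizationMonoid.radical_dvd_self
  have hgs : Squarefree g := UniqueFactorizationMonoid.squarefree_radical
  have hg0 : g ≠ 0 := hgs.ne_zero
  obtain ⟨Q, hQ⟩ := IsIntegrallyClosed.eq_map_mul_C_of_dvd K hR hgd
  have hlc : g.leadingCoeff ≠ 0 := by simpa using hg0
  have hass : Associated (Q.map (algebraMap A K)) g := by
    rw [← hQ]
    exact associated_mul_unit_right _ _ (Polynomial.isUnit_C.2 (isUnit_iff_ne_zero.2 hlc))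
  have hQm : Q.Monic := by
    have h1 : (Q.map (algebraMap A K)).leadingCoeff * g.leadingCoeff = g.leadingCoeff := by
      conv_rhs => rw [← hQ]
      rw [Polynomial.leadingCoeff_mul, Polynomial.leadingCoeff_C]
    have h2 : (Q.map (algebraMap A K)).leadingCoeff = 1 := by
      exact mul_right_cancel₀ hlc (by rw [h1, one_mul])
    have hinj : Function.Injective (algebraMap A K) := IsFractionRing.injective A K
    rw [Polynomial.leadingCoeff_map_of_injective hinj] at h2
    exact hinj (by rw [h2, map_one])
  refine ⟨Q, hQm, ?_, ?_⟩
  · obtain ⟨N, hN⟩ : ∃ N, Rk ∣ g ^ N := by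
      have h1 : ∀ s : Multiset (Polynomial K), (∀ p ∈ s, p ∣ g) → s.prod ∣ g ^ s.card := by
        intro s
        induction s using Multiset.induction_on with
        | empty => simp
        | cons a s ih =>
          intro hs
          rw [Multiset.prod_cons, Multiset.card_cons, pow_succ, mul_comm]
          exact mul_dvd_mul (ih fun b hb => hs b (by simp [hb])) (hs a (by simp))
      refine ⟨_, (UniqueFactorizationMonoid.prod_normalizedFactors hRk0).symm.dvd.trans
        (h1 (UniqueFactorizationMonoid.normalizedFactors Rk) fun p hp => ?_)⟩
      exact (UniqueFactorizationMonoid.dvd_radical_iff_of_irreducible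
        (UniqueFactorizationMonoid.irreducible_of_normalized_factor p hp) hRk0).2
        (UniqueFactorizationMonoid.dvd_of_mem_normalizedFactors hp)
    have h1 : R ∣ Q ^ N := by
      rw [← Polynomial.map_dvd_map (algebraMap A K) (IsFractionRing.injective A K) hR, Polynomial.map_pow]
      exact hN.trans (hass.pow_pow.symm.dvd)
    intro x t h
    obtain ⟨S, hS⟩ := h1
    have h2 : qev (Q ^ N) x t = 0 := by
      rw [hS]; simp only [qev, Polynomial.map_mul, Polynomial.eval_mul] at h ⊢; rw [h, zero_mul]
    simp only [qev, Polynomial.map_pow, Polynomial.eval_pow] at h2 ⊢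
    exact by_contra fun hne => pow_ne_zero N hne h2
  · have hsq : Squarefree (Q.map (algebraMap A K)) := hass.squarefree_iff.2 hgs
    have hsep : (Q.map (algebraMap A K)).Separable := PerfectField.separable_iff_squarefree.2 hsq
    obtain ⟨a, b, hab⟩ := hsep
    obtain ⟨da, hda⟩ := IsLocalization.integerNormalization_map_to_map (nonZeroDivisors A) a
    obtain ⟨db, hdb⟩ := IsLocalization.integerNormalization_map_to_map (nonZeroDivisors A) b
    refine ⟨Polynomial.C (db : A) * IsLocalization.integerNormalization (nonZeroDivisors A) a,
      Polynomial.C (da : A) * IsLocalization.integerNormalization (nonZeroDivisors A) b, (da : A) * db,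
      mul_ne_zero (nonZeroDivisors.ne_zero da.2) (nonZeroDivisors.ne_zero db.2), ?_⟩
    apply Polynomial.map_injective (algebraMap A K) (IsFractionRing.injective A K)
    rw [Polynomial.derivative_map] at hab
    have e1 : ∀ (d : A) (q : Polynomial K), d • q = Polynomial.C (algebraMap A K d) * q := fun d q => by
      rw [← Polynomial.smul_eq_C_mul, algebraMap_smul]
    have e2 : Polynomial.C (algebraMap A K da) * Polynomial.C (algebraMap A K db)
        * (a * Q.map (algebraMap A K) + b * Q.derivative.map (algebraMap A K))
        = Polynomial.C (algebraMap A K da) * Polynomial.C (algebraMap A K db) := by rw [hab, mul_one]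
    simp only [Polynomial.map_add, Polynomial.map_mul, Polynomial.map_C, hda, hdb, e1, map_mul]
    rw [← e2]
    ring

open Set Filter Topology MvPolynomial

theorem quot_ex.{u} {A : Type u} [CommRing A] (c : A) : ∃ (T : Type u) (_ : CommRing T) (mk : A →+* T),
    Function.Surjective mk ∧ ∀ P, mk P = 0 ↔ c ∣ P :=
  ⟨A ⧸ Ideal.span {c}, inferInstance, Ideal.Quotient.mk _, Ideal.Quotient.mk_surjective, fun P => by
    rw [Ideal.Quotient.eq_zero_iff_mem, Ideal.mem_span_singleton]⟩

/-- elimination of one variable -/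
theorem elim_alg' {E : Type*} [CommRing E] [IsDomain E] [UniqueFactorizationMonoid E]
    {T : Type*} [CommRing T] (mk : Polynomial (Polynomial E) →+* T) (hsurj : Function.Surjective mk)
    {c : Polynomial E} (hc : c.Monic) {R : Polynomial (Polynomial E)} (hR : R.IsPrimitive)
    (hker : ∀ P, mk P = 0 ↔ Polynomial.C c ∣ P) :
    ∃ a : Polynomial E, a ≠ 0 ∧ ∃ s q : Polynomial (Polynomial E),
      a.map Polynomial.C = R * s + Polynomial.C c * q := by
  classical
  let f : Polynomial E →+* T := mk.comp (Polynomial.mapRingHom Polynomial.C)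
  have hx0 : f.IsIntegralElem (mk (Polynomial.C Polynomial.X)) := by
    refine ⟨c.map Polynomial.C, hc.map _, ?_⟩
    rw [Polynomial.eval₂_map]
    have h1 : f.comp Polynomial.C = (mk.comp Polynomial.C).comp Polynomial.C := by
      ext e; simp [f]
    rw [h1]
    have h2 := Polynomial.hom_eval₂ c (Polynomial.C) (mk.comp Polynomial.C) (Polynomial.X : Polynomial E)
    rw [RingHom.comp_apply] at h2
    erw [← h2]
    rw [Polynomial.eval₂_C_X]
    exact (hker _).2 dvd_rfl
  have hintg : ∀ P : Polynomial (Polynomial E), f.IsIntegralElem (mk P) := by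
    intro P
    induction P using Polynomial.induction_on' with
    | add p q hp hq => rw [map_add]; exact hp.add _ hq
    | monomial n a =>
      rw [← Polynomial.C_mul_X_pow_eq_monomial, map_mul]
      refine RingHom.IsIntegralElem.mul _ ?_ ?_
      · induction a using Polynomial.induction_on' with
        | add p q hp hq => rw [map_add, map_add]; exact hp.add _ hq
        | monomial k b =>
          rw [← Polynomial.C_mul_X_pow_eq_monomial, map_mul, map_mul, map_pow, map_pow]
          refine RingHom.IsIntegralElem.mul _ ?_ ?_
          · have : mk (Polynomial.C (Polynomial.C b)) = f (Polynomial.C b) := by simp [f]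
            rw [this]; exact f.isIntegralElem_map
          · induction k with
            | zero => rw [pow_zero]; exact f.isIntegralElem_one
            | succ k ih => rw [pow_succ]; exact ih.mul _ hx0
      · have : mk (Polynomial.X ^ n) = f (Polynomial.X ^ n) := by simp [f]
        rw [this]; exact f.isIntegralElem_map
  have hrel : IsRelPrime (Polynomial.C c) R := by
    intro d hd1 hd2
    have hd0 : d.natDegree = 0 := by
      have hc0 : Polynomial.C c ≠ 0 := by
        rw [Ne, Polynomial.C_eq_zero]; exact hc.ne_zero
      have := Polynomial.natDegree_le_of_dvd hd1 hc0
      simpa using this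
    rw [Polynomial.eq_C_of_natDegree_eq_zero hd0] at hd2 ⊢
    exact Polynomial.isUnit_C.2 (hR _ hd2)
  have hnz : ∀ {x}, x * mk R = 0 → x = 0 := by
    intro x hx
    obtain ⟨P, rfl⟩ := hsurj x
    rw [← map_mul, hker] at hx
    exact (hker _).2 (hrel.dvd_of_dvd_mul_right hx)
  obtain ⟨p, hp, hp0⟩ := hintg R
  obtain ⟨i, hi, hmem⟩ := Ideal.exists_coeff_ne_zero_mem_comap_of_non_zero_divisor_root_mem
    (f := f) (I := Ideal.span {mk R}) hnz (Ideal.subset_span rfl) hp.ne_zero hp0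
  refine ⟨p.coeff i, hi, ?_⟩
  rw [Ideal.mem_comap, Ideal.mem_span_singleton] at hmem
  obtain ⟨s, hs⟩ := hmem
  obtain ⟨s, rfl⟩ := hsurj s
  have h3 : mk ((p.coeff i).map Polynomial.C - R * s) = 0 := by
    rw [map_sub, map_mul]; erw [← hs]; simp [f]
  rw [hker] at h3
  obtain ⟨q, hq⟩ := h3
  exact ⟨s, q, by rw [← hq]; ring⟩

theorem elim_alg {E : Type*} [CommRing E] [IsDomain E] [UniqueFactorizationMonoid E]
    {c : Polynomial E} (hc : c.Monic) {R : Polynomial (Polynomial E)} (hR : R.IsPrimitive) :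
    ∃ a : Polynomial E, a ≠ 0 ∧ ∃ s q : Polynomial (Polynomial E),
      a.map Polynomial.C = R * s + Polynomial.C c * q := by
  obtain ⟨T, _, mk, h1, h2⟩ := quot_ex (Polynomial.C c)
  exact elim_alg' mk h1 hc hR h2

/-- inverse of the shear -/
noncomputable def shearInv {n : ℕ} (v : Fin n → ℂ) :
    Polynomial (MvPolynomial (Fin n) ℂ) →+* MvPolynomial (Fin (n + 1)) ℂ :=
  Polynomial.eval₂RingHom (aeval fun i => X i.succ - C (v i) * X 0 :
    MvPolynomial (Fin n) ℂ →ₐ[ℂ] MvPolynomial (Fin (n + 1)) ℂ).toRingHom (X 0)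

theorem shearInv_shear {n : ℕ} (v : Fin n → ℂ) (p : MvPolynomial (Fin (n + 1)) ℂ) :
    shearInv v (shearHom v p) = p := by
  have : (shearInv v).comp (shearHom v).toRingHom = RingHom.id _ := by
    refine MvPolynomial.ringHom_ext ?_ ?_
    · intro r
      simp [← algebraMap_eq, Polynomial.algebraMap_apply, shearInv]
    · intro i
      refine Fin.cases ?_ (fun i => ?_) i
      · simp [shearHom, shearInv]
      · simp [shearHom, shearInv]
  exact RingHom.congr_fun this p

theorem shear_shearInv {n : ℕ} (v : Fin n → ℂ) (p : Polynomial (MvPolynomial (Fin n) ℂ)) :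
    shearHom v (shearInv v p) = p := by
  have : (shearHom v).toRingHom.comp (shearInv v) = RingHom.id _ := by
    refine Polynomial.ringHom_ext' ?_ ?_
    · refine MvPolynomial.ringHom_ext ?_ ?_
      · intro r
        simp [shearInv, ← algebraMap_eq, Polynomial.algebraMap_apply]
      · intro i
        simp only [shearInv, RingHom.comp_apply, Polynomial.coe_eval₂RingHom, Polynomial.eval₂_C,
          AlgHom.toRingHom_eq_coe, RingHom.coe_coe, aeval_X, map_sub, map_mul, RingHom.id_apply]
        have hC : shearHom v (C (v i)) = Polynomial.C (C (v i)) := by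
          rw [← algebraMap_eq, AlgHom.commutes, Polynomial.algebraMap_apply, algebraMap_eq]
        rw [hC]
        simp [shearHom]
    · simp [shearInv, shearHom]
  exact RingHom.congr_fun this p

theorem elim_poly {n : ℕ} {p : MvPolynomial (Fin (n + 1)) ℂ} {v : Fin n → ℂ} {a : ℂ}
    (hm : (Polynomial.C (C a) * shearHom v p).Monic) {R : Polynomial (MvPolynomial (Fin (n + 1)) ℂ)}
    (hR : R.IsPrimitive) : ∃ R' : Polynomial (MvPolynomial (Fin n) ℂ), R' ≠ 0 ∧
      ∀ (y : Fin n → ℂ) (t s : ℂ), eval (Fin.cons t (y + t • v) : Fin (n + 1) → ℂ) p = 0 →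
        qev R (Fin.cons t (y + t • v)) s = 0 → qev R' y s = 0 := by
  have hR2 : (R.map (shearHom v).toRingHom).IsPrimitive := by
    intro d hd
    have h1 : Polynomial.C (shearInv v d) ∣ R := by
      rw [Polynomial.C_dvd_iff_dvd_coeff] at hd ⊢
      intro i
      have := map_dvd (shearInv v) (hd i)
      rw [Polynomial.coeff_map] at this
      erw [shearInv_shear] at this
      exact this
    have h2 := (hR _ h1).map (shearHom v)
    rwa [shear_shearInv] at h2
  obtain ⟨a', ha', s', q, h⟩ := elim_alg hm hR2
  refine ⟨a', ha', fun y t s h0 h1 => ?_⟩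
  let θ : Polynomial (MvPolynomial (Fin n) ℂ) →+* ℂ := (Polynomial.evalRingHom t).comp (Polynomial.mapRingHom (eval y))
  have hθ : θ.comp (shearHom v).toRingHom = eval (Fin.cons t (y + t • v) : Fin (n + 1) → ℂ) :=
    RingHom.ext fun p => shearHom_qev v p y t
  have h2 := congrArg (Polynomial.eval₂ θ s) h
  rw [Polynomial.eval₂_map, Polynomial.eval₂_add, Polynomial.eval₂_mul, Polynomial.eval₂_mul,
    Polynomial.eval₂_C, Polynomial.eval₂_map, hθ] at h2
  have h3 : θ (Polynomial.C (C a) * shearHom v p) = 0 := by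
    rw [map_mul]
    have : θ (shearHom v p) = 0 := by
      rw [← h0]; exact RingHom.congr_fun hθ p
    rw [this, mul_zero]
  have h4 : θ.comp Polynomial.C = eval y := by
    refine RingHom.ext fun e => ?_
    simp [θ]
  rw [qev, Polynomial.eval_map] at h1
  rw [h3, h4, h1, zero_mul, zero_mul, zero_add] at h2
  rw [qev, Polynomial.eval_map, h2]

/-- `qev` as an ordinary polynomial -/
theorem qev_poly {ι κ : Type*} (e : ι → κ) (i : κ) (Q : Polynomial (MvPolynomial ι ℂ)) :
    ∃ p : MvPolynomial κ ℂ, ∀ z : κ → ℂ, eval z p = qev Q (fun j => z (e j)) (z i) := by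
  refine ⟨Q.eval₂ (rename e).toRingHom (X i), fun z => ?_⟩
  rw [Polynomial.hom_eval₂, eval_X, qev, Polynomial.eval_map]
  congr 1
  refine RingHom.ext fun q => ?_
  simp only [RingHom.comp_apply, AlgHom.toRingHom_eq_coe, RingHom.coe_coe, eval_rename]
  rfl

theorem qev_continuous {ι : Type*} (Q : Polynomial (MvPolynomial ι ℂ)) :
    Continuous fun z : (ι → ℂ) × ℂ => qev Q z.1 z.2 := by
  simp only [qev, Polynomial.eval_map]
  simp only [Polynomial.eval₂_eq_sum_range]
  refine continuous_finsetSum _ fun i _ => ((MvPolynomial.continuous_eval _).comp continuous_fst).mul (continuous_snd.pow _)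

theorem qev_mul {ι : Type*} (P Q : Polynomial (MvPolynomial ι ℂ)) (x t) : qev (P * Q) x t = qev P x t * qev Q x t := by
  simp [qev]
theorem qev_add {ι : Type*} (P Q : Polynomial (MvPolynomial ι ℂ)) (x t) : qev (P + Q) x t = qev P x t + qev Q x t := by
  simp [qev]
theorem qev_C {ι : Type*} (p : MvPolynomial ι ℂ) (x t) : qev (Polynomial.C p) x t = eval x p := by
  simp [qev]

open Set Filter Topology MvPolynomial

/-- parametrization of a submanifold near a point -/
theorem subm_param {N : ℕ} {X : Set (CE N)} {a : CE N} {d : ℕ} (hd : d ≤ N)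
    (h : IsSubmanifoldPtOfDim X d a) (ha : a ∈ X) :
    ∃ (g : CE d → CE N) (p : CE N → CE d) (U : Set (CE d)) (V : Set (CE N)), IsOpen U ∧ IsOpen V ∧ a ∈ V ∧
      AnalyticOnNhd ℂ g U ∧ AnalyticOnNhd ℂ p V ∧ MapsTo g U (X ∩ V) ∧ (∀ t ∈ U, p (g t) = t) ∧
      ∀ z ∈ X ∩ V, p z ∈ U ∧ g (p z) = z := by
  obtain ⟨V, W, φ, ψ, hV, haV, hW, hφ, hψ, hm1, hm2, h1, h2, h3⟩ := h
  let E : CE d →L[ℂ] CE N := LinearMap.toContinuousLinearMap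
    { toFun := fun t i => if hi : (i : ℕ) < d then t ⟨i, hi⟩ else 0
      map_add' := fun s t => by ext i; by_cases hi : (i : ℕ) < d <;> simp [hi]
      map_smul' := fun c t => by ext i; by_cases hi : (i : ℕ) < d <;> simp [hi] }
  let P : CE N →L[ℂ] CE d := LinearMap.toContinuousLinearMap
    { toFun := fun z i => z (Fin.castLE hd i)
      map_add' := fun s t => rfl
      map_smul' := fun c t => rfl }
  have hE : ∀ t i, E t i = if hi : (i : ℕ) < d then t ⟨i, hi⟩ else 0 := fun t i => rfl
  have hP : ∀ z i, P z i = z (Fin.castLE hd i) := fun z i => rfl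
  have hPE : ∀ t, P (E t) = t := by
    intro t; ext i; rw [hP, hE]; simp
  have hEP : ∀ z : CE N, (∀ i : Fin N, d ≤ (i : ℕ) → z i = 0) → E (P z) = z := by
    intro z hz; ext i; rw [hE]
    by_cases hi : (i : ℕ) < d
    · simp [hi, hP]
    · simp [hi, hz i (not_lt.1 hi)]
  have hE0 : ∀ t (i : Fin N), d ≤ (i : ℕ) → E t i = 0 := by
    intro t i hi; rw [hE]; simp [not_lt.2 hi]
  refine ⟨fun t => ψ (E t), fun z => P (φ z), E ⁻¹' W, V, hW.preimage E.continuous, hV, haV, ?_, ?_, ?_, ?_, ?_⟩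
  · intro t ht
    exact (hψ (E t) ht).comp (E.analyticAt t)
  · intro z hz
    exact (P.analyticAt _).comp (hφ z hz)
  · intro t ht
    have : E t ∈ φ '' (X ∩ V) := by rw [h3]; exact ⟨ht, hE0 t⟩
    obtain ⟨x, hx, hxE⟩ := this
    change ψ (E t) ∈ _
    rw [← hxE, h1 x hx.2]; exact hx
  · intro t ht
    change P (φ (ψ (E t))) = t
    rw [h2 _ ht, hPE]
  · intro z hz
    have : φ z ∈ W ∩ {z | ∀ i : Fin N, d ≤ (i : ℕ) → z i = 0} := by rw [← h3]; exact mem_image_of_mem _ hz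
    have h4 := hEP _ this.2
    refine ⟨?_, ?_⟩
    · change E (P (φ z)) ∈ W
      rw [h4]; exact this.1
    · change ψ (E (P (φ z))) = z
      rw [h4, h1 z hz.2]

theorem subm_big {N : ℕ} {X : Set (CE N)} {a : CE N} {d : ℕ} (hd : N ≤ d)
    (h : IsSubmanifoldPtOfDim X d a) : IsSubmanifoldPtOfDim X N a := by
  obtain ⟨V, W, φ, ψ, hV, haV, hW, hφ, hψ, hm1, hm2, h1, h2, h3⟩ := h
  refine ⟨V, W, φ, ψ, hV, haV, hW, hφ, hψ, hm1, hm2, h1, h2, ?_⟩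
  rw [h3]
  ext z
  simp only [mem_inter_iff, mem_ofPred_eq, and_congr_right_iff]
  intro _
  constructor
  · intro _ i hi; exact absurd i.2 (by omega)
  · intro _ i hi; exact absurd i.2 (by omega)

theorem dim_le {a b : ℕ} {g : CE a → CE b} {U : Set (CE a)} (hg : AnalyticOnNhd ℂ g U)
    {x : CE b} (hx : g '' U ∈ 𝓝 x) : b ≤ a := by
  have h1 : dimH (g '' U) ≤ dimH U := by
    refine dimH_image_le_of_locally_lipschitzOn fun y hy => ?_
    obtain ⟨K, t, ht, hL⟩ := ((hg y hy).contDiffAt (n := 1)).exists_lipschitzOnWith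
    exact ⟨K, t, nhdsWithin_le_nhds ht, hL⟩
  rw [Real.dimH_of_mem_nhds hx] at h1
  have h2 := h1.trans (dimH_mono (subset_univ U))
  rw [Real.dimH_univ_eq_finrank] at h2
  have h3 : ∀ n : ℕ, Module.finrank ℝ (CE n) = 2 * n := by
    intro n
    rw [Module.finrank_pi_fintype]; simp [Complex.finrank_real_complex, mul_comm]
  rw [h3, h3] at h2
  have h4 : 2 * b ≤ 2 * a := by exact_mod_cast h2
  omega

/-- the dimension of a submanifold at a point is determined -/
theorem subm_dim_le {N : ℕ} {X : Set (CE N)} {a : CE N} {d e : ℕ} (hd : d ≤ N) (he : e ≤ N)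
    (h : IsSubmanifoldPtOfDim X d a) (h' : IsSubmanifoldPtOfDim X e a) (ha : a ∈ X) : d ≤ e := by
  obtain ⟨g, p, U, V, hU, hV, haV, hg, hp, hm, h1, h2⟩ := subm_param hd h ha
  obtain ⟨g', p', U', V', hU', hV', haV', hg', hp', hm', h1', h2'⟩ := subm_param he h' ha
  have hO : IsOpen (U' ∩ g' ⁻¹' V) := hg'.continuousOn.isOpen_inter_preimage hU' hV
  have hO2 : IsOpen (U ∩ g ⁻¹' V') := hg.continuousOn.isOpen_inter_preimage hU hV'
  refine dim_le (g := fun t => p (g' t)) (U := U' ∩ g' ⁻¹' V) (x := p a) ?_ ?_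
  · intro t ht
    exact (hp _ ht.2).comp (hg' t ht.1)
  · have hpa := h2 a ⟨ha, haV⟩
    refine Filter.mem_of_superset (hO2.mem_nhds ⟨hpa.1, ?_⟩) ?_
    · change g (p a) ∈ V'
      rw [hpa.2]; exact haV'
    · intro t ht
      have h5 := hm ht.1
      have h6 := h2' (g t) ⟨h5.1, ht.2⟩
      refine ⟨p' (g t), ⟨h6.1, ?_⟩, ?_⟩
      · change g' (p' (g t)) ∈ V
        rw [h6.2]; exact h5.2
      · change p (g' (p' (g t))) = t
        rw [h6.2, h1 t ht.1]

theorem subm_dim_unique {N : ℕ} {X : Set (CE N)} {a : CE N} {k d : ℕ} (hk : k < N)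
    (h : IsSubmanifoldPtOfDim X k a) (h' : IsSubmanifoldPtOfDim X d a) (ha : a ∈ X) : d = k := by
  rcases le_or_gt d N with hd | hd
  · exact le_antisymm (subm_dim_le hd hk.le h' h ha) (subm_dim_le hk.le hd h h' ha)
  · have := subm_dim_le le_rfl hk.le (subm_big hd.le h') h ha
    omega

open Set Filter Topology MvPolynomial

theorem prim_part {n : ℕ} {R : Polynomial (MvPolynomial (Fin n) ℂ)} (hR : R ≠ 0) :
    ∃ (a : MvPolynomial (Fin n) ℂ) (R' : Polynomial (MvPolynomial (Fin n) ℂ)), a ≠ 0 ∧ R'.IsPrimitive ∧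
      R = Polynomial.C a * R' := by
  classical
  let _ : StrongNormalizationMonoid (MvPolynomial (Fin n) ℂ) := UniqueFactorizationMonoid.strongNormalizationMonoid
  let _ : NormalizedGCDMonoid (MvPolynomial (Fin n) ℂ) := UniqueFactorizationMonoid.toNormalizedGCDMonoid _
  refine ⟨R.content, R.primPart, ?_, R.isPrimitive_primPart, R.eq_C_content_mul_primPart⟩
  rwa [Ne, Polynomial.content_eq_zero_iff]

theorem snoc_qev {N : ℕ} {P : MvPolynomial (Fin (N + 1)) ℂ} (hP : P ≠ 0) :
    ∃ R : Polynomial (MvPolynomial (Fin N) ℂ), R ≠ 0 ∧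
      ∀ (x : Fin N → ℂ) t, qev R x t = eval (Fin.snoc x t : Fin (N + 1) → ℂ) P := by
  let e : Fin (N + 1) → Fin (N + 1) := Fin.snoc (α := fun _ => Fin (N + 1)) Fin.succ 0
  have he : Function.Injective e := by
    intro i j
    refine Fin.lastCases ?_ (fun i => ?_) i <;> refine Fin.lastCases ?_ (fun j => ?_) j <;>
      simp [e, Fin.succ_ne_zero, (Fin.succ_ne_zero _).symm]
  refine ⟨shearHom 0 (rename e P), ?_, fun x t => ?_⟩
  · intro h
    have := shearInv_shear 0 (rename e P)
    rw [h, map_zero] at this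
    exact hP (rename_injective e he (by rw [← this, map_zero]))
  · rw [shearHom_qev, eval_rename]
    congr 2
    ext i
    refine Fin.lastCases ?_ (fun i => ?_) i <;> simp [e]

/-- the state of the dimension reduction -/
def NState {N : ℕ} (Y P : Set (CE N)) (s : Finset (CE N → ℂ)) (j : ℕ) : Prop :=
  ∃ (l : CE N →L[ℂ] CE j) (X : Set (CE N)), Y ∩ P ⊆ X ∧ (∀ i, IntOn X l (fun z => z i)) ∧
    (∀ z ∈ X, ∀ O ∈ 𝓝 z, l '' (X ∩ O) ∈ 𝓝 (l z)) ∧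
    ∀ f ∈ s, ∃ R : Polynomial (MvPolynomial (Fin j) ℂ), R ≠ 0 ∧ ∀ z ∈ X ∩ P, qev R (l z) (f z) = 0

theorem nstate_prim {N : ℕ} {P : Set (CE N)} {j : ℕ} (hP : IsOpen P)
    {l : CE N →L[ℂ] CE j} {X : Set (CE N)} {f : CE N → ℂ} (hf : ContinuousOn f P)
    (hc : ∀ z ∈ X, ∀ O ∈ 𝓝 z, l '' (X ∩ O) ∈ 𝓝 (l z)) {R : Polynomial (MvPolynomial (Fin j) ℂ)}
    (hR : R ≠ 0) (h : ∀ z ∈ X ∩ P, qev R (l z) (f z) = 0) :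
    ∃ R' : Polynomial (MvPolynomial (Fin j) ℂ), R'.IsPrimitive ∧ ∀ z ∈ X ∩ P, qev R' (l z) (f z) = 0 := by
  obtain ⟨a, R', ha, hR', rfl⟩ := prim_part hR
  refine ⟨R', hR', fun z hz => ?_⟩
  by_contra hne
  have hcont : ContinuousAt (fun w => qev R' (l w) (f w)) z := by
    have h1 : ContinuousAt (fun w => (l w, f w)) z :=
      l.continuous.continuousAt.prodMk (hf.continuousAt (hP.mem_nhds hz.2))
    exact ContinuousAt.comp (f := fun w => (l w, f w)) (g := fun q : (Fin j → ℂ) × ℂ => qev R' q.1 q.2)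
      (qev_continuous R').continuousAt h1
  have hO : {w | qev R' (l w) (f w) ≠ 0} ∩ P ∈ 𝓝 z := inter_mem (hcont.eventually_ne hne) (hP.mem_nhds hz.2)
  obtain ⟨x, hx, hxa⟩ := ((poly_frequently_ne ha (l z)).and_eventually (hc z hz.1 _ hO)).exists
  obtain ⟨w, hw, rfl⟩ := hxa
  have := h w ⟨hw.1, hw.2.2⟩
  rw [qev_mul, qev_C] at this
  rcases mul_eq_zero.1 this with h0 | h0
  · exact hx h0
  · exact hw.2.1 h0

theorem nstate_step {N k n : ℕ} {Y P : Set (CE N)} {s : Finset (CE N → ℂ)} (hkN : k ≤ N) (hkn : k < n + 1)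
    (hP : IsOpen P) (hs : ∀ f ∈ s, ContinuousOn f P) (hY : Y ∩ P = {x ∈ P | ∀ f ∈ s, f x = 0})
    (hdense : ∀ a ∈ Y, a ∈ closure {b | b ∈ Y ∧ IsSubmanifoldPtOfDim Y k b})
    (h : NState Y P s (n + 1)) : NState Y P s n := by
  classical
  obtain ⟨l, X, hYX, hintg, hopen, hR⟩ := h
  have hR1 : ∀ f ∈ s, ∃ (R : Polynomial (MvPolynomial (Fin (n + 1)) ℂ)), R.IsPrimitive ∧
      ∀ z ∈ X ∩ P, qev R (l z) (f z) = 0 := by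
    intro f hf
    obtain ⟨R, hR0, hR⟩ := hR f hf
    exact nstate_prim hP (hs f hf) hopen hR0 hR
  choose! R hRp hRv using hR1
  have hR2 : ∀ f ∈ s, ∃ (e : ℕ) (q : Polynomial (MvPolynomial (Fin (n + 1)) ℂ)),
      R f = Polynomial.X ^ e * q ∧ q.coeff 0 ≠ 0 := by
    intro f hf
    obtain ⟨q, hq, hnd⟩ := Polynomial.exists_eq_pow_rootMultiplicity_mul_and_not_dvd (R f) (hRp f hf).ne_zero 0
    rw [map_zero, sub_zero] at hq hnd
    exact ⟨_, q, hq, fun h => hnd (Polynomial.X_dvd_iff.2 h)⟩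
  choose! e q hq hq0 using hR2
  set c : MvPolynomial (Fin (n + 1)) ℂ := ∏ f ∈ s, (q f).coeff 0 with hcdef
  have hc0 : c ≠ 0 := Finset.prod_ne_zero_iff.2 hq0
  have hqe : ∀ f x, qev (q f) x 0 = eval x ((q f).coeff 0) := by
    intro f x
    rw [qev, ← Polynomial.coeff_zero_eq_eval_zero, Polynomial.coeff_map]
  -- `c ∘ l` vanishes on `Y ∩ P`
  have hcY : ∀ z ∈ Y ∩ P, eval (l z) c = 0 := by
    intro z hz
    by_contra hne
    rw [hcdef, map_prod, ← Ne, Finset.prod_ne_zero_iff] at hne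
    have hfz : ∀ f ∈ s, f z = 0 := by
      have := hz; rw [hY] at this; exact this.2
    have h1 : ∀ f ∈ s, ∀ᶠ w in 𝓝 z, qev (q f) (l w) (f w) ≠ 0 := by
      intro f hf
      have h1 : ContinuousAt (fun w => (l w, f w)) z :=
        l.continuous.continuousAt.prodMk ((hs f hf).continuousAt (hP.mem_nhds hz.2))
      have h2 : ContinuousAt (fun w => qev (q f) (l w) (f w)) z :=
        ContinuousAt.comp (f := fun w => (l w, f w)) (g := fun p : (Fin (n + 1) → ℂ) × ℂ => qev (q f) p.1 p.2)
          (qev_continuous (q f)).continuousAt h1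
      refine h2.eventually_ne ?_
      rw [hfz f hf, hqe]; exact hne f hf
    have h2 : ∀ᶠ w in 𝓝 z, ∀ f ∈ s, qev (q f) (l w) (f w) ≠ 0 := (Finset.eventually_all s).2 h1
    have h3 : ∀ᶠ w in 𝓝 z, w ∈ X → w ∈ Y := by
      filter_upwards [h2, hP.mem_nhds hz.2] with w hw hwP hwX
      have : w ∈ Y ∩ P := by
        rw [hY]
        refine ⟨hwP, fun f hf => ?_⟩
        have h4 := hRv f hf w ⟨hwX, hwP⟩
        rw [hq f hf, qev_mul] at h4
        have h5 := (mul_eq_zero.1 h4).resolve_right (hw f hf)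
        simp only [qev, Polynomial.map_pow, Polynomial.map_X, Polynomial.eval_pow, Polynomial.eval_X] at h5
        exact eq_zero_of_pow_eq_zero h5
      exact this.1
    obtain ⟨O, hO, hOo, hzO⟩ := eventually_nhds_iff.1 h3
    obtain ⟨b, hbO, hbY, hbs⟩ := mem_closure_iff.1 (hdense z hz.1) (O ∩ P) (hOo.inter hP) ⟨hzO, hz.2⟩
    obtain ⟨g, p, U, V, hU, hV, haV, hg, hp, hm, hpg, hgp⟩ := subm_param hkN hbs hbY
    have hO2 : O ∩ P ∩ V ∈ 𝓝 b := inter_mem ((hOo.inter hP).mem_nhds hbO) (hV.mem_nhds haV)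
    have h6 := hopen b (hYX ⟨hbY, hbO.2⟩) _ hO2
    have := dim_le (g := fun t => l (g t)) (U := U) (x := l b)
      (fun t ht => (l.analyticAt _).comp (hg t ht)) (Filter.mem_of_superset h6 (by
        rintro _ ⟨w, ⟨hwX, hwO⟩, rfl⟩
        have hwY := hO w hwO.1.1 hwX
        have h7 := hgp w ⟨hwY, hwO.2⟩
        exact ⟨p w, h7.1, by simp only [h7.2]⟩))
    omega
  -- shear
  obtain ⟨τ, hτ, hτv⟩ := lin_shear hc0
  obtain ⟨v, hv⟩ := (poly_frequently_ne hτ 0).exists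
  obtain ⟨a, ha, hmon⟩ := hτv v hv
  let l' : CE N →L[ℂ] CE n := ContinuousLinearMap.pi fun i =>
    (ContinuousLinearMap.proj (R := ℂ) (φ := fun _ : Fin (n + 1) => ℂ) i.succ).comp l
      - v i • (ContinuousLinearMap.proj (R := ℂ) (φ := fun _ : Fin (n + 1) => ℂ) 0).comp l
  have hl' : ∀ z i, l' z i = l z i.succ - v i * l z 0 := fun z i => rfl
  have hcons : ∀ z, (Fin.cons (l z 0) (l' z + l z 0 • v) : Fin (n + 1) → ℂ) = l z := by
    intro z; ext i
    refine Fin.cases ?_ (fun i => ?_) i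
    · simp
    · simp [hl', mul_comm]
  have hroot : ∀ y t, qev (Polynomial.C (C a) * shearHom v c) y t =
      a * eval (Fin.cons t (y + t • v) : Fin (n + 1) → ℂ) c := by
    intro y t; rw [qev_mul, qev_C, shearHom_qev, eval_C]
  refine ⟨l', X ∩ {z | eval (l z) c = 0}, fun z hz => ⟨hYX hz, hcY z hz⟩, ?_, ?_, ?_⟩
  · intro i
    refine IntOn.trans (y := fun z => l z) ?_ ((hintg i).mono inter_subset_left)
    have h0 : IntOn (X ∩ {z | eval (l z) c = 0}) l' (fun z => l z 0) := by
      refine ⟨_, hmon, fun z hz => ?_⟩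
      rw [hroot, hcons]
      have : eval (l z) c = 0 := hz.2
      rw [this, mul_zero]
    have h1 : ∀ i, IntOn (X ∩ {z | eval (l z) c = 0}) l'
        (fun z => (Fin.cons (l z 0) (l' z) : Fin (n + 1) → ℂ) i) := by
      intro i
      refine Fin.cases ?_ (fun i => ?_) i
      · simpa using h0
      · simpa using IntOn.self (x := l') i
    intro i
    refine Fin.cases h0 (fun i => ?_) i
    have h2 := IntOn.poly h1 (MvPolynomial.X i.succ + C (v i) * MvPolynomial.X 0)
    have h3 : ∀ z, eval (Fin.cons (l z 0) (l' z) : Fin (n + 1) → ℂ) (MvPolynomial.X i.succ + C (v i) * MvPolynomial.X 0) = l z i.succ := by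
      intro z; simp [hl']
    simpa only [h3] using h2
  · intro z hz O hO
    have h0 : qev (Polynomial.C (C a) * shearHom v c) (l' z) (l z 0) = 0 := by
      rw [hroot, hcons]
      have : eval (l z) c = 0 := hz.2
      rw [this, mul_zero]
    have h1 := hopen z hz.1 O hO
    have hcc : Continuous fun yt : (Fin n → ℂ) × ℂ => (Fin.cons yt.2 (yt.1 + yt.2 • v) : Fin (n + 1) → ℂ) := by
      refine continuous_pi fun i => ?_
      refine Fin.cases ?_ (fun i => ?_) i
      · simpa using continuous_snd
      · simp only [Fin.cons_succ, Pi.add_apply, Pi.smul_apply, smul_eq_mul]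
        fun_prop
    have h2 : ∀ᶠ yt : (Fin n → ℂ) × ℂ in 𝓝 (l' z, l z 0),
        (Fin.cons yt.2 (yt.1 + yt.2 • v) : Fin (n + 1) → ℂ) ∈ l '' (X ∩ O) := by
      refine hcc.continuousAt.eventually_mem ?_
      simp only [hcons]; exact h1
    rw [nhds_prod_eq] at h2
    obtain ⟨pa, hpa, pb, hpb, hab⟩ := Filter.eventually_prod_iff.1 h2
    obtain ⟨ε, hε, hball⟩ := Metric.eventually_nhds_iff.1 hpb
    filter_upwards [root_near hmon h0 hε, hpa] with y hy hya
    obtain ⟨t, ht, hty⟩ := hy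
    obtain ⟨w, hw, hwl⟩ := hab hya (hball (by rwa [dist_eq_norm]))
    refine ⟨w, ⟨⟨hw.1, ?_⟩, hw.2⟩, ?_⟩
    · change eval (l w) c = 0
      rw [hroot] at hty
      rw [hwl]
      exact (mul_eq_zero.1 hty).resolve_left ha
    · ext i
      rw [hl', hwl]
      simp [mul_comm]
  · intro f hf
    obtain ⟨R', hR', hR'v⟩ := elim_poly hmon (hRp f hf)
    refine ⟨R', hR', fun z hz => ?_⟩
    refine hR'v (l' z) (l z 0) (f z) ?_ ?_
    · rw [hcons]; exact hz.1.2
    · rw [hcons]; exact hRv f hf z ⟨hz.1.1, hz.2⟩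

theorem nash_local {N k : ℕ} {Ω Y : Set (CE N)} (hkN : k ≤ N) (hY : IsNashSet Ω Y)
    (hdense : ∀ a ∈ Y, a ∈ closure {b | b ∈ Y ∧ IsSubmanifoldPtOfDim Y k b}) {y : CE N} (hy : y ∈ Y) :
    ∃ P : Set (CE N), IsOpen P ∧ y ∈ P ∧ ∀ u : Fin (k + 1) → MvPolynomial (Fin N) ℂ,
      ∃ p : MvPolynomial (Fin (k + 1)) ℂ, p ≠ 0 ∧ ∀ z ∈ Y ∩ P, eval (fun i => eval z (u i)) p = 0 := by
  classical
  obtain ⟨U, hU, hyU, hUΩ, s, hs, hYU⟩ := hY.2 y (hY.1 hy)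
  have h1 : ∀ f ∈ s, ∃ V : Set (CE N), IsOpen V ∧ y ∈ V ∧
    ∃ P : MvPolynomial (Fin (N + 1)) ℂ, P ≠ 0 ∧ ∀ x ∈ V, eval (Fin.snoc x (f x) : Fin (N + 1) → ℂ) P = 0 := by
    intro f hf
    obtain ⟨V, hV, hyV, _, h⟩ := (hs f hf).2 y hyU
    exact ⟨V, hV, hyV, h⟩
  choose! V hV hyV Pf hPf hPfv using h1
  set P := U ∩ ⋂ f ∈ s, V f with hPdef
  have hP : IsOpen P := hU.inter (isOpen_biInter_finset hV)
  have hyP : y ∈ P := ⟨hyU, mem_iInter₂.2 hyV⟩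
  have hYP : Y ∩ P = {x ∈ P | ∀ f ∈ s, f x = 0} := by
    ext x
    constructor
    · rintro ⟨hx, hxP⟩
      have : x ∈ Y ∩ U := ⟨hx, hxP.1⟩
      rw [hYU] at this
      exact ⟨hxP, this.2⟩
    · rintro ⟨hxP, hx⟩
      have : x ∈ Y ∩ U := by rw [hYU]; exact ⟨hxP.1, hx⟩
      exact ⟨this.1, hxP⟩
  have hcont : ∀ f ∈ s, ContinuousOn f P := fun f hf => (hs f hf).1.continuousOn.mono inter_subset_left
  have hN : NState Y P s N := by
    refine ⟨ContinuousLinearMap.id ℂ _, univ, subset_univ _, fun i => IntOn.self (x := fun z => z) i, ?_, ?_⟩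
    · intro z _ O hO; simpa using hO
    · intro f hf
      obtain ⟨R, hR, hRv⟩ := snoc_qev (hPf f hf)
      refine ⟨R, hR, fun z hz => ?_⟩
      rw [hRv]
      exact hPfv f hf z (mem_iInter₂.1 hz.2.2 f hf)
  have hk : NState Y P s k := by
    obtain ⟨m, rfl⟩ := Nat.exists_eq_add_of_le hkN
    have : ∀ i ≤ m, NState Y P s (k + (m - i)) := by
      intro i
      induction i with
      | zero => intro _; simpa using hN
      | succ i ih =>
        intro hi
        have h2 := ih (by omega)
        have h3 : k + (m - i) = k + (m - (i + 1)) + 1 := by omega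
        rw [h3] at h2
        exact nstate_step hkN (by omega) hP hcont hYP hdense h2
    simpa using this m le_rfl
  obtain ⟨l, X, hYX, hintg, _, _⟩ := hk
  refine ⟨P, hP, hyP, fun u => ?_⟩
  obtain ⟨p, hp, hpv⟩ := dep_on (S := X) (x := l) (u := fun z i => eval z (u i))
    (fun i => IntOn.poly (y := fun z => z) hintg (u i)) (Or.inl (Nat.lt_succ_self k))
  exact ⟨p, hp, fun z hz => hpv z (hYX hz)⟩

open Set Filter Topology MvPolynomial

/-- projection to the first `k` coordinates -/
noncomputable def prK {N k : ℕ} (hk : k ≤ N) : CE N →L[ℂ] CE k :=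
  ContinuousLinearMap.pi fun i => ContinuousLinearMap.proj (R := ℂ) (φ := fun _ : Fin N => ℂ) (Fin.castLE hk i)

theorem prK_apply {N k : ℕ} (hk : k ≤ N) (z : CE N) (i : Fin k) : prK hk z i = z (Fin.castLE hk i) := rfl

/-- the data of an algebraic branched covering of `ℂ^k` -/
structure IsCov {N k : ℕ} (hk : k ≤ N) (Q : Fin N → Polynomial (MvPolynomial (Fin k) ℂ))
    (δ : MvPolynomial (Fin k) ℂ) : Prop where
  monic : ∀ i, (Q i).Monic
  dne : δ ≠ 0
  sep : ∀ i x t, qev (Q i) x t = 0 → qev (Q i).derivative x t = 0 → eval x δ = 0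
  proj : ∀ x (z : CE N), (∀ i, qev (Q i) x (z i) = 0) → prK hk z = x

/-- the covering space -/
def XQ {N k : ℕ} (hk : k ≤ N) (Q : Fin N → Polynomial (MvPolynomial (Fin k) ℂ)) : Set (CE N) :=
  {z | ∀ i, qev (Q i) (prK hk z) (z i) = 0}

/-- its unbranched part -/
def XO {N k : ℕ} (hk : k ≤ N) (Q : Fin N → Polynomial (MvPolynomial (Fin k) ℂ))
    (δ : MvPolynomial (Fin k) ℂ) : Set (CE N) :=
  {z | z ∈ XQ hk Q ∧ eval (prK hk z) δ ≠ 0}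

theorem qev_analytic {k : ℕ} (Q : Polynomial (MvPolynomial (Fin k) ℂ)) (u : CE k × ℂ) :
    AnalyticAt ℂ (fun z : CE k × ℂ => qev Q z.1 z.2) u := by
  simp only [qev, Polynomial.eval_map]
  simp only [Polynomial.eval₂_eq_sum_range]
  refine Finset.analyticAt_fun_sum _ fun i _ => ?_
  refine AnalyticAt.mul ?_ (analyticAt_snd.pow _)
  have h1 : AnalyticAt ℂ (fun x : CE k => eval x (Q.coeff i)) u.1 := poly_analytic (Q.coeff i) univ u.1 (mem_univ _)
  exact AnalyticAt.comp (g := fun x : CE k => eval x (Q.coeff i)) (f := Prod.fst) h1 analyticAt_fst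

theorem qev_hasDerivAt {k : ℕ} (Q : Polynomial (MvPolynomial (Fin k) ℂ)) (x : CE k) (t : ℂ) :
    HasDerivAt (fun t => qev Q x t) (qev Q.derivative x t) t := by
  have := (Q.map (eval x)).hasDerivAt t
  rwa [Polynomial.derivative_map] at this

theorem implicit_root {k : ℕ} {Q : Polynomial (MvPolynomial (Fin k) ℂ)} {x₀ : CE k} {t₀ : ℂ}
    (h0 : qev Q x₀ t₀ = 0) (h1 : qev Q.derivative x₀ t₀ ≠ 0) :
    ∃ s : CE k → ℂ, s x₀ = t₀ ∧ AnalyticAt ℂ s x₀ ∧ (∀ᶠ x in 𝓝 x₀, qev Q x (s x) = 0) ∧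
      ∀ᶠ p : CE k × ℂ in 𝓝 (x₀, t₀), qev Q p.1 p.2 = 0 → p.2 = s p.1 := by
  set f : CE k × ℂ → ℂ := fun z => qev Q z.1 z.2 with hf
  have hfa : AnalyticAt ℂ f (x₀, t₀) := qev_analytic Q _
  have cdf : ContDiffAt ℂ ⊤ f (x₀, t₀) := hfa.contDiffAt
  have h2 : (fderiv ℂ f (x₀, t₀) ∘L .inr ℂ (CE k) ℂ) 1 = qev Q.derivative x₀ t₀ := by
    have e1 : HasFDerivAt (fun t : ℂ => f (x₀, t)) (fderiv ℂ f (x₀, t₀) ∘L .inr ℂ (CE k) ℂ) t₀ :=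
      hfa.differentiableAt.hasFDerivAt.comp t₀ (hasFDerivAt_prodMk_right x₀ t₀)
    have e2 := e1.hasDerivAt
    exact e2.unique (qev_hasDerivAt Q x₀ t₀)
  have hinv : (fderiv ℂ f (x₀, t₀) ∘L .inr ℂ (CE k) ℂ).IsInvertible := by
    set A := (fderiv ℂ f (x₀, t₀) ∘L .inr ℂ (CE k) ℂ)
    refine ⟨ContinuousLinearEquiv.unitsEquivAut ℂ (Units.mk0 _ h1), ?_⟩
    ext
    simp [h2]
  have hsimp : f (x₀, t₀) = 0 := h0
  refine ⟨cdf.implicitFunction (by simp) hinv, cdf.implicitFunction_apply_self (by simp) hinv, ?_, ?_, ?_⟩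
  · exact (cdf.contDiffAt_implicitFunction (by simp) hinv).analyticAt
  · filter_upwards [cdf.eventually_apply_implicitFunction (by simp) hinv] with x hx
    rw [hsimp] at hx; exact hx
  · filter_upwards [cdf.eventually_apply_eq_iff_implicitFunction (by simp) hinv] with p hp h3
    rw [hsimp] at hp; exact (hp.1 h3).symm

section
variable {N k : ℕ} {hk : k ≤ N} {Q : Fin N → Polynomial (MvPolynomial (Fin k) ℂ)} {δ : MvPolynomial (Fin k) ℂ}

theorem XQ_closed : IsClosed (XQ hk Q) := by
  have : XQ hk Q = ⋂ i, {z | qev (Q i) (prK hk z) (z i) = 0} := by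
    ext z; simp [XQ]
  rw [this]
  refine isClosed_iInter fun i => isClosed_eq ?_ continuous_const
  exact (qev_continuous (Q i)).comp ((prK hk).continuous.prodMk (continuous_apply i))

theorem dpi_continuous : Continuous fun z : CE N => eval (prK hk z) δ :=
  (MvPolynomial.continuous_eval δ).comp (prK hk).continuous

theorem IsCov.mem (h : IsCov hk Q δ) {x : CE k} {z : CE N} (hz : ∀ i, qev (Q i) x (z i) = 0) :
    z ∈ XQ hk Q ∧ prK hk z = x := by
  have := h.proj x z hz
  refine ⟨fun i => ?_, this⟩
  rw [this]; exact hz i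

/-- local sections -/
theorem IsCov.chart (h : IsCov hk Q δ) {w : CE N} (hw : w ∈ XO hk Q δ) :
    ∃ σ : CE k → CE N, σ (prK hk w) = w ∧
      (∀ᶠ x in 𝓝 (prK hk w), AnalyticAt ℂ σ x ∧ σ x ∈ XQ hk Q ∧ prK hk (σ x) = x) ∧
      ∀ᶠ z in 𝓝 w, z ∈ XQ hk Q → z = σ (prK hk z) := by
  have h1 : ∀ i, ∃ s : CE k → ℂ, s (prK hk w) = w i ∧ AnalyticAt ℂ s (prK hk w) ∧
      (∀ᶠ x in 𝓝 (prK hk w), qev (Q i) x (s x) = 0) ∧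
      ∀ᶠ p : CE k × ℂ in 𝓝 (prK hk w, w i), qev (Q i) p.1 p.2 = 0 → p.2 = s p.1 := fun i =>
    implicit_root (hw.1 i) fun h' => hw.2 (h.sep i _ _ (hw.1 i) h')
  choose s hs0 hsa hsq hsu using h1
  refine ⟨fun x i => s i x, funext hs0, ?_, ?_⟩
  · have h2 : ∀ᶠ x in 𝓝 (prK hk w), ∀ i, AnalyticAt ℂ (s i) x :=
      eventually_all.2 fun i => (hsa i).eventually_analyticAt
    filter_upwards [h2, eventually_all.2 hsq] with x hx hx2
    exact ⟨analyticAt_pi_iff.2 hx, h.mem hx2⟩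
  · have h3 : ∀ i, ∀ᶠ z in 𝓝 w, qev (Q i) (prK hk z) (z i) = 0 → z i = s i (prK hk z) := by
      intro i
      have : ContinuousAt (fun z : CE N => (prK hk z, z i)) w :=
        ((prK hk).continuous.prodMk (continuous_apply i)).continuousAt
      exact this.eventually (hsu i)
    filter_upwards [eventually_all.2 h3] with z hz hzX
    exact funext fun i => hz i (hzX i)

/-- openness of the projection -/
theorem IsCov.lift (h : IsCov hk Q δ) {w : CE N} (hw : w ∈ XQ hk Q) {O : Set (CE N)} (hO : O ∈ 𝓝 w) :
    ∀ᶠ x in 𝓝 (prK hk w), ∃ z ∈ XQ hk Q ∩ O, prK hk z = x := by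
  obtain ⟨ε, hε, hball⟩ := Metric.mem_nhds_iff.1 hO
  have h1 : ∀ i, ∀ᶠ x in 𝓝 (prK hk w), ∃ t, ‖t - w i‖ < ε ∧ qev (Q i) x t = 0 :=
    fun i => root_near (h.monic i) (hw i) hε
  filter_upwards [eventually_all.2 h1] with x hx
  choose t ht1 ht2 using hx
  have h2 := h.mem ht2
  refine ⟨t, ⟨h2.1, hball ?_⟩, h2.2⟩
  rw [Metric.mem_ball, dist_pi_lt_iff hε]
  intro i; rw [dist_eq_norm]; exact ht1 i

theorem IsCov.dense (h : IsCov hk Q δ) {w : CE N} (hw : w ∈ XQ hk Q) : w ∈ closure (XO hk Q δ) := by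
  rw [mem_closure_iff_nhds]
  intro O hO
  obtain ⟨x, hx, z, hz, hzx⟩ := ((poly_frequently_ne h.dne (prK hk w)).and_eventually (h.lift hw hO)).exists
  refine ⟨z, hz.2, hz.1, ?_⟩
  rw [hzx]; exact hx

/-- the unbranched part is a submanifold -/
theorem IsCov.subm (h : IsCov hk Q δ) {w : CE N} (hw : w ∈ XO hk Q δ) :
    IsSubmanifoldPtOfDim (XQ hk Q) k w := by
  classical
  obtain ⟨σ, hσ0, hσ, hσu⟩ := h.chart hw
  obtain ⟨B, hB, hBo, hwB⟩ := eventually_nhds_iff.1 hσ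
  obtain ⟨O, hO, hOo, hwO⟩ := eventually_nhds_iff.1 hσu
  let φ : CE N → CE N := fun z i => if (i : ℕ) < k then z i else z i - σ (prK hk z) i
  let ψ : CE N → CE N := fun z i => if (i : ℕ) < k then z i else z i + σ (prK hk z) i
  have hcl : ∀ i : Fin k, ((Fin.castLE hk i : Fin N) : ℕ) < k := fun i => i.2
  have hπφ : ∀ z, prK hk (φ z) = prK hk z := by
    intro z; ext i; simp only [prK_apply, φ]; rw [if_pos (hcl i)]
  have hπψ : ∀ z, prK hk (ψ z) = prK hk z := by
    intro z; ext i; simp only [prK_apply, ψ]; rw [if_pos (hcl i)]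
  have hψφ : ∀ z, ψ (φ z) = z := by
    intro z; ext i
    change (if (i : ℕ) < k then φ z i else φ z i + σ (prK hk (φ z)) i) = z i
    rw [hπφ]
    by_cases hi : (i : ℕ) < k <;> simp [φ, hi]
  have hφψ : ∀ z, φ (ψ z) = z := by
    intro z; ext i
    change (if (i : ℕ) < k then ψ z i else ψ z i - σ (prK hk (ψ z)) i) = z i
    rw [hπψ]
    by_cases hi : (i : ℕ) < k <;> simp [ψ, hi]
  have hσπ : AnalyticOnNhd ℂ (fun z => σ (prK hk z)) (prK hk ⁻¹' B) := fun z hz =>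
    AnalyticAt.fun_comp (hB _ hz).1 ((prK hk).analyticAt z)
  have hcoord : ∀ (i : Fin N) z, AnalyticAt ℂ (fun z : CE N => z i) z := fun i z =>
    (ContinuousLinearMap.proj (R := ℂ) (φ := fun _ : Fin N => ℂ) i).analyticAt z
  have hφa : AnalyticOnNhd ℂ φ (prK hk ⁻¹' B) := by
    intro z hz
    refine analyticAt_pi_iff.2 fun i => ?_
    by_cases hi : (i : ℕ) < k
    · simpa [φ, hi] using hcoord i z
    · have e : (fun z => φ z i) = (fun z => z i) - fun z => σ (prK hk z) i := by
        funext z; simp [φ, hi]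
      rw [e]
      exact (hcoord i z).sub (analyticAt_pi_iff.1 (hσπ z hz) i)
  have hψa : AnalyticOnNhd ℂ ψ (prK hk ⁻¹' B) := by
    intro z hz
    refine analyticAt_pi_iff.2 fun i => ?_
    by_cases hi : (i : ℕ) < k
    · simpa [ψ, hi] using hcoord i z
    · have e : (fun z => ψ z i) = (fun z => z i) + fun z => σ (prK hk z) i := by
        funext z; simp [ψ, hi]
      rw [e]
      exact (hcoord i z).add (analyticAt_pi_iff.1 (hσπ z hz) i)
  have hBo' : IsOpen (prK hk ⁻¹' B) := hBo.preimage (prK hk).continuous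
  have hWo : IsOpen (prK hk ⁻¹' B ∩ ψ ⁻¹' O) := hψa.continuousOn.isOpen_inter_preimage hBo' hOo
  refine ⟨prK hk ⁻¹' B ∩ O, prK hk ⁻¹' B ∩ ψ ⁻¹' O, φ, ψ, hBo'.inter hOo, ⟨hwB, hwO⟩, hWo,
    hφa.mono inter_subset_left, hψa.mono inter_subset_left, ?_, ?_, fun z _ => hψφ z, fun z _ => hφψ z, ?_⟩
  · intro z hz
    refine ⟨?_, ?_⟩
    · change prK hk (φ z) ∈ B
      rw [hπφ]; exact hz.1
    · change ψ (φ z) ∈ O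
      rw [hψφ]; exact hz.2
  · intro z hz
    refine ⟨?_, hz.2⟩
    change prK hk (ψ z) ∈ B
    rw [hπψ]; exact hz.1
  · ext u
    constructor
    · rintro ⟨z, ⟨hzX, hzB, hzO⟩, rfl⟩
      refine ⟨⟨?_, ?_⟩, ?_⟩
      · change prK hk (φ z) ∈ B
        rw [hπφ]; exact hzB
      · change ψ (φ z) ∈ O
        rw [hψφ]; exact hzO
      · intro i hi
        have := congrFun (hO z hzO hzX) i
        simp [φ, not_lt.2 hi, ← this]
    · rintro ⟨⟨huB, huO⟩, hu⟩
      refine ⟨ψ u, ⟨?_, ?_, huO⟩, hφψ u⟩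
      · have h3 := (hB _ huB)
        have : ψ u = σ (prK hk u) := by
          ext i
          by_cases hi : (i : ℕ) < k
          · have h4 := congrFun h3.2.2 ⟨i, hi⟩
            rw [prK_apply, prK_apply] at h4
            simpa [ψ, hi] using h4.symm
          · simp [ψ, hi, hu i (not_lt.1 hi)]
        rw [this]; exact h3.2.1
      · change prK hk (ψ u) ∈ B
        rw [hπψ]; exact huB

theorem subm_nearby {N : ℕ} {X : Set (CE N)} {a : CE N} {d : ℕ} (h : IsSubmanifoldPtOfDim X d a) :
    ∀ᶠ b in 𝓝 a, IsSubmanifoldPtOfDim X d b := by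
  obtain ⟨V, W, φ, ψ, hV, haV, hr⟩ := h
  filter_upwards [hV.mem_nhds haV] with b hb
  exact ⟨V, W, φ, ψ, hV, hb, hr⟩

theorem IsCov.pureDim (h : IsCov hk Q δ) (hkN : k < N) : PureDimOf (XQ hk Q) k := by
  have hsub : XO hk Q δ ⊆ {b | b ∈ XQ hk Q ∧ IsSubmanifoldPtOfDim (XQ hk Q) k b} :=
    fun b hb => ⟨hb.1, h.subm hb⟩
  refine ⟨fun a ha => closure_mono hsub (h.dense ha), fun b hb d hd => ?_⟩
  obtain ⟨c, hc1, hc2⟩ := mem_closure_iff_nhds.1 (h.dense hb) _ (subm_nearby hd)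
  exact subm_dim_unique hkN (h.subm hc2) hc1 hc2.1

end

open Set Filter Topology MvPolynomial

/-- a locally constant predicate on a preconnected set is constant -/
theorem dich {α : Type*} [TopologicalSpace α] {S : Set α} (hS : IsPreconnected S) {p : α → Prop}
    (h : ∀ w ∈ S, (∀ᶠ z in 𝓝 w, z ∈ S → p z) ∨ (∀ᶠ z in 𝓝 w, z ∈ S → ¬ p z))
    {a b : α} (ha : a ∈ S) (hb : b ∈ S) (hpa : p a) : p b := by
  by_contra hpb
  have h1 := hS {z | ∀ᶠ y in 𝓝 z, y ∈ S → p y} {z | ∀ᶠ y in 𝓝 z, y ∈ S → ¬ p y}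
    (isOpen_setOfPred_eventually_nhds) (isOpen_setOfPred_eventually_nhds) (fun z hz => h z hz)
    ⟨a, ha, by
      rcases h a ha with h2 | h2
      · exact h2
      · exact absurd hpa (h2.self_of_nhds ha)⟩
    ⟨b, hb, by
      rcases h b hb with h2 | h2
      · exact absurd (h2.self_of_nhds hb) hpb
      · exact h2⟩
  obtain ⟨z, hz, hz1, hz2⟩ := h1
  exact hz2.self_of_nhds hz (hz1.self_of_nhds hz)

/-- the complement of an algebraic hypersurface in a ball is connected -/
theorem ball_diff_preconnected {k : ℕ} {δ : MvPolynomial (Fin k) ℂ} (hδ : δ ≠ 0) (c : CE k) (ρ : ℝ) :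
    IsPreconnected {x | x ∈ Metric.ball c ρ ∧ eval x δ ≠ 0} := by
  classical
  rw [isPreconnected_iff_subset_of_disjoint]
  intro u v hu hv huv hd
  set B := Metric.ball c ρ with hB
  have hdisj : ∀ x ∈ B, eval x δ ≠ 0 → x ∈ u → x ∈ v → False := by
    intro x hx hx2 h1 h2
    have : x ∈ ({x | x ∈ B ∧ eval x δ ≠ 0} ∩ (u ∩ v) : Set (CE k)) := ⟨⟨hx, hx2⟩, h1, h2⟩
    rw [hd] at this; exact this
  let s : CE k → ℂ := fun x => if x ∈ u then 1 else 0
  have hopen : ∀ x, eval x δ ≠ 0 → ∀ᶠ y in 𝓝 x, eval y δ ≠ 0 := fun x hx =>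
    (MvPolynomial.continuous_eval δ).continuousAt.eventually_ne hx
  have hs : ∀ x ∈ B, eval x δ ≠ 0 → DifferentiableAt ℂ s x := by
    intro x hx hx2
    by_cases hxu : x ∈ u
    · have : s =ᶠ[𝓝 x] fun _ => 1 := by
        filter_upwards [hu.mem_nhds hxu] with y hy
        simp [s, hy]
      exact (differentiableAt_const _).congr_of_eventuallyEq this
    · have hxv : x ∈ v := (huv ⟨hx, hx2⟩).resolve_left hxu
      have : s =ᶠ[𝓝 x] fun _ => 0 := by
        filter_upwards [hv.mem_nhds hxv, hopen x hx2, Metric.isOpen_ball.mem_nhds hx] with y hy hy2 hy3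
        have : y ∉ u := fun h => hdisj y hy3 hy2 h hy
        simp [s, this]
      exact (differentiableAt_const _).congr_of_eventuallyEq this
  obtain ⟨g, hg, hgs⟩ := scv_riemann_ext (S := B) (δ := fun x => eval x δ) (s := s) Metric.isOpen_ball
    (poly_analytic δ B) hs (fun x _ => poly_frequently_ne hδ x)
    (fun x _ => ⟨1, Eventually.of_forall fun y _ => by
      by_cases h : y ∈ u <;> simp [s, h]⟩)
  have hval : MapsTo g B ({0, 1} : Set ℂ) := by
    intro x hx
    by_contra hne
    have hne' : ∀ᶠ y in 𝓝 x, g y ∈ ({0, 1} : Set ℂ)ᶜ :=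
      (hg x hx).continuousAt.eventually ((((finite_singleton (1:ℂ)).insert 0).isClosed.isOpen_compl).mem_nhds hne)
    obtain ⟨y, hy1, hy2, hy3⟩ := ((poly_frequently_ne hδ x).and_eventually
      (hne'.and (Metric.isOpen_ball.mem_nhds hx))).exists
    apply hy2
    rw [hgs y hy3 hy1]
    by_cases h : y ∈ u <;> simp [s, h]
  have hBc : IsPreconnected B := (convex_ball c ρ).isPreconnected
  have hconst : ∀ x ∈ B, ∀ y ∈ B, g x = g y := by
    intro x hx y hy
    have hfin : ({0, 1} : Set ℂ).Finite := (finite_singleton (1:ℂ)).insert 0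
    exact hfin.countable.isTotallyDisconnected _ hval.image_subset (hBc.image g hg.continuousOn)
      (mem_image_of_mem g hx) (mem_image_of_mem g hy)
  by_cases hex : ∃ x, (x ∈ B ∧ eval x δ ≠ 0) ∧ x ∈ u
  · obtain ⟨x, hx, hxu⟩ := hex
    left
    intro y hy
    by_contra hyu
    have := hconst x hx.1 y hy.1
    rw [hgs x hx.1 hx.2, hgs y hy.1 hy.2] at this
    simp [s, hxu, hyu] at this
  · right
    intro y hy
    exact (huv hy).resolve_left fun h => hex ⟨y, hy, h⟩

section
variable {N k : ℕ} {hk : k ≤ N} {Q : Fin N → Polynomial (MvPolynomial (Fin k) ℂ)} {δ : MvPolynomial (Fin k) ℂ}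

theorem IsCov.chartBall (h : IsCov hk Q δ) {w : CE N} (hw : w ∈ XO hk Q δ) {O : Set (CE N)} (hO : O ∈ 𝓝 w) :
    ∃ (ρ : ℝ) (σ : CE k → CE N), 0 < ρ ∧ σ (prK hk w) = w ∧
      AnalyticOnNhd ℂ σ (Metric.ball (prK hk w) ρ) ∧
      (∀ x ∈ Metric.ball (prK hk w) ρ, σ x ∈ XO hk Q δ ∧ σ x ∈ O ∧ prK hk (σ x) = x) ∧
      ∀ᶠ z in 𝓝 w, z ∈ XQ hk Q → prK hk z ∈ Metric.ball (prK hk w) ρ ∧ z = σ (prK hk z) := by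
  obtain ⟨σ, hσ0, hσ, hσu⟩ := h.chart hw
  have hca : ContinuousAt σ (prK hk w) := hσ.self_of_nhds.1.continuousAt
  have h1 : ∀ᶠ x in 𝓝 (prK hk w), σ x ∈ O := hca.eventually (by rw [hσ0]; exact hO)
  have h2 : ∀ᶠ x in 𝓝 (prK hk w), eval x δ ≠ 0 :=
    (MvPolynomial.continuous_eval δ).continuousAt.eventually_ne hw.2
  obtain ⟨ρ, hρ, hball⟩ := Metric.eventually_nhds_iff_ball.1 ((hσ.and h1).and h2)
  refine ⟨ρ, σ, hρ, hσ0, fun x hx => (hball x hx).1.1.1, fun x hx => ?_, ?_⟩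
  · obtain ⟨⟨⟨_, h3, h4⟩, h5⟩, h6⟩ := hball x hx
    exact ⟨⟨h3, by rw [h4]; exact h6⟩, h5, h4⟩
  · filter_upwards [hσu, (prK hk).continuous.continuousAt.eventually (Metric.ball_mem_nhds _ hρ)] with z hz hz2 hz3
    exact ⟨hz2, hz hz3⟩

theorem analytic_relclosed {N : ℕ} {D A : Set (CE N)} (hA : IsAnalyticSet D A) {z : CE N} (hz : z ∈ D)
    (hzA : z ∉ A) : ∀ᶠ y in 𝓝 z, y ∉ A := by
  obtain ⟨U, hU, hzU, hUD, s, hs, hAU⟩ := hA.2 z hz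
  have : ∃ f ∈ s, f z ≠ 0 := by
    by_contra hne
    push Not at hne
    have : z ∈ A ∩ U := by rw [hAU]; exact ⟨hzU, hne⟩
    exact hzA this.1
  obtain ⟨f, hf, hfz⟩ := this
  filter_upwards [(hs f hf z hzU).continuousAt.eventually_ne hfz, hU.mem_nhds hzU] with y hy hyU hyA
  have : y ∈ A ∩ U := ⟨hyA, hyU⟩
  rw [hAU] at this
  exact hy (this.2 f hf)

theorem analytic_closure {N : ℕ} {D A M : Set (CE N)} (hA : IsAnalyticSet D A) (hM : M ⊆ A) :
    closure M ∩ D ⊆ A := by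
  rintro z ⟨hz, hzD⟩
  by_contra hzA
  obtain ⟨y, hy, hyM⟩ := mem_closure_iff_nhds.1 hz _ (analytic_relclosed hA hzD hzA)
  exact hy (hM hyM)

theorem analytic_inter {N : ℕ} {D A A' : Set (CE N)} (hA : IsAnalyticSet D A) (hA' : IsAnalyticSet D A') :
    IsAnalyticSet D (A ∩ A') := by
  classical
  refine ⟨fun z hz => hA.1 hz.1, fun z hz => ?_⟩
  obtain ⟨U, hU, hzU, hUD, s, hs, hAU⟩ := hA.2 z hz
  obtain ⟨U', hU', hzU', hUD', s', hs', hAU'⟩ := hA'.2 z hz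
  refine ⟨U ∩ U', hU.inter hU', ⟨hzU, hzU'⟩, fun y hy => hUD hy.1, s ∪ s', ?_, ?_⟩
  · intro f hf
    rcases Finset.mem_union.1 hf with h | h
    · exact (hs f h).mono inter_subset_left
    · exact (hs' f h).mono inter_subset_right
  · ext y
    have e1 : y ∈ A ∩ U ↔ y ∈ {w | w ∈ U ∧ ∀ f ∈ s, f w = 0} := by rw [hAU]
    have e2 : y ∈ A' ∩ U' ↔ y ∈ {w | w ∈ U' ∧ ∀ f ∈ s', f w = 0} := by rw [hAU']
    simp only [mem_inter_iff, mem_ofPred_eq, Finset.mem_union] at e1 e2 ⊢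
    constructor
    · rintro ⟨⟨h1, h2⟩, h3, h4⟩
      refine ⟨⟨h3, h4⟩, fun f hf => ?_⟩
      rcases hf with hf | hf
      · exact (e1.1 ⟨h1, h3⟩).2 f hf
      · exact (e2.1 ⟨h2, h4⟩).2 f hf
    · rintro ⟨⟨h3, h4⟩, h5⟩
      exact ⟨⟨(e1.2 ⟨h3, fun f hf => h5 f (Or.inl hf)⟩).1, (e2.2 ⟨h4, fun f hf => h5 f (Or.inr hf)⟩).1⟩, h3, h4⟩

/-- local identity principle -/
theorem IsCov.idLocal (h : IsCov hk Q δ) {D A : Set (CE N)} (hA : IsAnalyticSet D A) {z : CE N}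
    (hz : z ∈ XO hk Q δ) (hzD : z ∈ D) :
    ∃ O ∈ 𝓝 z, (∃ t ∈ O ∩ XQ hk Q, ∀ᶠ y in 𝓝 t, y ∈ XQ hk Q → y ∈ A) → ∀ t ∈ O, t ∈ XQ hk Q → t ∈ A := by
  obtain ⟨U, hU, hzU, hUD, s, hs, hAU⟩ := hA.2 z hzD
  obtain ⟨ρ, σ, hρ, hσ0, hσa, hσ, hσu⟩ := h.chartBall hz (hU.mem_nhds hzU)
  refine ⟨_, hσu, ?_⟩
  rintro ⟨t, ⟨htO, htX⟩, ht⟩ t' ht' htX'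
  obtain ⟨htB, htσ⟩ := htO htX
  obtain ⟨htB', htσ'⟩ := ht' htX'
  have key : ∀ f ∈ s, f (σ (prK hk t')) = 0 := by
    intro f hf
    have hfa : AnalyticOnNhd ℂ (fun x => f (σ x)) (Metric.ball (prK hk z) ρ) := fun x hx =>
      AnalyticAt.fun_comp (hs f hf _ (hσ x hx).2.1) (hσa x hx)
    have hzero : (fun x => f (σ x)) =ᶠ[𝓝 (prK hk t)] 0 := by
      have hc : Tendsto σ (𝓝 (prK hk t)) (𝓝 t) := by
        have := (hσa _ htB).continuousAt
        rw [ContinuousAt, ← htσ] at this; exact this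
      filter_upwards [hc.eventually ht, Metric.isOpen_ball.mem_nhds htB] with x hx hxB
      have h3 := hσ x hxB
      have : σ x ∈ A ∩ U := ⟨hx h3.1.1, h3.2.1⟩
      rw [hAU] at this
      exact this.2 f hf
    exact hfa.eqOn_zero_of_preconnected_of_eventuallyEq_zero (convex_ball _ _).isPreconnected htB hzero htB'
  have : σ (prK hk t') ∈ A ∩ U := by
    rw [hAU]
    exact ⟨(hσ _ htB').2.1, key⟩
  rw [htσ']
  exact this.1

/-- identity principle -/
theorem IsCov.ident (h : IsCov hk Q δ) {D A M : Set (CE N)} (hA : IsAnalyticSet D A)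
    (hM : IsPreconnected M) (hMX : M ⊆ XO hk Q δ ∩ D) {t : CE N} (ht : t ∈ M)
    (htA : ∀ᶠ y in 𝓝 t, y ∈ XQ hk Q → y ∈ A) : M ⊆ A := by
  intro z hz
  have := dich (p := fun t => ∀ᶠ y in 𝓝 t, y ∈ XQ hk Q → y ∈ A) hM (fun w hw => ?_) ht hz htA
  · exact this.self_of_nhds (hMX hz).1.1
  · obtain ⟨O, hO, hOA⟩ := h.idLocal hA (hMX hw).1 (hMX hw).2
    by_cases hex : ∃ t ∈ O ∩ XQ hk Q, ∀ᶠ y in 𝓝 t, y ∈ XQ hk Q → y ∈ A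
    · left
      filter_upwards [eventually_mem_nhds_iff.2 hO] with y hy _
      exact mem_of_superset hy (hOA hex)
    · right
      filter_upwards [hO] with y hy hyM hy2
      exact hex ⟨y, ⟨hy, (hMX hyM).1.1⟩, hy2⟩

/-- connected components of the unbranched part are open -/
theorem IsCov.comp_open (h : IsCov hk Q δ) {D : Set (CE N)} (hD : IsOpen D) {z : CE N}
    (hz : z ∈ XO hk Q δ ∩ D) :
    ∀ᶠ y in 𝓝 z, y ∈ XQ hk Q → y ∈ connectedComponentIn (XO hk Q δ ∩ D) z := by
  obtain ⟨ρ, σ, hρ, hσ0, hσa, hσ, hσu⟩ := h.chartBall hz.1 (hD.mem_nhds hz.2)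
  have hpre : IsPreconnected (σ '' Metric.ball (prK hk z) ρ) :=
    (convex_ball _ _).isPreconnected.image σ hσa.continuousOn
  have hsub : σ '' Metric.ball (prK hk z) ρ ⊆ XO hk Q δ ∩ D := by
    rintro _ ⟨x, hx, rfl⟩
    exact ⟨(hσ x hx).1, (hσ x hx).2.1⟩
  have := hpre.subset_connectedComponentIn ⟨_, Metric.mem_ball_self hρ, hσ0⟩ hsub
  filter_upwards [hσu] with y hy hyX
  obtain ⟨h1, h2⟩ := hy hyX
  rw [h2]
  exact this ⟨_, h1, rfl⟩

/-- relatively clopen subsets of the unbranched part -/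
structure IsClp (hk : k ≤ N) (Q : Fin N → Polynomial (MvPolynomial (Fin k) ℂ)) (δ : MvPolynomial (Fin k) ℂ)
    (D E : Set (CE N)) : Prop where
  sub : E ⊆ XO hk Q δ ∩ D
  opn : ∀ z ∈ E, ∀ᶠ y in 𝓝 z, y ∈ XQ hk Q → y ∈ E
  cls : ∀ z ∈ XO hk Q δ ∩ D, z ∉ E → ∀ᶠ y in 𝓝 z, y ∉ E

theorem IsCov.comp_clp (h : IsCov hk Q δ) {D : Set (CE N)} (hD : IsOpen D) (w : CE N) :
    IsClp hk Q δ D (connectedComponentIn (XO hk Q δ ∩ D) w) := by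
  refine ⟨connectedComponentIn_subset _ _, ?_, ?_⟩
  · intro z hz
    rw [connectedComponentIn_eq hz]
    exact h.comp_open hD (connectedComponentIn_subset _ _ hz)
  · intro z hz hzw
    filter_upwards [h.comp_open hD hz] with y hy hyw
    have h1 := hy (connectedComponentIn_subset _ _ hyw).1.1
    have e : connectedComponentIn (XO hk Q δ ∩ D) w = connectedComponentIn (XO hk Q δ ∩ D) z := by
      rw [connectedComponentIn_eq hyw, connectedComponentIn_eq h1]
    rw [e] at hzw
    exact hzw (mem_connectedComponentIn hz)

theorem IsClp.compl {D E : Set (CE N)} (hE : IsClp hk Q δ D E) (hD : IsOpen D) :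
    IsClp hk Q δ D ((XO hk Q δ ∩ D) \ E) := by
  refine ⟨fun z hz => hz.1, ?_, ?_⟩
  · intro z hz
    have h1 : ∀ᶠ y in 𝓝 z, eval (prK hk y) δ ≠ 0 := dpi_continuous.continuousAt.eventually_ne hz.1.1.2
    filter_upwards [hE.cls z hz.1 hz.2, h1, hD.mem_nhds hz.1.2] with y hy hy1 hy2 hyX
    exact ⟨⟨⟨hyX, hy1⟩, hy2⟩, hy⟩
  · intro z hz hzE
    have : z ∈ E := by
      by_contra hne
      exact hzE ⟨hz, hne⟩
    filter_upwards [hE.opn z this] with y hy hy2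
    exact hy2.2 (hy hy2.1.1.1)

end

open Set Filter Topology MvPolynomial

section
variable {N k : ℕ} {hk : k ≤ N} {Q : Fin N → Polynomial (MvPolynomial (Fin k) ℂ)} {δ : MvPolynomial (Fin k) ℂ}

/-- the fibre over `x` -/
noncomputable def fibQ (Q : Fin N → Polynomial (MvPolynomial (Fin k) ℂ)) (x : CE k) : Finset (CE N) :=
  Fintype.piFinset fun i => ((Q i).map (eval x)).roots.toFinset

theorem IsCov.mem_fibQ' (h : IsCov hk Q δ) (x : CE k) (z : CE N) :
    z ∈ fibQ Q x ↔ ∀ i, qev (Q i) x (z i) = 0 := by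
  simp only [fibQ, Fintype.mem_piFinset, Multiset.mem_toFinset]
  refine forall_congr' fun i => ?_
  rw [Polynomial.mem_roots ((h.monic i).map _).ne_zero]
  rfl

theorem IsCov.mem_fibQ (h : IsCov hk Q δ) (x : CE k) (z : CE N) :
    z ∈ fibQ Q x ↔ z ∈ XQ hk Q ∧ prK hk z = x := by
  rw [h.mem_fibQ']
  constructor
  · exact fun h2 => h.mem h2
  · rintro ⟨h1, rfl⟩; exact h1

theorem IsCov.card_fibQ (h : IsCov hk Q δ) (x : CE k) :
    (fibQ Q x).card ≤ ∏ i, (Q i).natDegree := by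
  rw [fibQ, Fintype.card_piFinset]
  refine Finset.prod_le_prod' fun i _ => ?_
  refine (Multiset.toFinset_card_le _).trans ((Polynomial.card_roots' _).trans ?_)
  exact Polynomial.natDegree_map_le

open Classical in
/-- the part of the fibre in `E` and in the ball -/
noncomputable def fibE (Q : Fin N → Polynomial (MvPolynomial (Fin k) ℂ)) (E : Set (CE N)) (a : CE N) (ε : ℝ)
    (x : CE k) : Finset (CE N) := (fibQ Q x).filter fun z => z ∈ E ∧ z ∈ Metric.ball a ε

theorem IsCov.mem_fibE (h : IsCov hk Q δ) {E : Set (CE N)} {a : CE N} {ε : ℝ} (x : CE k) (z : CE N) :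
    z ∈ fibE Q E a ε x ↔ (z ∈ XQ hk Q ∧ prK hk z = x) ∧ z ∈ E ∧ z ∈ Metric.ball a ε := by
  classical
  rw [fibE, Finset.mem_filter, h.mem_fibQ]

/-- existence of good boxes -/
theorem IsCov.box (h : IsCov hk Q δ) {D : Set (CE N)} (hD : IsOpen D) {a : CE N} (ha : a ∈ D) :
    ∃ ε ρ : ℝ, 0 < ε ∧ 0 < ρ ∧ Metric.closedBall a ε ⊆ D ∧
      ∀ z ∈ XQ hk Q, prK hk z ∈ Metric.ball (prK hk a) ρ → z ∈ Metric.closedBall a ε → z ∈ Metric.ball a ε := by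
  obtain ⟨ε₀, hε₀, hball⟩ := Metric.isOpen_iff.1 hD a ha
  obtain ⟨ε, hε1, hε2⟩ : ∃ ε ∈ Ioo 0 ε₀, ε ∉ (fun z => dist z a) '' (fibQ Q (prK hk a) : Set (CE N)) := by
    have hinf : (Ioo 0 ε₀).Infinite := Ioo_infinite hε₀
    exact (hinf.sdiff (((fibQ Q (prK hk a)).finite_toSet).image _)).nonempty
  have hcomp : IsCompact (XQ hk Q ∩ Metric.sphere a ε) := (isCompact_sphere a ε).inter_left XQ_closed
  have hcl : IsClosed (prK hk '' (XQ hk Q ∩ Metric.sphere a ε)) := (hcomp.image (prK hk).continuous).isClosed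
  have hnot : prK hk a ∈ (prK hk '' (XQ hk Q ∩ Metric.sphere a ε))ᶜ := by
    rintro ⟨z, ⟨hzX, hzs⟩, hza⟩
    exact hε2 ⟨z, (h.mem_fibQ _ _).2 ⟨hzX, hza⟩, hzs⟩
  obtain ⟨ρ, hρ, hρb⟩ := Metric.isOpen_iff.1 hcl.isOpen_compl _ hnot
  refine ⟨ε, ρ, hε1.1, hρ, fun z hz => hball (lt_of_le_of_lt hz hε1.2), fun z hz hzB hzc => ?_⟩
  refine lt_of_le_of_ne hzc fun heq => hρb hzB ⟨z, ⟨hz, heq⟩, rfl⟩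

/-- local structure of the fibres -/
theorem IsCov.fib_local (h : IsCov hk Q δ) {D E : Set (CE N)} (hE : IsClp hk Q δ D E) {a : CE N} {ε ρ : ℝ}
    (hεD : Metric.closedBall a ε ⊆ D)
    (hbox : ∀ z ∈ XQ hk Q, prK hk z ∈ Metric.ball (prK hk a) ρ → z ∈ Metric.closedBall a ε → z ∈ Metric.ball a ε)
    {x₀ : CE k} (hx₀ : x₀ ∈ Metric.ball (prK hk a) ρ) (hδ : eval x₀ δ ≠ 0) :
    ∃ σ : CE N → CE k → CE N, (∀ w ∈ fibE Q E a ε x₀, AnalyticAt ℂ (σ w) x₀) ∧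
      ∀ᶠ x in 𝓝 x₀, (∀ z, z ∈ fibE Q E a ε x ↔ ∃ w ∈ fibE Q E a ε x₀, σ w x = z) ∧
        InjOn (fun w => σ w x) (fibE Q E a ε x₀ : Set (CE N)) := by
  classical
  have hch : ∀ w, ∃ σ : CE k → CE N, w ∈ fibE Q E a ε x₀ → (σ x₀ = w ∧
      (∀ᶠ x in 𝓝 x₀, AnalyticAt ℂ σ x ∧ σ x ∈ XQ hk Q ∧ prK hk (σ x) = x) ∧
      ∀ᶠ z in 𝓝 w, z ∈ XQ hk Q → z = σ (prK hk z)) := by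
    intro w
    by_cases hw : w ∈ fibE Q E a ε x₀
    · obtain ⟨⟨h1, h2⟩, h3, h4⟩ := (h.mem_fibE _ _).1 hw
      obtain ⟨σ, hσ⟩ := h.chart (hE.sub h3).1
      refine ⟨σ, fun _ => ?_⟩
      rw [h2] at hσ; exact hσ
    · exact ⟨fun _ => 0, fun h' => absurd h' hw⟩
  choose σ hσ using hch
  have hana : ∀ w ∈ fibE Q E a ε x₀, AnalyticAt ℂ (σ w) x₀ := fun w hw => (hσ w hw).2.1.self_of_nhds.1
  refine ⟨σ, hana, ?_⟩
  have hten : ∀ w ∈ fibE Q E a ε x₀, Tendsto (σ w) (𝓝 x₀) (𝓝 w) := by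
    intro w hw
    have := (hana w hw).continuousAt
    rw [ContinuousAt, (hσ w hw).1] at this; exact this
  have hA : ∀ᶠ x in 𝓝 x₀, ∀ w ∈ fibE Q E a ε x₀, σ w x ∈ fibE Q E a ε x := by
    rw [Finset.eventually_all]
    intro w hw
    have hw' := (h.mem_fibE _ _).1 hw
    filter_upwards [(hσ w hw).2.1, (hten w hw).eventually (hE.opn w hw'.2.1),
      (hten w hw).eventually (Metric.isOpen_ball.mem_nhds hw'.2.2)] with x hx1 hx2 hx3
    exact (h.mem_fibE _ _).2 ⟨hx1.2, hx2 hx1.2.1, hx3⟩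
  have hB : ∀ᶠ x in 𝓝 x₀, ∀ z ∈ Metric.closedBall a ε, z ∈ E → prK hk z = x →
      ∃ w ∈ fibE Q E a ε x₀, σ w x = z := by
    refine (isCompact_closedBall a ε).eventually_forall_of_forall_eventually fun z hz => ?_
    have hsnd : Tendsto (fun p : CE k × CE N => p.2) (𝓝 (x₀, z)) (𝓝 z) := continuous_snd.continuousAt
    by_cases hzE : z ∈ E ∧ prK hk z = x₀
    · have hzX := (hE.sub hzE.1).1.1
      have hw : z ∈ fibE Q E a ε x₀ :=
        (h.mem_fibE _ _).2 ⟨⟨hzX, hzE.2⟩, hzE.1, hbox z hzX (by rw [hzE.2]; exact hx₀) hz⟩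
      filter_upwards [hsnd.eventually (hσ z hw).2.2] with p hp hpE hpx
      refine ⟨z, hw, ?_⟩
      rw [← hpx]; exact (hp (hE.sub hpE).1.1).symm
    · by_cases hzx : prK hk z = x₀
      · have hzE' : z ∉ E := fun h' => hzE ⟨h', hzx⟩
        by_cases hzX : z ∈ XQ hk Q
        · have := hE.cls z ⟨⟨hzX, by rw [hzx]; exact hδ⟩, hεD hz⟩ hzE'
          filter_upwards [hsnd.eventually this] with p hp hpE
          exact absurd hpE hp
        · filter_upwards [hsnd.eventually (XQ_closed.isOpen_compl.mem_nhds hzX)] with p hp hpE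
          exact absurd (hE.sub hpE).1.1 hp
      · have hc : Continuous fun p : CE k × CE N => prK hk p.2 - p.1 :=
          ((prK hk).continuous.comp continuous_snd).sub continuous_fst
        have : ∀ᶠ p : CE k × CE N in 𝓝 (x₀, z), prK hk p.2 - p.1 ≠ 0 :=
          hc.continuousAt.eventually_ne (sub_ne_zero.2 hzx)
        filter_upwards [this] with p hp _ hpx
        exact absurd (sub_eq_zero.2 hpx) hp
  have hC : ∀ᶠ x in 𝓝 x₀, ∀ w ∈ fibE Q E a ε x₀, ∀ w' ∈ fibE Q E a ε x₀, w ≠ w' → σ w x ≠ σ w' x := by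
    rw [Finset.eventually_all]
    intro w hw
    rw [Finset.eventually_all]
    intro w' hw'
    by_cases hne : w = w'
    · exact Eventually.of_forall fun x h' => absurd hne h'
    · filter_upwards [((hten w hw).sub (hten w' hw')).eventually_ne (sub_ne_zero.2 hne)] with x hx _
      exact sub_ne_zero.1 hx
  filter_upwards [hA, hB, hC] with x hxA hxB hxC
  refine ⟨fun z => ⟨fun hz => ?_, ?_⟩, ?_⟩
  · have hz' := (h.mem_fibE _ _).1 hz
    exact hxB z (Metric.ball_subset_closedBall hz'.2.2) hz'.2.1 hz'.1.2
  · rintro ⟨w, hw, rfl⟩; exact hxA w hw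
  · intro w hw w' hw' heq
    by_contra hne
    exact hxC w hw w' hw' hne heq

/-- product over the fibre of the differences of a linear form -/
noncomputable def prodE (Q : Fin N → Polynomial (MvPolynomial (Fin k) ℂ)) (hk : k ≤ N) (E : Set (CE N)) (a : CE N) (ε : ℝ)
    (l : CE N →L[ℂ] ℂ) (z : CE N) : ℂ := ∏ w ∈ fibE Q E a ε (prK hk z), l (z - w)

theorem IsCov.prodE_diff (h : IsCov hk Q δ) {D E : Set (CE N)} (hE : IsClp hk Q δ D E) {a : CE N} {ε ρ : ℝ}
    (hεD : Metric.closedBall a ε ⊆ D)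
    (hbox : ∀ z ∈ XQ hk Q, prK hk z ∈ Metric.ball (prK hk a) ρ → z ∈ Metric.closedBall a ε → z ∈ Metric.ball a ε)
    (l : CE N →L[ℂ] ℂ) {z₀ : CE N} (hz₀ : prK hk z₀ ∈ Metric.ball (prK hk a) ρ) (hδ : eval (prK hk z₀) δ ≠ 0) :
    DifferentiableAt ℂ (prodE Q hk E a ε l) z₀ := by
  classical
  obtain ⟨σ, hσa, hσ⟩ := h.fib_local hE hεD hbox hz₀ hδ
  have heq : prodE Q hk E a ε l =ᶠ[𝓝 z₀] fun z => ∏ w ∈ fibE Q E a ε (prK hk z₀), l (z - σ w (prK hk z)) := by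
    filter_upwards [(prK hk).continuous.continuousAt.eventually hσ] with z hz
    have e : fibE Q E a ε (prK hk z) = (fibE Q E a ε (prK hk z₀)).image (fun w => σ w (prK hk z)) := by
      ext y
      rw [hz.1 y, Finset.mem_image]
    rw [prodE, e, Finset.prod_image]
    exact hz.2
  refine DifferentiableAt.congr_of_eventuallyEq ?_ heq
  have hd : ∀ w ∈ fibE Q E a ε (prK hk z₀),
      DifferentiableAt ℂ (fun z => l (z - σ w (prK hk z))) z₀ := by
    intro w hw
    have h1 : DifferentiableAt ℂ (fun z => z - σ w (prK hk z)) z₀ :=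
      differentiableAt_id.fun_sub ((hσa w hw).differentiableAt.fun_comp' z₀ (prK hk).differentiableAt)
    exact l.differentiableAt.fun_comp' z₀ h1
  exact (HasFDerivAt.finsetProd (fun w hw => (hd w hw).hasFDerivAt)).differentiableAt

end

open Set Filter Topology MvPolynomial

/-- the linear form with coefficients `c^j` -/
noncomputable def vform (N : ℕ) (c : ℂ) : CE N →L[ℂ] ℂ :=
  ∑ j : Fin N, c ^ (j : ℕ) • ContinuousLinearMap.proj (R := ℂ) (φ := fun _ : Fin N => ℂ) j

theorem vform_apply (N : ℕ) (c : ℂ) (v : CE N) : vform N c v = ∑ j : Fin N, c ^ (j : ℕ) * v j := by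
  simp [vform]

theorem vform_zeros {N : ℕ} (M : ℕ) {v : CE N} (hv : v ≠ 0) :
    ((Finset.range M).filter fun c : ℕ => vform N (c : ℂ) v = 0).card < N := by
  classical
  set p : Polynomial ℂ := ∑ j : Fin N, Polynomial.C (v j) * Polynomial.X ^ (j : ℕ) with hp
  have hev : ∀ c : ℂ, p.eval c = vform N c v := by
    intro c
    rw [vform_apply, hp, Polynomial.eval_finsetSum]
    refine Finset.sum_congr rfl fun j _ => ?_
    rw [Polynomial.eval_mul, Polynomial.eval_C, Polynomial.eval_pow, Polynomial.eval_X, mul_comm]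
  have hcoef : ∀ j : Fin N, p.coeff j = v j := by
    intro j
    rw [hp, Polynomial.finsetSum_coeff]
    rw [Finset.sum_eq_single j]
    · simp
    · intro i _ hij
      rw [Polynomial.coeff_C_mul_X_pow, if_neg]
      exact fun h => hij (Fin.ext h.symm)
    · simp
  have hp0 : p ≠ 0 := by
    intro h0
    apply hv
    funext j
    rw [← hcoef j, h0]; simp
  have hdeg : p.degree < N := Polynomial.degree_sum_fin_lt v
  have hnd : p.natDegree < N := (Polynomial.natDegree_lt_iff_degree_lt hp0).2 hdeg
  refine lt_of_le_of_lt ?_ hnd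
  refine le_trans ?_ (Polynomial.card_roots' p)
  refine le_trans ?_ (Multiset.toFinset_card_le _)
  refine Finset.card_le_card_of_injOn (fun c : ℕ => (c : ℂ)) ?_ ?_
  · intro c hc
    have := (Finset.mem_filter.1 hc).2
    simp only [Finset.mem_coe, Multiset.mem_toFinset]
    rw [Polynomial.mem_roots hp0, Polynomial.IsRoot, hev]
    exact this
  · intro c _ c' _ h
    exact Nat.cast_injective (R := ℂ) h

theorem vform_quant {N : ℕ} (M : ℕ) {K : Set (CE N)} (hK : IsCompact K) (h0 : (0 : CE N) ∉ K) :
    ∃ κ : ℝ, 0 < κ ∧ ∀ v ∈ K, ((Finset.range M).filter fun c : ℕ => ‖vform N (c : ℂ) v‖ < κ).card < N := by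
  classical
  refine hK.induction_on (p := fun S => ∃ κ : ℝ, 0 < κ ∧ ∀ v ∈ S,
    ((Finset.range M).filter fun c : ℕ => ‖vform N (c : ℂ) v‖ < κ).card < N) ?_ ?_ ?_ ?_
  · exact ⟨1, one_pos, fun v hv => hv.elim⟩
  · rintro s t hst ⟨κ, h1, h2⟩
    exact ⟨κ, h1, fun v hv => h2 v (hst hv)⟩
  · rintro s t ⟨κ, h1, h2⟩ ⟨κ', h1', h2'⟩
    refine ⟨min κ κ', lt_min h1 h1', fun v hv => ?_⟩
    rcases hv with hv | hv
    · refine lt_of_le_of_lt (Finset.card_le_card fun c hc => ?_) (h2 v hv)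
      rw [Finset.mem_filter] at hc ⊢
      exact ⟨hc.1, hc.2.trans_le (min_le_left _ _)⟩
    · refine lt_of_le_of_lt (Finset.card_le_card fun c hc => ?_) (h2' v hv)
      rw [Finset.mem_filter] at hc ⊢
      exact ⟨hc.1, hc.2.trans_le (min_le_right _ _)⟩
  · intro v₀ hv₀
    have hne : v₀ ≠ 0 := fun h => h0 (h ▸ hv₀)
    have h1 : ∀ c ∈ Finset.range M, ∃ κ : ℝ, 0 < κ ∧ (vform N c v₀ ≠ 0 → ∀ᶠ v in 𝓝 v₀, κ ≤ ‖vform N c v‖) := by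
      intro c _
      by_cases hc : vform N c v₀ = 0
      · exact ⟨1, one_pos, fun h => absurd hc h⟩
      · have hpos : 0 < ‖vform N c v₀‖ := norm_pos_iff.2 hc
        refine ⟨‖vform N c v₀‖ / 2, by positivity, fun _ => ?_⟩
        have : ContinuousAt (fun v => ‖vform N c v‖) v₀ := (vform N c).continuous.norm.continuousAt
        filter_upwards [this.eventually (lt_mem_nhds (half_lt_self hpos))] with v hv using hv.le
    choose! κ hκ1 hκ2 using h1
    obtain ⟨κ₀, hκ₀, hκ₀'⟩ : ∃ κ₀ : ℝ, 0 < κ₀ ∧ ∀ c ∈ Finset.range M, κ₀ ≤ κ c := by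
      have : ∀ T : Finset ℕ, (∀ c ∈ T, 0 < κ c) → ∃ κ₀ : ℝ, 0 < κ₀ ∧ ∀ c ∈ T, κ₀ ≤ κ c := by
        intro T
        induction T using Finset.induction_on with
        | empty => exact fun _ => ⟨1, one_pos, by simp⟩
        | insert a T ha ih =>
          intro hT
          obtain ⟨κ₀, h1, h2⟩ := ih fun c hc => hT c (Finset.mem_insert_of_mem hc)
          refine ⟨min κ₀ (κ a), lt_min h1 (hT a (Finset.mem_insert_self _ _)), fun c hc => ?_⟩
          rcases Finset.mem_insert.1 hc with rfl | hc
          · exact min_le_right _ _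
          · exact (min_le_left _ _).trans (h2 c hc)
      exact this _ fun c hc => hκ1 c hc
    have hev : ∀ᶠ v in 𝓝 v₀, ∀ c ∈ Finset.range M, vform N c v₀ ≠ 0 → κ c ≤ ‖vform N c v‖ := by
      rw [Finset.eventually_all]
      intro c hc
      by_cases h : vform N c v₀ = 0
      · exact Eventually.of_forall fun v h' => absurd h h'
      · filter_upwards [hκ2 c hc h] with v hv _ using hv
    refine ⟨_, mem_nhdsWithin_of_mem_nhds hev, κ₀, hκ₀, fun v hv => ?_⟩
    refine lt_of_le_of_lt (Finset.card_le_card fun c hc => ?_) (vform_zeros M hne)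
    rw [Finset.mem_filter] at hc ⊢
    refine ⟨hc.1, ?_⟩
    by_contra h
    have := hv c hc.1 h
    have := hκ₀' c hc.1
    linarith [hc.2]

section
variable {N k : ℕ} {hk : k ≤ N} {Q : Fin N → Polynomial (MvPolynomial (Fin k) ℂ)} {δ : MvPolynomial (Fin k) ℂ}

theorem dpi_frequently (hk : k ≤ N) (hδ : δ ≠ 0) (z : CE N) : ∃ᶠ y in 𝓝 z, eval (prK hk y) δ ≠ 0 := by
  have h1 : rename (Fin.castLE hk) δ ≠ 0 := fun h0 =>
    hδ (rename_injective _ (Fin.castLE_injective hk) (by rw [h0, map_zero]))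
  have := poly_frequently_ne h1 z
  refine this.mono fun y hy => ?_
  rw [eval_rename] at hy
  exact hy

theorem dpi_analytic (hk : k ≤ N) (δ : MvPolynomial (Fin k) ℂ) (S : Set (CE N)) :
    AnalyticOnNhd ℂ (fun z => eval (prK hk z) δ) S := by
  have := poly_analytic (rename (Fin.castLE hk) δ) S
  simp only [eval_rename] at this
  exact this

/-- closures of relatively clopen subsets are analytic -/
theorem IsCov.closure_analytic (h : IsCov hk Q δ) {D E : Set (CE N)} (hD : IsOpen D) (hE : IsClp hk Q δ D E) :
    IsAnalyticSet D (closure E ∩ D) := by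
  classical
  have hEX : closure E ⊆ XQ hk Q := closure_minimal (fun z hz => (hE.sub hz).1.1) XQ_closed
  refine ⟨inter_subset_right, fun a ha => ?_⟩
  by_cases haX : a ∈ XQ hk Q
  swap
  · refine ⟨D ∩ (XQ hk Q)ᶜ, hD.inter XQ_closed.isOpen_compl, ⟨ha, haX⟩, inter_subset_left,
      {fun _ => 1}, ?_, ?_⟩
    · intro f hf
      rw [Finset.mem_singleton] at hf
      rw [hf]
      exact analyticOnNhd_const
    · ext z
      simp only [Finset.mem_singleton, forall_eq, one_ne_zero, and_false, mem_inter_iff, mem_ofPred_eq,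
        iff_false]
      rintro ⟨⟨h1, _⟩, _, h2⟩
      exact h2 (hEX h1)
  obtain ⟨ε, ρ, hε, hρ, hεD, hbox⟩ := h.box hD ha
  set P : Set (CE N) := Metric.ball a ε ∩ prK hk ⁻¹' Metric.ball (prK hk a) ρ with hP
  have hPo : IsOpen P := Metric.isOpen_ball.inter (Metric.isOpen_ball.preimage (prK hk).continuous)
  have haP : a ∈ P := ⟨Metric.mem_ball_self hε, Metric.mem_ball_self hρ⟩
  have hPD : P ⊆ D := fun z hz => hεD (Metric.ball_subset_closedBall hz.1)
  set d := ∏ i, (Q i).natDegree with hd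
  have hcard : ∀ x, (fibE Q E a ε x).card ≤ d := fun x =>
    (Finset.card_le_card (Finset.filter_subset _ _)).trans (h.card_fibQ x)
  have hdist : ∀ z ∈ P, ∀ w ∈ fibE Q E a ε (prK hk z), ‖z - w‖ ≤ 2 * ε := by
    intro z hz w hw
    have h1 : dist z a < ε := hz.1
    have h2 : dist w a < ε := ((h.mem_fibE _ _).1 hw).2.2
    rw [← dist_eq_norm]
    have := dist_triangle_right z w a
    linarith
  have hex : ∀ c : ℕ, ∃ g, AnalyticOnNhd ℂ g P ∧ ∀ z ∈ P, eval (prK hk z) δ ≠ 0 →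
      g z = prodE Q hk E a ε (vform N c) z := by
    intro c
    refine scv_riemann_ext hPo (dpi_analytic hk δ P) (fun z hz hzδ => h.prodE_diff hE hεD hbox _ hz.2 hzδ)
      (fun z _ => dpi_frequently hk h.dne z) (fun z hz => ?_)
    refine ⟨(max (‖vform N c‖ * (2 * ε)) 1) ^ d, ?_⟩
    filter_upwards [hPo.mem_nhds hz] with y hy _
    rw [prodE, norm_prod]
    calc ∏ w ∈ fibE Q E a ε (prK hk y), ‖vform N c (y - w)‖
        ≤ ∏ w ∈ fibE Q E a ε (prK hk y), max (‖vform N c‖ * (2 * ε)) 1 := by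
          refine Finset.prod_le_prod (fun _ _ => norm_nonneg _) fun w hw => ?_
          refine le_trans ?_ (le_max_left _ _)
          exact ((vform N c).le_opNorm _).trans (mul_le_mul_of_nonneg_left (hdist y hy w hw) (norm_nonneg _))
      _ = (max (‖vform N c‖ * (2 * ε)) 1) ^ (fibE Q E a ε (prK hk y)).card := by rw [Finset.prod_const]
      _ ≤ _ := pow_le_pow_right₀ (le_max_right _ _) (hcard _)
  choose g hga hge using hex
  set M := d * N + 1 with hM
  refine ⟨P, hPo, haP, hPD, (Finset.range M).image g, ?_, ?_⟩
  · intro f hf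
    obtain ⟨c, _, rfl⟩ := Finset.mem_image.1 hf
    exact hga c
  ext z
  simp only [mem_inter_iff, mem_ofPred_eq, Finset.mem_image, forall_exists_index, and_imp,
    forall_apply_eq_imp_iff₂]
  constructor
  · rintro ⟨⟨hzE, hzD⟩, hzP⟩
    refine ⟨hzP, fun c _ => ?_⟩
    by_contra hne
    obtain ⟨y, ⟨hy1, hy2⟩, hyE⟩ := mem_closure_iff_nhds.1 hzE _
      (inter_mem ((hga c z hzP).continuousAt.eventually_ne hne) (hPo.mem_nhds hzP))
    have hyX := (hE.sub hyE).1
    apply hy1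
    rw [hge c y hy2 hyX.2, prodE]
    exact Finset.prod_eq_zero ((h.mem_fibE _ _).2 ⟨⟨hyX.1, rfl⟩, hyE, hy2.1⟩) (by simp)
  · rintro ⟨hzP, hz⟩
    refine ⟨⟨?_, hPD hzP⟩, hzP⟩
    by_contra hzE
    obtain ⟨η, hη, hηb⟩ := Metric.isOpen_iff.1 isClosed_closure.isOpen_compl z hzE
    obtain ⟨κ, hκ, hκb⟩ := vform_quant (N := N) M
      (K := Metric.closedBall 0 (2 * ε) ∩ (Metric.ball 0 (η / 2))ᶜ)
      ((isCompact_closedBall 0 (2 * ε)).inter_right Metric.isOpen_ball.isClosed_compl)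
      (fun h0 => h0.2 (Metric.mem_ball_self (by positivity)))
    have hm : 0 < (min κ 1) ^ d := by positivity
    have hsmall : ∀ᶠ y in 𝓝 z, ∀ c ∈ Finset.range M, ‖g c y‖ < (min κ 1) ^ d := by
      rw [Finset.eventually_all]
      intro c hc
      refine (hga c z hzP).continuousAt.norm.eventually (gt_mem_nhds ?_)
      change ‖g c z‖ < _
      rw [hz c hc, norm_zero]; exact hm
    have hPz : ∀ᶠ y in 𝓝 z, y ∈ P := hPo.mem_nhds hzP
    have hηz : ∀ᶠ y in 𝓝 z, y ∈ Metric.ball z (η / 2) := Metric.ball_mem_nhds z (half_pos hη)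
    obtain ⟨y, hyδ, hyP, hyz, hysm⟩ := ((dpi_frequently hk h.dne z).and_eventually
      (hPz.and (hηz.and hsmall))).exists
    have hw : ∀ w ∈ fibE Q E a ε (prK hk y), y - w ∈ Metric.closedBall 0 (2 * ε) ∩ (Metric.ball (0 : CE N) (η / 2))ᶜ := by
      intro w hw
      refine ⟨by rw [mem_closedBall_zero_iff]; exact hdist y hyP w hw, fun hlt => ?_⟩
      rw [mem_ball_zero_iff, ← dist_eq_norm] at hlt
      have h1 : dist y z < η / 2 := hyz
      refine (show w ∈ (closure E)ᶜ from hηb ?_) (subset_closure ((h.mem_fibE _ _).1 hw).2.1)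
      rw [Metric.mem_ball]
      have := dist_triangle w y z
      rw [dist_comm w y] at this
      linarith
    obtain ⟨c, hc, hcw⟩ : ∃ c ∈ Finset.range M, ∀ w ∈ fibE Q E a ε (prK hk y), κ ≤ ‖vform N c (y - w)‖ := by
      by_contra hne
      push Not at hne
      have hsub : Finset.range M ⊆ (fibE Q E a ε (prK hk y)).biUnion
          fun w => (Finset.range M).filter fun c : ℕ => ‖vform N (c : ℂ) (y - w)‖ < κ := by
        intro c hc
        obtain ⟨w, hw1, hw2⟩ := hne c hc
        exact Finset.mem_biUnion.2 ⟨w, hw1, Finset.mem_filter.2 ⟨hc, hw2⟩⟩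
      have h1 := (Finset.card_le_card hsub).trans (Finset.card_biUnion_le_card_mul _ _ N
        fun w hw1 => (hκb _ (hw w hw1)).le)
      rw [Finset.card_range] at h1
      have h2 := Nat.mul_le_mul_right N (hcard (prK hk y))
      omega
    have h1 := hysm c hc
    rw [hge c y hyP hyδ, prodE, norm_prod] at h1
    refine absurd h1 (not_lt.2 ?_)
    calc (min κ 1) ^ d ≤ (min κ 1) ^ (fibE Q E a ε (prK hk y)).card :=
          pow_le_pow_of_le_one (by positivity) (min_le_right _ _) (hcard _)
      _ = ∏ w ∈ fibE Q E a ε (prK hk y), min κ 1 := by rw [Finset.prod_const]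
      _ ≤ _ := Finset.prod_le_prod (fun _ _ => by positivity) fun w hw1 => (min_le_left _ _).trans (hcw w hw1)

/-- local finiteness of the components -/
theorem IsCov.comp_finite (h : IsCov hk Q δ) {D E : Set (CE N)} (hD : IsOpen D) (hE : IsClp hk Q δ D E)
    {a : CE N} (ha : a ∈ closure E ∩ D) : ∃ w ∈ E, a ∈ closure (connectedComponentIn (XO hk Q δ ∩ D) w) := by
  classical
  obtain ⟨ε, ρ, hε, hρ, hεD, hbox⟩ := h.box hD ha.2
  set P : Set (CE N) := Metric.ball a ε ∩ prK hk ⁻¹' Metric.ball (prK hk a) ρ with hP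
  have hPo : IsOpen P := Metric.isOpen_ball.inter (Metric.isOpen_ball.preimage (prK hk).continuous)
  have haP : a ∈ P := ⟨Metric.mem_ball_self hε, Metric.mem_ball_self hρ⟩
  obtain ⟨x₁, hx₁, hx₁B⟩ := ((poly_frequently_ne h.dne (prK hk a)).and_eventually
    (Metric.ball_mem_nhds _ hρ)).exists
  have hsub : P ∩ E ⊆ ⋃ w ∈ {w ∈ (fibQ Q x₁ : Set (CE N)) | w ∈ E}, connectedComponentIn (XO hk Q δ ∩ D) w := by
    rintro z ⟨hzP, hzE⟩
    set M := connectedComponentIn (XO hk Q δ ∩ D) z with hM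
    have hzM : z ∈ M := mem_connectedComponentIn (hE.sub hzE)
    have hclp : IsClp hk Q δ D M := h.comp_clp hD z
    have hcon : ∃ w, w ∈ fibE Q M a ε x₁ := by
      refine dich (p := fun x => ∃ w, w ∈ fibE Q M a ε x) (ball_diff_preconnected h.dne (prK hk a) ρ) (fun x hx => ?_)
        (a := prK hk z) ⟨hzP.2, (hE.sub hzE).1.2⟩ ⟨hx₁B, hx₁⟩ ⟨z, ?_⟩
      · obtain ⟨σ, _, hσ⟩ := h.fib_local hclp hεD hbox hx.1 hx.2
        by_cases hne : ∃ w, w ∈ fibE Q M a ε x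
        · left
          obtain ⟨w, hw⟩ := hne
          filter_upwards [hσ] with y hy _
          exact ⟨σ w y, (hy.1 _).2 ⟨w, hw, rfl⟩⟩
        · right
          filter_upwards [hσ] with y hy _ ⟨w, hw⟩
          obtain ⟨w', hw', _⟩ := (hy.1 _).1 hw
          exact hne ⟨w', hw'⟩
      · exact (h.mem_fibE _ _).2 ⟨⟨(hE.sub hzE).1.1, rfl⟩, hzM, hzP.1⟩
    obtain ⟨w, hw⟩ := hcon
    have hw' := (h.mem_fibE _ _).1 hw
    have hMw : M = connectedComponentIn (XO hk Q δ ∩ D) w := connectedComponentIn_eq hw'.2.1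
    -- `M ⊆ E`
    have hME : M ⊆ E := by
      intro y hy
      refine dich (p := fun y => y ∈ E) isPreconnected_connectedComponentIn (fun t ht => ?_) hzM hy hzE
      have ht' := connectedComponentIn_subset _ _ ht
      by_cases htE : t ∈ E
      · left
        filter_upwards [hE.opn t htE] with u hu huM
        exact hu (connectedComponentIn_subset _ _ huM).1.1
      · right
        filter_upwards [hE.cls t ht' htE] with u hu _ using hu
    refine mem_iUnion₂.2 ⟨w, ⟨(h.mem_fibQ _ _).2 hw'.1, hME hw'.2.1⟩, ?_⟩
    rw [← hMw]; exact hzM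
  have h1 : a ∈ closure (P ∩ E) := by
    rw [mem_closure_iff_nhds]
    intro t ht
    obtain ⟨y, hy, hyE⟩ := mem_closure_iff_nhds.1 ha.1 _ (inter_mem ht (hPo.mem_nhds haP))
    exact ⟨y, hy.1, hy.2, hyE⟩
  have h2 := closure_mono hsub h1
  have hfin : {w ∈ (fibQ Q x₁ : Set (CE N)) | w ∈ E}.Finite := (fibQ Q x₁).finite_toSet.subset fun w hw => hw.1
  rw [hfin.closure_biUnion] at h2
  obtain ⟨w, hw, hwa⟩ := mem_iUnion₂.1 h2
  exact ⟨w, hw.2, hwa⟩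

end

open Set Filter Topology MvPolynomial

theorem open_of_inj {k : ℕ} {f : CE k → CE k} {f' : CE k →L[ℂ] CE k} {t : CE k} (hf : HasStrictFDerivAt f f' t)
    (hinj : Function.Injective f') : map f (𝓝 t) = 𝓝 (f t) := by
  let e : CE k ≃L[ℂ] CE k := (LinearEquiv.ofInjectiveEndo (f' : CE k →ₗ[ℂ] CE k) hinj).toContinuousLinearEquiv
  have he : (e : CE k →L[ℂ] CE k) = f' := by
    ext1 v; rfl
  rw [← he] at hf
  exact hf.map_nhds_eq_of_equiv

section
variable {N k : ℕ} {hk : k ≤ N} {Q : Fin N → Polynomial (MvPolynomial (Fin k) ℂ)} {δ : MvPolynomial (Fin k) ℂ}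

/-- near a `k`-regular point of `Y` in the unbranched part, `X = Y` -/
theorem IsCov.reg_open (h : IsCov hk Q δ) {Y : Set (CE N)} (hYX : Y ⊆ XQ hk Q) {b : CE N} (hb : b ∈ Y)
    (hbX : b ∈ XO hk Q δ) (hreg : IsSubmanifoldPtOfDim Y k b) : ∀ᶠ y in 𝓝 b, y ∈ XQ hk Q → y ∈ Y := by
  obtain ⟨g, p, U, V, hU, hV, hbV, hg, hp, hgm, hpg, hgp⟩ := subm_param hk hreg hb
  obtain ⟨σ, hσ0, hσ, hσu⟩ := h.chart hbX
  obtain ⟨hbU, hgb⟩ := hgp b ⟨hb, hbV⟩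
  have hga := hg _ hbU
  have hgt : Tendsto g (𝓝 (p b)) (𝓝 b) := by
    have := hga.continuousAt
    rw [ContinuousAt, hgb] at this; exact this
  have hfa : AnalyticAt ℂ (fun t => prK hk (g t)) (p b) := ((prK hk).analyticAt _).fun_comp hga
  have hσb : AnalyticAt ℂ σ (prK hk b) := hσ.self_of_nhds.1
  have hqa : AnalyticAt ℂ (fun x => p (σ x)) (prK hk b) :=
    AnalyticAt.fun_comp (by rw [hσ0]; exact hp b hbV) hσb
  have hleft : ∀ᶠ t in 𝓝 (p b), g t = σ (prK hk (g t)) := by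
    filter_upwards [hgt.eventually hσu, hU.mem_nhds hbU] with t ht htU
    exact ht (hYX (hgm htU).1)
  have hid : (fun t => p (σ (prK hk (g t)))) =ᶠ[𝓝 (p b)] id := by
    filter_upwards [hleft, hU.mem_nhds hbU] with t ht htU
    rw [← ht, hpg t htU]; rfl
  have hs := hfa.hasStrictFDerivAt
  have hinj : Function.Injective (fderiv ℂ (fun t => prK hk (g t)) (p b)) := by
    have hq' : HasFDerivAt (fun x => p (σ x)) (fderiv ℂ (fun x => p (σ x)) (prK hk b)) (prK hk (g (p b))) := by
      rw [hgb]; exact hqa.differentiableAt.hasFDerivAt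
    have h1 := hq'.comp (p b) hs.hasFDerivAt
    have h2 : HasFDerivAt (fun t => p (σ (prK hk (g t)))) (ContinuousLinearMap.id ℂ (CE k)) (p b) :=
      (hasFDerivAt_id _).congr_of_eventuallyEq hid
    have h3 := h1.unique h2
    intro u v huv
    have h4 := congrArg (fun T : CE k →L[ℂ] CE k => T u) h3
    have h5 := congrArg (fun T : CE k →L[ℂ] CE k => T v) h3
    simp only [ContinuousLinearMap.comp_apply, ContinuousLinearMap.id_apply] at h4 h5
    rw [← h4, ← h5, huv]
  have hmap := open_of_inj hs hinj
  have hbn : ∀ᶠ x in 𝓝 (prK hk b), ∃ t, t ∈ U ∧ g t = σ x := by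
    have h6 : (fun t => prK hk (g t)) '' {t | t ∈ U ∧ g t = σ (prK hk (g t))} ∈ 𝓝 (prK hk (g (p b))) := by
      rw [← hmap]
      refine image_mem_map ?_
      filter_upwards [hleft, hU.mem_nhds hbU] with t ht htU using ⟨htU, ht⟩
    rw [hgb] at h6
    filter_upwards [h6] with x hx
    obtain ⟨t, ht, rfl⟩ := hx
    exact ⟨t, ht.1, ht.2⟩
  filter_upwards [hσu, (prK hk).continuous.continuousAt.eventually hbn] with y hy hy2 hyX
  obtain ⟨t, htU, ht⟩ := hy2
  rw [hy hyX, ← ht]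
  exact (hgm htU).1

/-- `k`-regular points cannot lie inside the branch locus -/
theorem IsCov.reg_dense (h : IsCov hk Q δ) {Y : Set (CE N)} (hYX : Y ⊆ XQ hk Q)
    (hreg : ∀ a ∈ Y, a ∈ closure {b | b ∈ Y ∧ IsSubmanifoldPtOfDim Y k b}) {y : CE N} (hy : y ∈ Y) :
    y ∈ closure (Y ∩ XO hk Q δ) := by
  rw [mem_closure_iff]
  intro O hO hyO
  by_contra hne
  rw [not_nonempty_iff_eq_empty] at hne
  have hzero : ∀ z ∈ Y, z ∈ O → eval (prK hk z) δ = 0 := by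
    intro z hz hzO
    by_contra h0
    have : z ∈ O ∩ (Y ∩ XO hk Q δ) := ⟨hzO, hz, hYX hz, h0⟩
    rw [hne] at this; exact this
  obtain ⟨b, hbO, hbY, hbr⟩ := mem_closure_iff.1 (hreg y hy) O hO hyO
  obtain ⟨g, p, U, V, hU, hV, hbV, hg, hp, hgm, hpg, hgp⟩ := subm_param hk hbr hbY
  obtain ⟨hbU, hgb⟩ := hgp b ⟨hbY, hbV⟩
  have hga := hg _ hbU
  have hgt : Tendsto g (𝓝 (p b)) (𝓝 b) := by
    have := hga.continuousAt
    rw [ContinuousAt, hgb] at this; exact this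
  set L : CE N →L[ℂ] CE k := fderiv ℂ p b with hL
  have hintg : ∀ i : Fin N, IntOn (Y ∩ O) (fun z => prK hk z) (fun z => z i) := fun i =>
    ⟨Q i, h.monic i, fun z hz => hYX hz.1 i⟩
  have hintL : ∀ i : Fin k, IntOn (Y ∩ O) (fun z => prK hk z) (fun z => L z i) := by
    intro i
    have := IntOn.poly (y := fun z : CE N => z) hintg (∑ j : Fin N, MvPolynomial.C (L (Pi.single j 1) i) * MvPolynomial.X j)
    convert this using 2 with z
    have e : z = ∑ j, z j • (Pi.single j 1 : CE N) := by
      ext l; simp [Finset.sum_apply, Pi.single_apply]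
    conv_lhs => rw [e]
    rw [map_sum, Finset.sum_apply, map_sum]
    refine Finset.sum_congr rfl fun j _ => ?_
    rw [map_smul, map_mul, eval_C, eval_X, Pi.smul_apply, smul_eq_mul, mul_comm]
  obtain ⟨q, hq, hq0⟩ := dep_on (x := fun z => prK hk z) (u := fun z => L z) hintL
    (Or.inr ⟨le_rfl, δ, h.dne, fun z hz => hzero z hz.1 hz.2⟩)
  have hfa : AnalyticAt ℂ (fun t => L (g t)) (p b) := (L.analyticAt _).fun_comp hga
  have hs : HasStrictFDerivAt (fun t => L (g t)) (L.comp (fderiv ℂ g (p b))) (p b) :=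
    L.hasStrictFDerivAt.comp (p b) hga.hasStrictFDerivAt
  have hidd : L.comp (fderiv ℂ g (p b)) = ContinuousLinearMap.id ℂ (CE k) := by
    have h1 : HasFDerivAt p L (g (p b)) := by
      rw [hgb]; exact (hp b hbV).differentiableAt.hasFDerivAt
    have h2 := h1.comp (p b) hga.differentiableAt.hasFDerivAt
    have h3 : HasFDerivAt (p ∘ g) (ContinuousLinearMap.id ℂ (CE k)) (p b) := by
      refine (hasFDerivAt_id _).congr_of_eventuallyEq ?_
      filter_upwards [hU.mem_nhds hbU] with t ht using hpg t ht
    exact h2.unique h3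
  rw [hidd] at hs
  have hmap := open_of_inj hs (fun u v huv => huv)
  have hn : (fun t => L (g t)) '' {t | t ∈ U ∧ g t ∈ O} ∈ 𝓝 (L (g (p b))) := by
    rw [← hmap]
    refine image_mem_map ?_
    filter_upwards [hU.mem_nhds hbU, hgt.eventually (hO.mem_nhds hbO)] with t ht ht2 using ⟨ht, ht2⟩
  obtain ⟨x, hx, t, ht, rfl⟩ := ((poly_frequently_ne hq (L (g (p b)))).and_eventually hn).exists
  exact hx (hq0 _ ⟨(hgm ht.1).1, ht.2⟩)

/-- the main theorem on components of the covering -/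
theorem IsCov.components (h : IsCov hk Q δ) {D Y : Set (CE N)} (hD : IsOpen D) (hY : IsAnalyticSet D Y)
    (hYX : Y ⊆ XQ hk Q) (hreg : ∀ a ∈ Y, a ∈ closure {b | b ∈ Y ∧ IsSubmanifoldPtOfDim Y k b}) :
    IsUnionOfComponents D (XQ hk Q ∩ D) Y := by
  set E := Y ∩ XO hk Q δ with hEdef
  have hE : IsClp hk Q δ D E := by
    refine ⟨fun z hz => ⟨hz.2, hY.1 hz.1⟩, fun z hz => ?_, fun z hz hzE => ?_⟩
    · have hzD := hY.1 hz.1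
      have hδn : ∀ᶠ y in 𝓝 z, eval (prK hk y) δ ≠ 0 := dpi_continuous.continuousAt.eventually_ne hz.2.2
      obtain ⟨O, hO, hOY⟩ := h.idLocal hY hz.2 hzD
      obtain ⟨b, ⟨hbO, hbδ⟩, hbY, hbr⟩ := mem_closure_iff_nhds.1 (hreg z hz.1) _ (inter_mem hO hδn)
      have hT := h.reg_open hYX hbY ⟨hYX hbY, hbδ⟩ hbr
      have hall := hOY ⟨b, ⟨hbO, hYX hbY⟩, hT⟩
      filter_upwards [hO, hδn] with y hyO hyδ hyX
      exact ⟨hall y hyO hyX, hyX, hyδ⟩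
    · have : z ∉ Y := fun h' => hzE ⟨h', hz.1⟩
      filter_upwards [analytic_relclosed hY hz.2 this] with y hy hyE
      exact hy hyE.1
  have hEY : closure E ∩ D = Y := by
    refine subset_antisymm (analytic_closure hY inter_subset_left) fun y hy => ⟨h.reg_dense hYX hreg hy, hY.1 hy⟩
  have hXD : XQ hk Q ∩ D ⊆ closure (XO hk Q δ ∩ D) := by
    rintro z ⟨hzX, hzD⟩
    rw [mem_closure_iff_nhds]
    intro t ht
    obtain ⟨y, hy, hyX⟩ := mem_closure_iff_nhds.1 (h.dense hzX) _ (inter_mem ht (hD.mem_nhds hzD))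
    exact ⟨y, hy.1, hyX, hy.2⟩
  refine ⟨{C | ∃ w ∈ E, C = closure (connectedComponentIn (XO hk Q δ ∩ D) w) ∩ D}, ?_, ?_⟩
  · rintro C ⟨w, hw, rfl⟩
    set M := connectedComponentIn (XO hk Q δ ∩ D) w with hM
    have hMclp : IsClp hk Q δ D M := h.comp_clp hD w
    have hwM : w ∈ M := mem_connectedComponentIn (hE.sub hw)
    have hwD : w ∈ D := hY.1 hw.1
    have hCan : IsAnalyticSet D (closure M ∩ D) := h.closure_analytic hD hMclp
    have hwC : w ∈ closure M ∩ D := ⟨subset_closure hwM, hwD⟩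
    refine ⟨⟨hCan, ⟨w, hwC⟩, ?_⟩, ?_, ?_⟩
    · intro A B hA hB hAB
      by_cases hMA : M ⊆ A
      · left
        refine subset_antisymm (analytic_closure hA hMA) ?_
        rw [hAB]; exact subset_union_left
      · right
        obtain ⟨t, htM, htA⟩ := not_subset.1 hMA
        have htD := (hMclp.sub htM).2
        have hMB : M ⊆ B := by
          refine h.ident hB isPreconnected_connectedComponentIn hMclp.sub htM ?_
          filter_upwards [hMclp.opn t htM, analytic_relclosed hA htD htA] with y hy hyA hyX
          have hyM := hy hyX
          have : y ∈ A ∪ B := by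
            rw [← hAB]; exact ⟨subset_closure hyM, (hMclp.sub hyM).2⟩
          exact this.resolve_left hyA
        refine subset_antisymm (analytic_closure hB hMB) ?_
        rw [hAB]; exact subset_union_right
    · refine inter_subset_inter_left _ (closure_minimal (fun z hz => (hMclp.sub hz).1.1) XQ_closed)
    · intro C' hC' hCC' hC'X
      have hcomp : IsClp hk Q δ D ((XO hk Q δ ∩ D) \ M) := hMclp.compl hD
      have hA := analytic_inter hC'.1 hCan
      have hB := analytic_inter hC'.1 (h.closure_analytic hD hcomp)
      have hunion : C' = C' ∩ (closure M ∩ D) ∪ C' ∩ (closure ((XO hk Q δ ∩ D) \ M) ∩ D) := by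
        rw [← inter_union_distrib_left]
        refine (inter_eq_left.2 fun z hz => ?_).symm
        have hz2 := hC'X hz
        have hz3 := hXD hz2
        rw [← union_sdiff_cancel hMclp.sub, closure_union] at hz3
        rcases hz3 with h3 | h3
        · exact Or.inl ⟨h3, hz2.2⟩
        · exact Or.inr ⟨h3, hz2.2⟩
      rcases hC'.2.2 _ _ hA hB hunion with h1 | h1
      · refine subset_antisymm ?_ hCC'
        intro z hz
        rw [h1] at hz
        exact hz.2
      · exfalso
        have hwC' := hCC' hwC
        rw [h1] at hwC'
        obtain ⟨y, hy, hy2⟩ := mem_closure_iff_nhds.1 hwC'.2.1 _ (hMclp.opn w hwM)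
        exact hy2.2 (hy hy2.1.1.1)
  · ext y
    constructor
    · intro hy
      have hy' := hy
      rw [← hEY] at hy'
      obtain ⟨w, hw, hyw⟩ := h.comp_finite hD hE hy'
      exact ⟨_, ⟨w, hw, rfl⟩, hyw, hY.1 hy⟩
    · rintro ⟨C, ⟨w, hw, rfl⟩, hyC⟩
      have hME : connectedComponentIn (XO hk Q δ ∩ D) w ⊆ Y :=
        h.ident hY isPreconnected_connectedComponentIn (connectedComponentIn_subset _ _)
          (mem_connectedComponentIn (hE.sub hw))
          ((hE.opn w hw).mono fun y hy hyX => (hy hyX).1)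
      exact analytic_closure hY hME hyC

end

open Set Filter Topology MvPolynomial

section
variable {N : ℕ}

theorem leq_cont (Φ : CE N ≃ₗ[ℂ] CE N) : Continuous Φ := Φ.toContinuousLinearEquiv.continuous

theorem leq_ana (Φ : CE N ≃ₗ[ℂ] CE N) (z : CE N) : AnalyticAt ℂ (fun z => Φ z) z :=
  (Φ.toContinuousLinearEquiv : CE N →L[ℂ] CE N).analyticAt z

theorem leq_image_eq (Φ : CE N ≃ₗ[ℂ] CE N) (S : Set (CE N)) : Φ '' S = Φ.symm ⁻¹' S :=
  Φ.toEquiv.image_eq_preimage_symm S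

theorem leq_symm_image (Φ : CE N ≃ₗ[ℂ] CE N) (S : Set (CE N)) : Φ.symm '' (Φ '' S) = S :=
  Φ.toEquiv.symm_image_image S

theorem leq_image_symm (Φ : CE N ≃ₗ[ℂ] CE N) (S : Set (CE N)) : Φ '' (Φ.symm '' S) = S :=
  Φ.toEquiv.image_symm_image S

theorem leq_open (Φ : CE N ≃ₗ[ℂ] CE N) {S : Set (CE N)} (hS : IsOpen S) : IsOpen (Φ '' S) := by
  rw [leq_image_eq]; exact hS.preimage (leq_cont Φ.symm)

theorem analytic_image (Φ : CE N ≃ₗ[ℂ] CE N) {D A : Set (CE N)} (hA : IsAnalyticSet D A) :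
    IsAnalyticSet (Φ '' D) (Φ '' A) := by
  classical
  refine ⟨image_mono hA.1, ?_⟩
  rintro _ ⟨z, hz, rfl⟩
  obtain ⟨U, hU, hzU, hUD, s, hs, hAU⟩ := hA.2 z hz
  refine ⟨Φ '' U, leq_open Φ hU, mem_image_of_mem _ hzU, image_mono hUD, s.image fun f w => f (Φ.symm w), ?_, ?_⟩
  · intro f hf
    obtain ⟨f', hf', rfl⟩ := Finset.mem_image.1 hf
    rintro _ ⟨w, hw, rfl⟩
    refine AnalyticAt.fun_comp ?_ (leq_ana Φ.symm _)
    rw [Φ.symm_apply_apply]; exact hs f' hf' w hw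
  · rw [← image_inter Φ.injective, hAU]
    ext w
    simp only [leq_image_eq, mem_preimage, mem_ofPred_eq, Finset.mem_image, forall_exists_index, and_imp,
      forall_apply_eq_imp_iff₂]

theorem irred_image (Φ : CE N ≃ₗ[ℂ] CE N) {D A : Set (CE N)} (hA : IsIrreducibleAnalyticSet D A) :
    IsIrreducibleAnalyticSet (Φ '' D) (Φ '' A) := by
  refine ⟨analytic_image Φ hA.1, hA.2.1.image _, fun B C hB hC h => ?_⟩
  have hB' := analytic_image Φ.symm hB
  have hC' := analytic_image Φ.symm hC
  rw [leq_symm_image] at hB' hC'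
  have h' : A = Φ.symm '' B ∪ Φ.symm '' C := by
    rw [← image_union, ← h, leq_symm_image]
  rcases hA.2.2 _ _ hB' hC' h' with h1 | h1
  · left; rw [h1, leq_image_symm]
  · right; rw [h1, leq_image_symm]

theorem component_image (Φ : CE N ≃ₗ[ℂ] CE N) {D X C : Set (CE N)} (hC : IsIrreducibleComponent D X C) :
    IsIrreducibleComponent (Φ '' D) (Φ '' X) (Φ '' C) := by
  refine ⟨irred_image Φ hC.1, image_mono hC.2.1, fun C' hC' h1 h2 => ?_⟩
  have h3 := irred_image Φ.symm hC'
  rw [leq_symm_image] at h3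
  have h4 := hC.2.2 _ h3 (by rw [← leq_symm_image Φ C]; exact image_mono h1)
    (by rw [← leq_symm_image Φ X]; exact image_mono h2)
  rw [← h4, leq_image_symm]

theorem unionComp_image (Φ : CE N ≃ₗ[ℂ] CE N) {D X A : Set (CE N)} (hA : IsUnionOfComponents D X A) :
    IsUnionOfComponents (Φ '' D) (Φ '' X) (Φ '' A) := by
  obtain ⟨𝒞, h1, h2⟩ := hA
  refine ⟨(fun C => Φ '' C) '' 𝒞, ?_, ?_⟩
  · rintro _ ⟨C, hC, rfl⟩
    exact component_image Φ (h1 C hC)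
  · rw [h2, image_sUnion]

theorem subm_image (Φ : CE N ≃ₗ[ℂ] CE N) {X : Set (CE N)} {d : ℕ} {a : CE N} (h : IsSubmanifoldPtOfDim X d a) :
    IsSubmanifoldPtOfDim (Φ '' X) d (Φ a) := by
  obtain ⟨V, W, φ, ψ, hV, haV, hW, hφ, hψ, hm1, hm2, h1, h2, h3⟩ := h
  refine ⟨Φ '' V, W, fun z => φ (Φ.symm z), fun w => Φ (ψ w), leq_open Φ hV, mem_image_of_mem _ haV, hW, ?_, ?_, ?_, ?_,
    ?_, ?_, ?_⟩
  · rintro _ ⟨w, hw, rfl⟩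
    refine AnalyticAt.fun_comp ?_ (leq_ana Φ.symm _)
    rw [Φ.symm_apply_apply]; exact hφ w hw
  · intro w hw
    exact AnalyticAt.fun_comp (leq_ana Φ _) (hψ w hw)
  · rintro _ ⟨w, hw, rfl⟩
    change φ (Φ.symm (Φ w)) ∈ W
    rw [Φ.symm_apply_apply]; exact hm1 hw
  · intro w hw
    exact mem_image_of_mem _ (hm2 hw)
  · rintro _ ⟨w, hw, rfl⟩
    change Φ (ψ (φ (Φ.symm (Φ w)))) = Φ w
    rw [Φ.symm_apply_apply, h1 w hw]
  · intro w hw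
    change φ (Φ.symm (Φ (ψ w))) = w
    rw [Φ.symm_apply_apply, h2 w hw]
  · rw [← h3, ← image_inter Φ.injective, image_image]
    simp only [Φ.symm_apply_apply]

theorem reg_image (Φ : CE N ≃ₗ[ℂ] CE N) {X : Set (CE N)} {k : ℕ}
    (h : ∀ a ∈ X, a ∈ closure {b | b ∈ X ∧ IsSubmanifoldPtOfDim X k b}) :
    ∀ a ∈ Φ '' X, a ∈ closure {b | b ∈ Φ '' X ∧ IsSubmanifoldPtOfDim (Φ '' X) k b} := by
  rintro _ ⟨a, ha, rfl⟩
  have h1 : Φ a ∈ closure (Φ '' {b | b ∈ X ∧ IsSubmanifoldPtOfDim X k b}) :=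
    image_closure_subset_closure_image (leq_cont Φ) (mem_image_of_mem _ (h a ha))
  refine closure_mono ?_ h1
  rintro _ ⟨b, hb, rfl⟩
  exact ⟨mem_image_of_mem _ hb.1, subm_image Φ hb.2⟩

theorem pureDim_image (Φ : CE N ≃ₗ[ℂ] CE N) {X : Set (CE N)} {k : ℕ} (h : PureDimOf X k) :
    PureDimOf (Φ '' X) k := by
  refine ⟨reg_image Φ h.1, ?_⟩
  rintro _ ⟨b, hb, rfl⟩ d hd
  have := subm_image Φ.symm hd
  rw [leq_symm_image, Φ.symm_apply_apply] at this
  exact h.2 b hb d this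

theorem subm_restrict {X O : Set (CE N)} (hO : IsOpen O) {d : ℕ} {a : CE N} (haO : a ∈ O)
    (h : IsSubmanifoldPtOfDim X d a) : IsSubmanifoldPtOfDim (X ∩ O) d a := by
  obtain ⟨V, W, φ, ψ, hV, haV, hW, hφ, hψ, hm1, hm2, h1, h2, h3⟩ := h
  have hWo : IsOpen (W ∩ ψ ⁻¹' O) := hψ.continuousOn.isOpen_inter_preimage hW hO
  refine ⟨V ∩ O, W ∩ ψ ⁻¹' O, φ, ψ, hV.inter hO, ⟨haV, haO⟩, hWo, hφ.mono inter_subset_left,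
    hψ.mono inter_subset_left, ?_, ?_, fun x hx => h1 x hx.1, fun y hy => h2 y hy.1, ?_⟩
  · intro z hz
    refine ⟨hm1 hz.1, ?_⟩
    change ψ (φ z) ∈ O
    rw [h1 z hz.1]; exact hz.2
  · intro w hw
    exact ⟨hm2 hw.1, hw.2⟩
  · ext u
    constructor
    · rintro ⟨z, ⟨⟨hzX, hzO⟩, hzV, _⟩, rfl⟩
      have h4 : φ z ∈ φ '' (X ∩ V) := mem_image_of_mem _ ⟨hzX, hzV⟩
      rw [h3] at h4
      refine ⟨⟨h4.1, ?_⟩, h4.2⟩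
      change ψ (φ z) ∈ O
      rw [h1 z hzV]; exact hzO
    · rintro ⟨⟨huW, huO⟩, hu⟩
      have h4 : u ∈ φ '' (X ∩ V) := by rw [h3]; exact ⟨huW, hu⟩
      obtain ⟨z, ⟨hzX, hzV⟩, rfl⟩ := h4
      change ψ (φ z) ∈ O at huO
      rw [h1 z hzV] at huO
      exact ⟨z, ⟨⟨hzX, huO⟩, hzV, huO⟩, rfl⟩

theorem reg_restrict {X O : Set (CE N)} (hO : IsOpen O) {k : ℕ}
    (h : ∀ a ∈ X, a ∈ closure {b | b ∈ X ∧ IsSubmanifoldPtOfDim X k b}) :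
    ∀ a ∈ X ∩ O, a ∈ closure {b | b ∈ X ∩ O ∧ IsSubmanifoldPtOfDim (X ∩ O) k b} := by
  rintro a ⟨haX, haO⟩
  rw [mem_closure_iff_nhds]
  intro t ht
  obtain ⟨y, hy, hyX⟩ := mem_closure_iff_nhds.1 (h a haX) _ (inter_mem ht (hO.mem_nhds haO))
  exact ⟨y, hy.1, ⟨hyX.1, hy.2⟩, subm_restrict hO hy.2 hyX.2⟩

theorem nash_analytic {Ω Y : Set (CE N)} (h : IsNashSet Ω Y) : IsAnalyticSet Ω Y := by
  refine ⟨h.1, fun z hz => ?_⟩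
  obtain ⟨U, h1, h2, h3, s, h4, h5⟩ := h.2 z hz
  exact ⟨U, h1, h2, h3, s, fun f hf => (h4 f hf).1, h5⟩

theorem analytic_restrict {Ω Y D : Set (CE N)} (hD : IsOpen D) (hDΩ : D ⊆ Ω) (h : IsAnalyticSet Ω Y) :
    IsAnalyticSet D (Y ∩ D) := by
  refine ⟨inter_subset_right, fun z hz => ?_⟩
  obtain ⟨U, h1, h2, h3, s, h4, h5⟩ := h.2 z (hDΩ hz)
  refine ⟨U ∩ D, h1.inter hD, ⟨h2, hz⟩, inter_subset_right, s, fun f hf => (h4 f hf).mono inter_subset_left, ?_⟩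
  ext y
  have e1 : y ∈ Y ∩ U ↔ y ∈ {w | w ∈ U ∧ ∀ f ∈ s, f w = 0} := by rw [h5]
  simp only [mem_inter_iff, mem_ofPred_eq] at e1 ⊢
  tauto

/-- a linear form as a polynomial -/
theorem lin_poly (l : CE N →ₗ[ℂ] ℂ) : ∃ p : MvPolynomial (Fin N) ℂ, ∀ z, eval z p = l z := by
  refine ⟨∑ j : Fin N, MvPolynomial.C (l (Pi.single j 1)) * MvPolynomial.X j, fun z => ?_⟩
  have e : z = ∑ j, z j • (Pi.single j 1 : CE N) := by
    ext i; simp [Finset.sum_apply, Pi.single_apply]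
  conv_rhs => rw [e]
  rw [map_sum, map_sum]
  refine Finset.sum_congr rfl fun j _ => ?_
  rw [map_smul, map_mul, eval_C, eval_X, smul_eq_mul, mul_comm]

theorem algebraic_image (Φ : CE N ≃ₗ[ℂ] CE N) {X : Set (CE N)} (h : IsAlgebraicSet X) :
    IsAlgebraicSet (Φ '' X) := by
  classical
  obtain ⟨s, rfl⟩ := h
  have h1 : ∀ i, ∃ p : MvPolynomial (Fin N) ℂ, ∀ z, eval z p = Φ.symm z i := fun i =>
    lin_poly ((LinearMap.proj i).comp (Φ.symm : CE N →ₗ[ℂ] CE N))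
  choose L hL using h1
  refine ⟨s.image (bind₁ L), ?_⟩
  ext w
  simp only [leq_image_eq, mem_preimage, mem_ofPred_eq, Finset.mem_image, forall_exists_index, and_imp,
      forall_apply_eq_imp_iff₂]
  refine forall₂_congr fun p hps => ?_
  clear hps
  have : eval w (bind₁ L p) = eval (Φ.symm w) p := by
    induction p using MvPolynomial.induction_on with
    | C a => simp
    | add p q hp hq => simp only [map_add, hp, hq]
    | mul_X p i hp => simp only [map_mul, hp, bind₁_X_right, hL, eval_X]
  rw [this]

theorem XQ_algebraic {k : ℕ} {hk : k ≤ N} {Q : Fin N → Polynomial (MvPolynomial (Fin k) ℂ)} :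
    IsAlgebraicSet (XQ hk Q) := by
  classical
  have h1 : ∀ i, ∃ p : MvPolynomial (Fin N) ℂ, ∀ z, eval z p = qev (Q i) (fun j => z (Fin.castLE hk j)) (z i) :=
    fun i => qev_poly _ _ _
  choose p hp using h1
  refine ⟨Finset.univ.image p, ?_⟩
  ext z
  simp only [XQ, mem_ofPred_eq, Finset.mem_image, Finset.mem_univ, true_and, forall_exists_index,
    forall_apply_eq_imp_iff, hp]
  rfl

theorem root_bounded {k : ℕ} {q : Polynomial (MvPolynomial (Fin k) ℂ)} (hq : q.Monic) {K : Set (CE k)} (hK : IsCompact K) :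
    ∃ R : ℝ, ∀ x ∈ K, ∀ t, qev q x t = 0 → ‖t‖ ≤ R := by
  have h1 : ∀ i, ∃ C : ℝ, ∀ x ∈ K, ‖eval x (q.coeff i)‖ ≤ C := fun i =>
    hK.exists_bound_of_continuousOn (MvPolynomial.continuous_eval (q.coeff i)).continuousOn
  choose C hC using h1
  have h2 : ∃ B : ℝ, 0 ≤ B ∧ ∀ i ∈ Finset.range q.natDegree, C i ≤ B := by
    refine ⟨∑ i ∈ Finset.range q.natDegree, |C i|, by positivity, fun i hi => ?_⟩
    exact (le_abs_self _).trans (Finset.single_le_sum (f := fun i => |C i|) (fun _ _ => abs_nonneg _) hi)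
  obtain ⟨B, hB0, hB⟩ := h2
  refine ⟨B + 1, fun x hx t ht => ?_⟩
  have hm : (q.map (eval x)).Monic := hq.map _
  have hr : (q.map (eval x)).IsRoot t := ht
  have h3 := hr.norm_lt_cauchyBound hm.ne_zero
  have h4 : (Polynomial.cauchyBound (q.map (eval x)) : ℝ) ≤ B + 1 := by
    rw [Polynomial.cauchyBound, hm.leadingCoeff]
    simp only [nnnorm_one, div_one]
    push_cast
    gcongr
    have h5 : (Finset.range (q.map (eval x)).natDegree).sup (fun i => ‖(q.map (eval x)).coeff i‖₊) ≤ B.toNNReal := by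
      refine Finset.sup_le fun i hi => ?_
      rw [← NNReal.coe_le_coe, coe_nnnorm, Real.coe_toNNReal B hB0, Polynomial.coeff_map]
      have hi' : i ∈ Finset.range q.natDegree := by
        rw [hq.natDegree_map] at hi; exact hi
      exact (hC i x hx).trans (hB i hi')
    have h6 := NNReal.coe_le_coe.2 h5
    rw [Real.coe_toNNReal B hB0] at h6
    exact_mod_cast h6
  have h7 : ‖t‖ < (Polynomial.cauchyBound (q.map (eval x)) : ℝ) := by exact_mod_cast h3
  linarith

end


open Set Filter Topology MvPolynomial

theorem IntOn.add_smul {T : Type*} {ι : Type*} {S : Set T} {x : T → ι → ℂ} {u w : T → ℂ}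
    (hu : IntOn S x u) (hw : IntOn S x w) (c : ℂ) : IntOn S x (fun z => u z + c * w z) := by
  have h : ∀ i : Fin 2, IntOn S x (fun z => (![u z, w z] : Fin 2 → ℂ) i) := by
    intro i
    fin_cases i
    · exact hu
    · exact hw
  have h2 := IntOn.poly (y := fun z => (![u z, w z] : Fin 2 → ℂ)) h (MvPolynomial.X 0 + MvPolynomial.C c * MvPolynomial.X 1)
  simpa using h2

/-- the shear `z ↦ z - z_n w` -/
noncomputable def shearEq {N : ℕ} (n : Fin N) (w : CE N) (hw : w n = 0) : CE N ≃ₗ[ℂ] CE N where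
  toFun z := z - z n • w
  invFun z := z + z n • w
  map_add' a b := by simp only [Pi.add_apply, add_smul]; abel
  map_smul' c a := by simp only [Pi.smul_apply, smul_eq_mul, RingHom.id_apply, smul_sub, mul_smul]
  left_inv z := by simp [hw]
  right_inv z := by simp [hw]

theorem shearEq_apply {N : ℕ} (n : Fin N) (w : CE N) (hw : w n = 0) (z : CE N) :
    shearEq n w hw z = z - z n • w := rfl

theorem norm_step {N k : ℕ} {S : Set (CE N)}
    (hdep : ∀ u : Fin (k + 1) → MvPolynomial (Fin N) ℂ, ∃ p : MvPolynomial (Fin (k + 1)) ℂ, p ≠ 0 ∧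
      ∀ z ∈ S, eval (fun i => eval z (u i)) p = 0) {n : ℕ} (hn : n + 1 ≤ N) (hn2 : n ≤ N) (hkn : k ≤ n)
    (IH : ∀ η : ℝ, 0 < η → ∃ Φ : CE N ≃ₗ[ℂ] CE N, (∀ z, ‖Φ z - z‖ ≤ η * ‖z‖) ∧
      ∀ j, IntOn S (fun z => prK hn (Φ z)) (fun z => Φ z j)) :
    ∀ η : ℝ, 0 < η → ∃ Φ : CE N ≃ₗ[ℂ] CE N, (∀ z, ‖Φ z - z‖ ≤ η * ‖z‖) ∧
      ∀ j, IntOn S (fun z => prK hn2 (Φ z)) (fun z => Φ z j) := by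
  intro η hη
  obtain ⟨η', hη0, hη1, hη3⟩ : ∃ η' : ℝ, 0 < η' ∧ η' ≤ 1 ∧ 3 * η' ≤ η := by
    refine ⟨min 1 (η / 3), by positivity, min_le_left _ _, ?_⟩
    have := min_le_right 1 (η / 3)
    linarith
  obtain ⟨Φ, hΦ, hintg⟩ := IH η' hη0
  let nn : Fin N := ⟨n, hn⟩
  let g : Fin (n + 1) → Fin N := Fin.cons nn (Fin.castLE hn2)
  have h1 : ∀ i : Fin (k + 1), ∃ p : MvPolynomial (Fin N) ℂ, ∀ z, eval z p = Φ z (g (Fin.castLE (by omega) i)) :=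
    fun i => lin_poly ((LinearMap.proj (g (Fin.castLE (by omega) i))).comp (Φ : CE N →ₗ[ℂ] CE N))
  choose u hu using h1
  obtain ⟨p0, hp0, hp0S⟩ := hdep u
  let p1 : MvPolynomial (Fin (n + 1)) ℂ := rename (Fin.castLE (by omega)) p0
  have hp1 : p1 ≠ 0 := by
    intro h
    exact hp0 (rename_injective _ (Fin.castLE_injective _) (by rw [map_zero]; exact h))
  have hp1S : ∀ z ∈ S, eval (fun i => Φ z (g i)) p1 = 0 := by
    intro z hz
    have := hp0S z hz
    simp only [p1, eval_rename]
    simp only [hu] at this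
    exact this
  obtain ⟨τ, hτ, hτ2⟩ := lin_shear hp1
  obtain ⟨v, hv1, hv2⟩ := ((poly_frequently_ne hτ 0).and_eventually (Metric.ball_mem_nhds 0 hη0)).exists
  obtain ⟨a, ha, hmon⟩ := hτ2 v hv1
  let w : CE N := fun i => if h : (i : ℕ) < n then v ⟨i, h⟩ else 0
  have hw : w nn = 0 := by simp [w, nn]
  have hwv : ∀ i : Fin n, w (Fin.castLE hn2 i) = v i := by intro i; simp [w]
  have hwn : ‖w‖ ≤ η' := by
    refine (pi_norm_le_iff_of_nonneg hη0.le).2 fun i => ?_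
    simp only [w]
    split_ifs with h
    · exact (norm_le_pi_norm v _).trans (mem_ball_zero_iff.1 hv2).le
    · simpa using hη0.le
  refine ⟨Φ.trans (shearEq nn w hw), fun z => ?_, ?_⟩
  · rw [LinearEquiv.trans_apply, shearEq_apply]
    have e1 : ‖Φ z‖ ≤ 2 * ‖z‖ := by
      have : Φ z = (Φ z - z) + z := by abel
      rw [this]
      refine (norm_add_le _ _).trans ?_
      nlinarith [hΦ z, norm_nonneg z]
    have e2 : ‖Φ z nn • w‖ ≤ (2 * ‖z‖) * η' := by
      rw [norm_smul]
      exact mul_le_mul ((norm_le_pi_norm _ _).trans e1) hwn (norm_nonneg _) (by positivity)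
    have e3 : Φ z - Φ z nn • w - z = (Φ z - z) - Φ z nn • w := by abel
    rw [e3]
    refine (norm_sub_le _ _).trans ?_
    nlinarith [hΦ z, norm_nonneg z]
  · let y : CE N → CE n := fun z => prK hn2 ((Φ.trans (shearEq nn w hw)) z)
    have hy : ∀ z i, y z i = Φ z (Fin.castLE hn2 i) - Φ z nn * v i := by
      intro z i
      simp only [y, prK_apply, LinearEquiv.trans_apply, shearEq_apply, Pi.sub_apply, Pi.smul_apply, hwv, smul_eq_mul]
    have hn1 : IntOn S y (fun z => Φ z nn) := by
      refine ⟨_, hmon, fun z hz => ?_⟩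
      rw [qev_mul, shearHom_qev]
      have : (Fin.cons (Φ z nn) (y z + Φ z nn • v) : Fin (n + 1) → ℂ) = fun i => Φ z (g i) := by
        funext i
        refine Fin.cases ?_ (fun i => ?_) i
        · simp [g]
        · simp [g, hy]
      rw [this, hp1S z hz, mul_zero]
    have hx : ∀ i : Fin (n + 1), IntOn S y (fun z => prK hn (Φ z) i) := by
      intro i
      refine Fin.lastCases ?_ (fun i => ?_) i
      · exact hn1
      · have := IntOn.add_smul (IntOn.self (S := S) (x := y) i) hn1 (v i)
        refine (congrArg (IntOn S y) ?_).mp this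
        funext z
        rw [hy]
        change _ = Φ z (Fin.castLE hn2 i)
        ring
    intro j
    have hj := IntOn.add_smul (IntOn.trans hx (hintg j)) hn1 (- w j)
    refine (congrArg (IntOn S y) ?_).mp hj
    funext z
    simp only [LinearEquiv.trans_apply, shearEq_apply, Pi.sub_apply, Pi.smul_apply, smul_eq_mul]
    ring

theorem normalization {N k : ℕ} {S : Set (CE N)} (hkN : k ≤ N)
    (hdep : ∀ u : Fin (k + 1) → MvPolynomial (Fin N) ℂ, ∃ p : MvPolynomial (Fin (k + 1)) ℂ, p ≠ 0 ∧
      ∀ z ∈ S, eval (fun i => eval z (u i)) p = 0) :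
    ∀ η : ℝ, 0 < η → ∃ Φ : CE N ≃ₗ[ℂ] CE N, (∀ z, ‖Φ z - z‖ ≤ η * ‖z‖) ∧
      ∀ j, IntOn S (fun z => prK hkN (Φ z)) (fun z => Φ z j) := by
  have key : ∀ d n : ℕ, ∀ hn : n ≤ N, n + d = N → k ≤ n → ∀ η : ℝ, 0 < η → ∃ Φ : CE N ≃ₗ[ℂ] CE N,
      (∀ z, ‖Φ z - z‖ ≤ η * ‖z‖) ∧ ∀ j, IntOn S (fun z => prK hn (Φ z)) (fun z => Φ z j) := by
    intro d
    induction d with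
    | zero =>
      intro n hn hnN hkn η hη
      obtain rfl : n = N := by omega
      refine ⟨LinearEquiv.refl ℂ _, fun z => ?_, fun j => ?_⟩
      · simp only [LinearEquiv.refl_apply, sub_self, norm_zero]; positivity
      · exact IntOn.self (S := S) (x := fun z => prK hn z) j
    | succ d ih =>
      intro n hn hnN hkn
      exact norm_step hdep (by omega : n + 1 ≤ N) hn hkn (ih (n + 1) (by omega) (by omega) (by omega))
  exact key (N - k) k hkN (by omega) le_rfl


open Set Filter Topology MvPolynomial

theorem dep_on_compact {N k : ℕ} {Ω Y S : Set (CE N)} (hkN : k ≤ N) (hY : IsNashSet Ω Y)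
    (hdense : ∀ a ∈ Y, a ∈ closure {b | b ∈ Y ∧ IsSubmanifoldPtOfDim Y k b}) (hS : IsCompact S) (hSY : S ⊆ Y) :
    ∀ u : Fin (k + 1) → MvPolynomial (Fin N) ℂ, ∃ p : MvPolynomial (Fin (k + 1)) ℂ, p ≠ 0 ∧
      ∀ z ∈ S, eval (fun i => eval z (u i)) p = 0 := by
  intro u
  refine hS.induction_on (p := fun S => ∃ p : MvPolynomial (Fin (k + 1)) ℂ, p ≠ 0 ∧
      ∀ z ∈ S, eval (fun i => eval z (u i)) p = 0) ?_ ?_ ?_ ?_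
  · exact ⟨1, one_ne_zero, by simp⟩
  · rintro s t hst ⟨p, hp, h⟩
    exact ⟨p, hp, fun z hz => h z (hst hz)⟩
  · rintro s t ⟨p, hp, h⟩ ⟨q, hq, h'⟩
    refine ⟨p * q, mul_ne_zero hp hq, ?_⟩
    rintro z (hz | hz)
    · rw [map_mul, h z hz, zero_mul]
    · rw [map_mul, h' z hz, mul_zero]
  · intro y hy
    obtain ⟨P, hP, hyP, h⟩ := nash_local hkN hY hdense (hSY hy)
    obtain ⟨p, hp, h2⟩ := h u
    exact ⟨S ∩ P, inter_mem self_mem_nhdsWithin (mem_nhdsWithin_of_mem_nhds (hP.mem_nhds hyP)), p, hp,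
      fun z hz => h2 z ⟨hSY hz.1, hz.2⟩⟩

theorem exists_cov {N k : ℕ} {S : Set (CE N)} (hk : k ≤ N) (Φ : CE N ≃ₗ[ℂ] CE N)
    (hintg : ∀ j, IntOn S (fun z => prK hk (Φ z)) (fun z => Φ z j)) :
    ∃ Q δ, IsCov hk Q δ ∧ Φ '' S ⊆ XQ hk Q := by
  have h1 : ∀ j : Fin N, ∃ (Q : Polynomial (MvPolynomial (Fin k) ℂ)) (δ : MvPolynomial (Fin k) ℂ), Q.Monic ∧ δ ≠ 0 ∧
      (∀ x t, qev Q x t = 0 → qev Q.derivative x t = 0 → eval x δ = 0) ∧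
      (∀ z ∈ S, qev Q (prK hk (Φ z)) (Φ z j) = 0) ∧
      (∀ h : (j : ℕ) < k, ∀ x t, qev Q x t = 0 → t = x ⟨j, h⟩) := by
    intro j
    by_cases hj : (j : ℕ) < k
    · refine ⟨Polynomial.X - Polynomial.C (MvPolynomial.X ⟨j, hj⟩), 1, Polynomial.monic_X_sub_C _, one_ne_zero, ?_, ?_, ?_⟩
      · intro x t _ h
        simp [qev] at h
      · intro z _
        simp [qev, prK_apply]
      · intro _ x t h
        simpa [qev, sub_eq_zero] using h
    · obtain ⟨R, hR, hRS⟩ := hintg j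
      obtain ⟨Q, hQ, hRQ, a, b, δ, hδ, hab⟩ := sqfree_repl hR
      refine ⟨Q, δ, hQ, hδ, ?_, fun z hz => hRQ _ _ (hRS z hz), fun h => absurd h hj⟩
      intro x t h1 h2
      rw [← qev_C δ x t, ← hab, qev_add, qev_mul, qev_mul, h1, h2]; simp
  choose Q δ hQ hδ hsep hS hpr using h1
  refine ⟨Q, ∏ j, δ j, ⟨hQ, Finset.prod_ne_zero_iff.2 fun j _ => hδ j, ?_, ?_⟩, ?_⟩
  · intro i x t h1 h2
    rw [map_prod]
    exact Finset.prod_eq_zero (Finset.mem_univ i) (hsep i x t h1 h2)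
  · intro x z h
    funext i
    rw [prK_apply]
    exact hpr (Fin.castLE hk i) i.2 x _ (h _)
  · rintro _ ⟨z, hz, rfl⟩ i
    exact hS i z hz

theorem norm_le_prod {m : ℕ} {z : CE (m + 1)} {R s : ℝ} (hR0 : 0 ≤ R) (hs : 0 ≤ s) (h1 : ‖projFst m 1 z‖ ≤ R)
    (h2 : ‖z (Fin.last m)‖ ≤ s) : ‖z‖ ≤ R + s := by
  refine (pi_norm_le_iff_of_nonneg (by positivity)).2 fun i => ?_
  refine Fin.lastCases ?_ (fun i => ?_) i
  · linarith
  · have : ‖projFst m 1 z i‖ ≤ R := (norm_le_pi_norm _ i).trans h1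
    change ‖projFst m 1 z i‖ ≤ R + s
    linarith

theorem mem_ball1_iff {m : ℕ} (z : CE (m + 1)) (s : ℝ) : projSnd m 1 z ∈ ball1 s ↔ ‖z (Fin.last m)‖ < s := Iff.rfl

theorem projFst_dist {m : ℕ} (z w : CE (m + 1)) : dist (projFst m 1 z) (projFst m 1 w) ≤ ‖z - w‖ := by
  rw [dist_eq_norm]
  refine (pi_norm_le_iff_of_nonneg (norm_nonneg _)).2 fun i => ?_
  exact norm_le_pi_norm (z - w) (Fin.castAdd 1 i)

theorem projFst_continuous {m : ℕ} : Continuous (projFst m 1) :=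
  continuous_pi fun i => continuous_apply _

theorem prodSet_open {m : ℕ} {U : Set (CE m)} (hU : IsOpen U) (s : ℝ) : IsOpen (prodSet U (ball1 s)) := by
  have e : prodSet U (ball1 s) = projFst m 1 ⁻¹' U ∩ {z | ‖z (Fin.last m)‖ < s} := rfl
  rw [e]
  exact (hU.preimage projFst_continuous).inter (isOpen_lt (continuous_apply _).norm continuous_const)

theorem cov_proper {m k : ℕ} {hk : k ≤ m + 1} (hkm : k ≤ m) {Q : Fin (m + 1) → Polynomial (MvPolynomial (Fin k) ℂ)}
    {δ : MvPolynomial (Fin k) ℂ} (h : IsCov hk Q δ) : ProperProjTo (a := m) (b := 1) (XQ hk Q) univ := by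
  refine ⟨fun _ _ => mem_univ _, fun K hK _ => ?_⟩
  have hc : IsCompact (prK hkm '' K) := hK.image (prK hkm).continuous
  obtain ⟨R, hR⟩ := root_bounded (h.monic (Fin.last m)) hc
  obtain ⟨B, hB⟩ := hK.isBounded.exists_norm_le
  refine Metric.isCompact_of_isClosed_isBounded ?_ ?_
  · exact XQ_closed.inter (hK.isClosed.preimage projFst_continuous)
  · refine isBounded_iff_forall_norm_le.2 ⟨|B| + |R|, ?_⟩
    rintro z ⟨hz, hzK⟩
    refine norm_le_prod (abs_nonneg _) (abs_nonneg _) ((hB _ hzK).trans (le_abs_self _)) ?_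
    exact (hR _ (mem_image_of_mem _ hzK) _ (hz (Fin.last m))).trans (le_abs_self _)

theorem nash_in_algebraic_components (m k : ℕ) (hk : k < m + 1)
    (Ω : Set (CE m)) (hΩ : IsRungeDomain Ω)
    (Y : Set (CE (m + 1))) (hNash : IsNashSet (cylOver 1 Ω) Y)
    (hdim : PureDimOf Y k) (hproper : ProperProjTo Y Ω)
    (Ω₀ : Set (CE m)) (hΩ₀o : IsOpen Ω₀) (hΩ₀c : IsCompact (closure Ω₀))
    (hΩ₀Ω : closure Ω₀ ⊆ Ω) (r : ℝ) (hr : 0 < r) :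
    ∃ Ytil : Set (CE (m + 1)), IsAlgebraicSet Ytil ∧ PureDimOf Ytil k ∧
      IsUnionOfComponents (prodSet Ω₀ (ball1 r)) (Ytil ∩ prodSet Ω₀ (ball1 r))
        (Y ∩ prodSet Ω₀ (ball1 r)) ∧
      ∃ (Φ : CE (m + 1) ≃ₗ[ℂ] CE (m + 1)) (Ω₁ : Set (CE m)) (s : ℝ), 0 < s ∧
        IsRungeDomain Ω₁ ∧
        ProperProjTo (Φ '' Ytil) (univ : Set (CE m)) ∧
        Φ '' prodSet Ω₀ (ball1 r) ⊆ prodSet Ω₁ (ball1 s) ∧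
        IsUnionOfComponents (prodSet Ω₁ (ball1 s)) (Φ '' Ytil ∩ prodSet Ω₁ (ball1 s))
          (Φ '' Y ∩ prodSet Ω₁ (ball1 s)) := by
  obtain ⟨ε0, hε0, hK⟩ := hΩ₀c.exists_cthickening_subset_open hΩ.1.1 hΩ₀Ω
  obtain ⟨Ω₁, hΩ₁, hKΩ₁, L, hL, hΩ₁L, hLΩ⟩ := runge_between hΩ hΩ₀c.cthickening hK
  obtain ⟨ε1, hε1, hL'⟩ := hL.exists_cthickening_subset_open hΩ.1.1 hLΩ
  set L' := Metric.cthickening ε1 L with hL'def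
  have hL'c : IsCompact L' := hL.cthickening
  set s : ℝ := r + 1 with hsdef
  set S : Set (CE (m + 1)) := {z ∈ Y | projFst m 1 z ∈ L'} with hSdef
  have hScomp : IsCompact S := hproper.2 L' hL'c hL'
  have hkN : k ≤ m + 1 := hk.le
  have hdep := dep_on_compact hkN hNash hdim.1 hScomp (fun z hz => hz.1)
  obtain ⟨B, hB⟩ := hL.isBounded.exists_norm_le
  set R : ℝ := |B| + s with hRdef
  have hs0 : 0 < s := by linarith
  have hR0 : 0 < R := by positivity
  have hΩ₀L : Ω₀ ⊆ L := fun x hx =>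
    hΩ₁L (hKΩ₁ (Metric.self_subset_cthickening _ (subset_closure hx)))
  have hbd : ∀ z : CE (m + 1), projFst m 1 z ∈ L → ‖z (Fin.last m)‖ < s → ‖z‖ ≤ R := fun z h1 h2 =>
    norm_le_prod (abs_nonneg _) hs0.le ((hB _ h1).trans (le_abs_self _)) h2.le
  obtain ⟨η, hη, hη1, hη2, hη3, hη4⟩ : ∃ η : ℝ, 0 < η ∧ η ≤ 1 / 2 ∧ η * R ≤ ε0 ∧ η * R ≤ 1 ∧ 2 * (η * R) ≤ ε1 := by
    have hq : 0 < min (min ε0 1) (ε1 / 2) := by positivity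
    refine ⟨min (1 / 2) (min (min ε0 1) (ε1 / 2) / R), by positivity, min_le_left _ _, ?_⟩
    have h1 : min (1 / 2) (min (min ε0 1) (ε1 / 2) / R) * R ≤ min (min ε0 1) (ε1 / 2) :=
      (mul_le_mul_of_nonneg_right (min_le_right _ _) hR0.le).trans (by rw [div_mul_cancel₀ _ hR0.ne'])
    have h2 := (min_le_left (min ε0 1) (ε1 / 2))
    have h3 := (min_le_right (min ε0 1) (ε1 / 2))
    have h4 := min_le_left ε0 1
    have h5 := min_le_right ε0 1
    refine ⟨by linarith, by linarith, by linarith⟩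
  obtain ⟨Φ, hΦ, hintg⟩ := normalization hkN hdep η hη
  obtain ⟨Q, δ, hcov, hSX⟩ := exists_cov hkN Φ hintg
  -- the inclusions
  have hinc1 : Φ '' prodSet Ω₀ (ball1 r) ⊆ prodSet Ω₁ (ball1 s) := by
    rintro _ ⟨z, ⟨hz1, hz2⟩, rfl⟩
    rw [mem_ball1_iff] at hz2
    have hzR : ‖z‖ ≤ R := hbd z (hΩ₀L hz1) (by linarith)
    have hd : ‖Φ z - z‖ ≤ η * R := (hΦ z).trans (mul_le_mul_of_nonneg_left hzR hη.le)
    refine ⟨hKΩ₁ ?_, ?_⟩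
    · exact Metric.mem_cthickening_of_dist_le _ _ _ _ (subset_closure hz1) ((projFst_dist _ _).trans (hd.trans hη2))
    · rw [mem_ball1_iff]
      have h1 : ‖(Φ z - z) (Fin.last m)‖ ≤ 1 := (norm_le_pi_norm _ _).trans (hd.trans hη3)
      have h2 : Φ z (Fin.last m) = (Φ z - z) (Fin.last m) + z (Fin.last m) := by simp
      rw [h2]
      have := norm_add_le ((Φ z - z) (Fin.last m)) (z (Fin.last m))
      linarith
  have hinc2 : ∀ z, Φ z ∈ prodSet Ω₁ (ball1 s) → projFst m 1 z ∈ L' := by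
    rintro z ⟨hz1, hz2⟩
    rw [mem_ball1_iff] at hz2
    have hzR : ‖Φ z‖ ≤ R := hbd _ (hΩ₁L hz1) hz2
    have h1 : ‖z‖ ≤ ‖Φ z‖ + ‖Φ z - z‖ := by
      have : z = Φ z - (Φ z - z) := by abel
      conv_lhs => rw [this]
      exact norm_sub_le _ _
    have h2 := hΦ z
    have h3 : ‖z‖ ≤ 2 * R := by nlinarith [norm_nonneg z]
    have h4 : ‖z - Φ z‖ ≤ ε1 := by
      rw [norm_sub_rev]
      nlinarith
    exact Metric.mem_cthickening_of_dist_le _ _ _ _ (hΩ₁L hz1) ((projFst_dist _ _).trans h4)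
  have hana := nash_analytic hNash
  refine ⟨Φ.symm '' XQ hkN Q, algebraic_image Φ.symm XQ_algebraic, pureDim_image Φ.symm (hcov.pureDim hk), ?_,
    Φ, Ω₁, s, hs0, hΩ₁, ?_, hinc1, ?_⟩
  · have hD := prodSet_open hΩ₀o r
    have h1 : IsAnalyticSet (prodSet Ω₀ (ball1 r)) (Y ∩ prodSet Ω₀ (ball1 r)) :=
      analytic_restrict hD (fun z hz => hΩ₀Ω (subset_closure hz.1)) hana
    have h2 := hcov.components (leq_open Φ hD) (analytic_image Φ h1) ?_ (reg_image Φ (reg_restrict hD hdim.1))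
    · have h3 := unionComp_image Φ.symm h2
      rw [leq_symm_image, leq_symm_image, image_inter Φ.symm.injective, leq_symm_image] at h3
      exact h3
    · refine Subset.trans (image_mono ?_) hSX
      rintro z ⟨hzY, hz⟩
      exact ⟨hzY, Metric.self_subset_cthickening _ (hΩ₀L hz.1)⟩
  · rw [leq_image_symm]
    exact cov_proper (by omega) hcov
  · rw [leq_image_symm]
    have hD := prodSet_open hΩ₁.1.1 s
    refine hcov.components hD (analytic_restrict hD ?_ (analytic_image Φ hana)) ?_
      (reg_restrict hD (reg_image Φ hdim.1))
    · intro w hw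
      refine ⟨Φ.symm w, ?_, Φ.apply_symm_apply w⟩
      exact hL' (hinc2 _ (by rw [Φ.apply_symm_apply]; exact hw))
    · rintro _ ⟨⟨z, hz, rfl⟩, hzD⟩
      exact hSX (mem_image_of_mem _ ⟨hz, hinc2 z hzD⟩)
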